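/- Homotopy transfer for weak Lie 3-algebras: let (L,d,λ) be a weak Lie 3-algebra over a commutative ring k and let (p,i,h) be a deformation retract of (L,d) onto a 3-term chain complex (L′,d′). Then (L′,d′) carries a weak Lie 3-algebra structure λ′ such that i extends to a weak morphism of weak Lie 3-algebras, i.e. there exist maps f2: L′^⊗2 → L of degree 1, f21: L′^⊗2 → L of degree 2 and f3: L′^⊗3 → L of degree 2 such that (i, f2, f21, f3) is a weak morphism (L′,d′,λ′) → (L,d,λ). -/

import Mathlib

namespace WL3

open Finset

/-! ## Graded multilinear maps -/

/-- Cast along an equality of degrees. -/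
def gcast {M : ℤ → Type} {i j : ℤ} (h : i = j) (x : M i) : M j := h ▸ x

/-- A degree-`r`, arity-`m` map between ℤ-graded types, given by its components on
homogeneous tuples: its component at degrees `d` maps `L (d 1) ⊗ ⋯ ⊗ L (d m)` to
`M (r + d 1 + ⋯ + d m)`. -/
abbrev MMap (L M : ℤ → Type) (m : ℕ) (r : ℤ) : Type :=
  ∀ d : Fin m → ℤ, (∀ j, L (d j)) → M (r + ∑ j, d j)

variable {L M N : ℤ → Type}

/-- Cast an `MMap` along equalities of arities and degrees. -/
def mcast {m m' : ℕ} {r r' : ℤ} (hm : m = m') (hr : r = r') (μ : MMap L M m r) :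
    MMap L M m' r' := by subst hm; subst hr; exact μ

/-- Koszul sign of the permutation `σ` acting on a tuple of homogeneous elements of
degrees `d`: `∏_{i<j, σ i > σ j} (-1)^(d i · d j)`. -/
def koszulSign {m : ℕ} (d : Fin m → ℤ) (σ : Equiv.Perm (Fin m)) : ℤ :=
  ∏ p ∈ Finset.univ.filter (fun p : Fin m × Fin m => p.1 < p.2 ∧ σ p.2 < σ p.1),
    (-1 : ℤ) ^ (d p.1 * d p.2).natAbs

/-- The action `μ ↦ μ^σ`, `μ^σ(x₁,…,x_m) = ε(σ;x)·μ(x_{σ⁻¹1},…,x_{σ⁻¹m})`. -/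
def pa [∀ i, AddCommGroup (M i)] {m : ℕ} {r : ℤ} (σ : Equiv.Perm (Fin m)) (μ : MMap L M m r) :
    MMap L M m r := fun d x =>
  koszulSign d σ •
    gcast (by rw [Equiv.sum_comp σ.symm d])
      (μ (fun j => d (σ.symm j)) (fun j => x (σ.symm j)))

/-- Degrees of the outer map in a partial composition. -/
def outDeg (m₁ m₂ n : ℕ) (s : ℤ) (d : Fin (m₁ + n + m₂) → ℤ) : Fin (m₁ + 1 + m₂) → ℤ :=
  Fin.append
    (Fin.append (fun j : Fin m₁ => d (Fin.castAdd m₂ (Fin.castAdd n j)))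
      (fun _ : Fin 1 => s + ∑ j : Fin n, d (Fin.castAdd m₂ (Fin.natAdd m₁ j))))
    (fun j : Fin m₂ => d (Fin.natAdd (m₁ + n) j))

theorem outDeg_left (m₁ m₂ n : ℕ) (s : ℤ) (d : Fin (m₁ + n + m₂) → ℤ) (j : Fin m₁) :
    outDeg m₁ m₂ n s d (Fin.castAdd m₂ (Fin.castAdd 1 j))
      = d (Fin.castAdd m₂ (Fin.castAdd n j)) := by
  simp [outDeg, Fin.append_left]

theorem outDeg_mid (m₁ m₂ n : ℕ) (s : ℤ) (d : Fin (m₁ + n + m₂) → ℤ) (j : Fin 1) :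
    outDeg m₁ m₂ n s d (Fin.castAdd m₂ (Fin.natAdd m₁ j))
      = s + ∑ j : Fin n, d (Fin.castAdd m₂ (Fin.natAdd m₁ j)) := by
  simp [outDeg, Fin.append_left, Fin.append_right]

theorem outDeg_right (m₁ m₂ n : ℕ) (s : ℤ) (d : Fin (m₁ + n + m₂) → ℤ) (j : Fin m₂) :
    outDeg m₁ m₂ n s d (Fin.natAdd (m₁ + 1) j) = d (Fin.natAdd (m₁ + n) j) := by
  simp [outDeg, Fin.append_right]

theorem outDeg_sum (m₁ m₂ n : ℕ) (r s : ℤ) (d : Fin (m₁ + n + m₂) → ℤ) :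
    r + ∑ j, outDeg m₁ m₂ n s d j = (r + s) + ∑ j, d j := by
  simp [outDeg, Fin.sum_univ_add, Fin.append_left, Fin.append_right]
  ring

/-- Partial (operadic) composition `μ ∘_{m₁+1} ν` of `μ` (of arity `m₁ + 1 + m₂`) with `ν`
inserted in the slot `m₁ + 1`, with the Koszul sign `(-1)^(|ν|·(d 1 + ⋯ + d m₁))`. -/
def pcomp [∀ i, AddCommGroup (L i)] [∀ i, AddCommGroup (M i)] (m₁ m₂ : ℕ) {n : ℕ} {r s : ℤ}
    (μ : MMap L M (m₁ + 1 + m₂) r) (ν : MMap L L n s) : MMap L M (m₁ + n + m₂) (r + s) :=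
  fun d x =>
    ((-1 : ℤ) ^ (s * ∑ j : Fin m₁, d (Fin.castAdd m₂ (Fin.castAdd n j))).natAbs) •
    gcast (outDeg_sum m₁ m₂ n r s d)
      (μ (outDeg m₁ m₂ n s d)
        (fun j => Fin.addCases (motive := fun t => L (outDeg m₁ m₂ n s d t))
          (fun j' => Fin.addCases (motive := fun t => L (outDeg m₁ m₂ n s d (Fin.castAdd m₂ t)))
            (fun j1 => gcast (outDeg_left m₁ m₂ n s d j1).symm
              (x (Fin.castAdd m₂ (Fin.castAdd n j1))))
            (fun j0 => gcast (outDeg_mid m₁ m₂ n s d j0).symm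
              (ν (fun j2 => d (Fin.castAdd m₂ (Fin.natAdd m₁ j2)))
                 (fun j2 => x (Fin.castAdd m₂ (Fin.natAdd m₁ j2)))))
            j')
          (fun j3 => gcast (outDeg_right m₁ m₂ n s d j3).symm (x (Fin.natAdd (m₁ + n) j3)))
          j))

/-- Composition `μ ∘ g` of an arity-1 map with an arity-`a` map. -/
def comp₁ {a : ℕ} {r s : ℤ} (μ : MMap M N 1 r) (g : MMap L M a s) : MMap L N a (r + s) :=
  fun d x =>
    gcast (by rw [Fin.sum_univ_one]; ring)
      (μ (fun _ : Fin 1 => s + ∑ j, d j) (fun _ => g d x))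

theorem sum2 (a b : ℕ) (r s₁ s₂ : ℤ) (d : Fin (a + b) → ℤ) :
    r + ∑ t : Fin 2, ![s₁ + ∑ j : Fin a, d (Fin.castAdd b j),
                       s₂ + ∑ j : Fin b, d (Fin.natAdd a j)] t
      = (r + (s₁ + s₂)) + ∑ j, d j := by
  simp [Fin.sum_univ_two, Fin.sum_univ_add]
  ring

/-- Full composition `μ ∘ (g₁, g₂)` with Koszul signs. -/
def comp₂ [∀ i, AddCommGroup (N i)] {a b : ℕ} {r s₁ s₂ : ℤ}
    (μ : MMap M N 2 r) (g₁ : MMap L M a s₁) (g₂ : MMap L M b s₂) :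
    MMap L N (a + b) (r + (s₁ + s₂)) :=
  fun d x =>
    ((-1 : ℤ) ^ (s₂ * ∑ j : Fin a, d (Fin.castAdd b j)).natAbs) •
    gcast (sum2 a b r s₁ s₂ d)
      (μ ![s₁ + ∑ j : Fin a, d (Fin.castAdd b j), s₂ + ∑ j : Fin b, d (Fin.natAdd a j)]
        (Fin.cons (gcast (by simp) (g₁ (fun j => d (Fin.castAdd b j)) (fun j => x (Fin.castAdd b j))))
          (fun _ : Fin 1 => gcast (by simp) (g₂ (fun j => d (Fin.natAdd a j)) (fun j => x (Fin.natAdd a j))))))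

theorem sum3 (a b c : ℕ) (r s₁ s₂ s₃ : ℤ) (d : Fin (a + b + c) → ℤ) :
    r + ∑ t : Fin 3, ![s₁ + ∑ j : Fin a, d (Fin.castAdd c (Fin.castAdd b j)),
                       s₂ + ∑ j : Fin b, d (Fin.castAdd c (Fin.natAdd a j)),
                       s₃ + ∑ j : Fin c, d (Fin.natAdd (a + b) j)] t
      = (r + (s₁ + s₂ + s₃)) + ∑ j, d j := by
  simp [Fin.sum_univ_three, Fin.sum_univ_add]
  ring

/-- Full composition `μ ∘ (g₁, g₂, g₃)` with Koszul signs. -/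
def comp₃ [∀ i, AddCommGroup (N i)] {a b c : ℕ} {r s₁ s₂ s₃ : ℤ}
    (μ : MMap M N 3 r) (g₁ : MMap L M a s₁) (g₂ : MMap L M b s₂) (g₃ : MMap L M c s₃) :
    MMap L N (a + b + c) (r + (s₁ + s₂ + s₃)) :=
  fun d x =>
    ((-1 : ℤ) ^ (s₂ * (∑ j : Fin a, d (Fin.castAdd c (Fin.castAdd b j)))
        + s₃ * ((∑ j : Fin a, d (Fin.castAdd c (Fin.castAdd b j)))
          + ∑ j : Fin b, d (Fin.castAdd c (Fin.natAdd a j)))).natAbs) •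
    gcast (sum3 a b c r s₁ s₂ s₃ d)
      (μ ![s₁ + ∑ j : Fin a, d (Fin.castAdd c (Fin.castAdd b j)),
           s₂ + ∑ j : Fin b, d (Fin.castAdd c (Fin.natAdd a j)),
           s₃ + ∑ j : Fin c, d (Fin.natAdd (a + b) j)]
        (Fin.cons (gcast (by simp)
            (g₁ (fun j => d (Fin.castAdd c (Fin.castAdd b j)))
                (fun j => x (Fin.castAdd c (Fin.castAdd b j)))))
          (Fin.cons (gcast (by simp)
              (g₂ (fun j => d (Fin.castAdd c (Fin.natAdd a j)))
                  (fun j => x (Fin.castAdd c (Fin.natAdd a j)))))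
            (fun _ : Fin 1 => gcast (by simp)
              (g₃ (fun j => d (Fin.natAdd (a + b) j))
                  (fun j => x (Fin.natAdd (a + b) j)))))))

theorem sum4 (a b c e : ℕ) (r s₁ s₂ s₃ s₄ : ℤ) (d : Fin (a + b + c + e) → ℤ) :
    r + ∑ t : Fin 4, ![s₁ + ∑ j : Fin a, d (Fin.castAdd e (Fin.castAdd c (Fin.castAdd b j))),
                       s₂ + ∑ j : Fin b, d (Fin.castAdd e (Fin.castAdd c (Fin.natAdd a j))),
                       s₃ + ∑ j : Fin c, d (Fin.castAdd e (Fin.natAdd (a + b) j)),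
                       s₄ + ∑ j : Fin e, d (Fin.natAdd (a + b + c) j)] t
      = (r + (s₁ + s₂ + s₃ + s₄)) + ∑ j, d j := by
  simp [Fin.sum_univ_four, Fin.sum_univ_add]
  ring

/-- Full composition `μ ∘ (g₁, g₂, g₃, g₄)` with Koszul signs. -/
def comp₄ [∀ i, AddCommGroup (N i)] {a b c e : ℕ} {r s₁ s₂ s₃ s₄ : ℤ}
    (μ : MMap M N 4 r) (g₁ : MMap L M a s₁) (g₂ : MMap L M b s₂) (g₃ : MMap L M c s₃)
    (g₄ : MMap L M e s₄) :
    MMap L N (a + b + c + e) (r + (s₁ + s₂ + s₃ + s₄)) :=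
  fun d x =>
    ((-1 : ℤ) ^ (s₂ * (∑ j : Fin a, d (Fin.castAdd e (Fin.castAdd c (Fin.castAdd b j))))
        + s₃ * ((∑ j : Fin a, d (Fin.castAdd e (Fin.castAdd c (Fin.castAdd b j))))
          + ∑ j : Fin b, d (Fin.castAdd e (Fin.castAdd c (Fin.natAdd a j))))
        + s₄ * ((∑ j : Fin a, d (Fin.castAdd e (Fin.castAdd c (Fin.castAdd b j))))
          + (∑ j : Fin b, d (Fin.castAdd e (Fin.castAdd c (Fin.natAdd a j))))
          + ∑ j : Fin c, d (Fin.castAdd e (Fin.natAdd (a + b) j)))).natAbs) •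
    gcast (sum4 a b c e r s₁ s₂ s₃ s₄ d)
      (μ ![s₁ + ∑ j : Fin a, d (Fin.castAdd e (Fin.castAdd c (Fin.castAdd b j))),
           s₂ + ∑ j : Fin b, d (Fin.castAdd e (Fin.castAdd c (Fin.natAdd a j))),
           s₃ + ∑ j : Fin c, d (Fin.castAdd e (Fin.natAdd (a + b) j)),
           s₄ + ∑ j : Fin e, d (Fin.natAdd (a + b + c) j)]
        (Fin.cons (gcast (by simp)
            (g₁ (fun j => d (Fin.castAdd e (Fin.castAdd c (Fin.castAdd b j))))
                (fun j => x (Fin.castAdd e (Fin.castAdd c (Fin.castAdd b j))))))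
          (Fin.cons (gcast (by simp)
              (g₂ (fun j => d (Fin.castAdd e (Fin.castAdd c (Fin.natAdd a j))))
                  (fun j => x (Fin.castAdd e (Fin.castAdd c (Fin.natAdd a j))))))
            (Fin.cons (gcast (by simp)
                (g₃ (fun j => d (Fin.castAdd e (Fin.natAdd (a + b) j)))
                    (fun j => x (Fin.castAdd e (Fin.natAdd (a + b) j)))))
              (fun _ : Fin 1 => gcast (by simp)
                (g₄ (fun j => d (Fin.natAdd (a + b + c) j))
                    (fun j => x (Fin.natAdd (a + b + c) j))))))))

/-- The differential `∂(μ) = D' ∘ μ - (-1)^{|μ|} ∑ᵢ μ ∘ᵢ D`. -/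
def bdry [∀ i, AddCommGroup (L i)] [∀ i, AddCommGroup (M i)] {m : ℕ} {r : ℤ}
    (D' : MMap M M 1 (-1)) (D : MMap L L 1 (-1)) (μ : MMap L M m r) : MMap L M m (-1 + r) :=
  comp₁ D' μ - ((-1 : ℤ) ^ r.natAbs) •
    ∑ p : Fin m, mcast (by have := p.isLt; omega) (by ring)
      (pcomp p.val (m - 1 - p.val) (mcast (by have := p.isLt; omega) rfl μ) D)

/-- The identity, as an `MMap`. -/
def idm : MMap L L 1 0 := fun d x => gcast (by rw [Fin.sum_univ_one, zero_add]) (x 0)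

/-- `μ ∘_{m₁+1} ν`, recast to a specified target degree `R`. -/
def pc [∀ i, AddCommGroup (L i)] [∀ i, AddCommGroup (M i)] (R : ℤ) (m₁ m₂ : ℕ) {n : ℕ}
    {r s : ℤ} (μ : MMap L M (m₁ + 1 + m₂) r) (ν : MMap L L n s)
    (h : r + s = R := by norm_num) : MMap L M (m₁ + n + m₂) R :=
  mcast rfl h (pcomp m₁ m₂ μ ν)

/-- `μ ∘ g`, recast to a specified target degree `R`. -/
def fc1 (R : ℤ) {a : ℕ} {r s : ℤ} (μ : MMap M N 1 r) (g : MMap L M a s)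
    (h : r + s = R := by norm_num) : MMap L N a R :=
  mcast rfl h (comp₁ μ g)

/-- `μ ∘ (g₁, g₂)`, recast to a specified target degree `R`. -/
def fc2 [∀ i, AddCommGroup (N i)] (R : ℤ) {a b : ℕ} {r s₁ s₂ : ℤ}
    (μ : MMap M N 2 r) (g₁ : MMap L M a s₁) (g₂ : MMap L M b s₂)
    (h : r + (s₁ + s₂) = R := by norm_num) : MMap L N (a + b) R :=
  mcast rfl h (comp₂ μ g₁ g₂)

/-- `μ ∘ (g₁, g₂, g₃)`, recast to a specified target degree `R`. -/
def fc3 [∀ i, AddCommGroup (N i)] (R : ℤ) {a b c : ℕ} {r s₁ s₂ s₃ : ℤ}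
    (μ : MMap M N 3 r) (g₁ : MMap L M a s₁) (g₂ : MMap L M b s₂) (g₃ : MMap L M c s₃)
    (h : r + (s₁ + s₂ + s₃) = R := by norm_num) : MMap L N (a + b + c) R :=
  mcast rfl h (comp₃ μ g₁ g₂ g₃)

/-- `μ ∘ (g₁, g₂, g₃, g₄)`, recast to a specified target degree `R`. -/
def fc4 [∀ i, AddCommGroup (N i)] (R : ℤ) {a b c e : ℕ} {r s₁ s₂ s₃ s₄ : ℤ}
    (μ : MMap M N 4 r) (g₁ : MMap L M a s₁) (g₂ : MMap L M b s₂) (g₃ : MMap L M c s₃)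
    (g₄ : MMap L M e s₄) (h : r + (s₁ + s₂ + s₃ + s₄) = R := by norm_num) :
    MMap L N (a + b + c + e) R :=
  mcast rfl h (comp₄ μ g₁ g₂ g₃ g₄)

/-- `∂(μ)`, recast to a specified target degree `R`. -/
def bd [∀ i, AddCommGroup (L i)] [∀ i, AddCommGroup (M i)] (R : ℤ) {m : ℕ} {r : ℤ}
    (D' : MMap M M 1 (-1)) (D : MMap L L 1 (-1)) (μ : MMap L M m r)
    (h : -1 + r = R := by norm_num) : MMap L M m R :=
  mcast rfl h (bdry D' D μ)

/-- Multilinearity over `k` of the components of an `MMap`. -/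
def IsMultilinear (k : Type) [CommRing k] {L M : ℤ → Type} [∀ i, AddCommGroup (L i)]
    [∀ i, AddCommGroup (M i)] [∀ i, Module k (L i)] [∀ i, Module k (M i)] {m : ℕ} {r : ℤ}
    (μ : MMap L M m r) : Prop :=
  ∀ (d : Fin m → ℤ) (x : ∀ j, L (d j)) (j : Fin m),
    (∀ a b : L (d j), μ d (Function.update x j (a + b))
        = μ d (Function.update x j a) + μ d (Function.update x j b)) ∧
    (∀ (c : k) (a : L (d j)), μ d (Function.update x j (c • a)) = c • μ d (Function.update x j a))

/-! ## Permutations (0-indexed; a cycle `(a b c)` is `swap a b * swap b c`) -/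

def P12 (m : ℕ) [NeZero m] : Equiv.Perm (Fin m) := Equiv.swap 0 1
def P13 (m : ℕ) [NeZero m] : Equiv.Perm (Fin m) := Equiv.swap 0 2
def P23 (m : ℕ) [NeZero m] : Equiv.Perm (Fin m) := Equiv.swap 1 2
def P34 (m : ℕ) [NeZero m] : Equiv.Perm (Fin m) := Equiv.swap 2 3
def P123 (m : ℕ) [NeZero m] : Equiv.Perm (Fin m) := Equiv.swap 0 1 * Equiv.swap 1 2
def P132 (m : ℕ) [NeZero m] : Equiv.Perm (Fin m) := Equiv.swap 0 2 * Equiv.swap 2 1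
def P234 (m : ℕ) [NeZero m] : Equiv.Perm (Fin m) := Equiv.swap 1 2 * Equiv.swap 2 3
def P243 (m : ℕ) [NeZero m] : Equiv.Perm (Fin m) := Equiv.swap 1 3 * Equiv.swap 3 2
def P1234 (m : ℕ) [NeZero m] : Equiv.Perm (Fin m) :=
  Equiv.swap 0 1 * Equiv.swap 1 2 * Equiv.swap 2 3
def P1432 (m : ℕ) [NeZero m] : Equiv.Perm (Fin m) :=
  Equiv.swap 0 3 * Equiv.swap 3 2 * Equiv.swap 2 1
def P1342 (m : ℕ) [NeZero m] : Equiv.Perm (Fin m) :=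
  Equiv.swap 0 2 * Equiv.swap 2 3 * Equiv.swap 3 1
def P13P24 (m : ℕ) [NeZero m] : Equiv.Perm (Fin m) := Equiv.swap 0 2 * Equiv.swap 1 3

end WL3
namespace WL3

open Finset

variable (k : Type) [CommRing k]

/-- A Leibniz 3-algebra structure: maps `l2, l3, l4` on a complex with differential `D`
satisfying the generalized Jacobi identities (L1)–(L4). -/
structure IsLeibniz3 {L : ℤ → Type} [∀ i, AddCommGroup (L i)] [∀ i, Module k (L i)]
    (D : MMap L L 1 (-1)) (l2 : MMap L L 2 0) (l3 : MMap L L 3 1) (l4 : MMap L L 4 2) :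
    Prop where
  lin2 : IsMultilinear k l2
  lin3 : IsMultilinear k l3
  lin4 : IsMultilinear k l4
  eqL1 : bd (-1) D D l2 = 0
  eqL2 : bd 0 D D l3 =
    pc 0 1 0 l2 l2 - pc 0 0 1 l2 l2 - pa (P12 3) (pc 0 1 0 l2 l2)
  eqL3 : bd 1 D D l4 =
    pc 1 0 1 l2 l3 + pc 1 1 0 l2 l3 - pa (P12 4) (pc 1 1 0 l2 l3)
      + pa (P123 4) (pc 1 1 0 l2 l3) - pc 1 0 2 l3 l2
      + pc 1 1 1 l3 l2 - pa (P12 4) (pc 1 1 1 l3 l2)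
      - pc 1 2 0 l3 l2 + pa (P23 4) (pc 1 2 0 l3 l2) - pa (P132 4) (pc 1 2 0 l3 l2)
  eqL4 : (0 : MMap L L 5 2) =
    pc 2 0 1 l2 l4 - pc 2 1 0 l2 l4 + pa (P12 5) (pc 2 1 0 l2 l4)
      - pa (P123 5) (pc 2 1 0 l2 l4) + pa (P1234 5) (pc 2 1 0 l2 l4)
      + pc 2 0 2 l3 l3 + pc 2 1 1 l3 l3 - pa (P12 5) (pc 2 1 1 l3 l3)
      + pa (P123 5) (pc 2 1 1 l3 l3) + pc 2 2 0 l3 l3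
      - pa (P23 5) (pc 2 2 0 l3 l3) + pa (P132 5) (pc 2 2 0 l3 l3)
      + pa (P234 5) (pc 2 2 0 l3 l3) - pa (P1342 5) (pc 2 2 0 l3 l3)
      + pa (P13P24 5) (pc 2 2 0 l3 l3)
      + pc 2 0 3 l4 l2 - pc 2 1 2 l4 l2 + pa (P12 5) (pc 2 1 2 l4 l2)
      + pc 2 2 1 l4 l2 - pa (P23 5) (pc 2 2 1 l4 l2) + pa (P132 5) (pc 2 2 1 l4 l2)
      - pc 2 3 0 l4 l2 + pa (P34 5) (pc 2 3 0 l4 l2) - pa (P243 5) (pc 2 3 0 l4 l2)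
      + pa (P1432 5) (pc 2 3 0 l4 l2)

/-- A weak Lie 3-algebra: a 3-term chain complex equipped with structure maps
`l2, l3, l4, l21, l211, l31, l32` satisfying (L1)–(L4) and (W1)–(W11). -/
structure WeakLie3 (L : ℤ → Type) [∀ i, AddCommGroup (L i)] [∀ i, Module k (L i)] where
  D : MMap L L 1 (-1)
  linD : IsMultilinear k D
  dd : fc1 (-2) D D = 0
  bound : ∀ i : ℤ, (i < 0 ∨ 2 < i) → ∀ x : L i, x = 0
  l2 : MMap L L 2 0
  l3 : MMap L L 3 1
  l4 : MMap L L 4 2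
  l21 : MMap L L 2 1
  l211 : MMap L L 2 2
  l31 : MMap L L 3 2
  l32 : MMap L L 3 2
  leib : IsLeibniz3 k D l2 l3 l4
  lin21 : IsMultilinear k l21
  lin211 : IsMultilinear k l211
  lin31 : IsMultilinear k l31
  lin32 : IsMultilinear k l32
  w1 : bd 0 D D l21 = l2 + pa (P12 2) l2
  w2 : bd 1 D D l211 = l21 - pa (P12 2) l21
  w3 : bd 1 D D l31 = l3 + pa (P12 3) l3 + pc 1 0 1 l2 l21
  w4 : bd 1 D D l32 = l3 + pa (P23 3) l3 - pc 1 1 0 l2 l21 + pc 1 0 1 l21 l2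
        + pa (P12 3) (pc 1 1 0 l21 l2)
  w5 : l211 + pa (P12 2) l211 = 0
  w6 : l31 - pa (P12 3) l31 = pc 2 0 1 l2 l211
  w7 : l31 - pa (P12 3) l32 + pa (P132 3) l31 - l32 + pa (P23 3) l31 - pa (P123 3) l32
        = pc 2 1 0 l21 l21 + pc 2 0 1 l21 l21 + pa (P12 3) (pc 2 1 0 l21 l21)
          + pa (P132 3) (pc 2 1 0 l211 l2)
  w8 : l32 - pa (P23 3) l32 = - pc 2 1 0 l2 l211 + pc 2 0 1 l211 l2
        + pa (P12 3) (pc 2 1 0 l211 l2)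
  w9 : l4 + pa (P12 4) l4 = pc 2 0 1 l2 l31 - pc 2 2 0 l31 l2
        + pa (P123 4) (pc 2 1 0 l2 l31) + pc 2 0 2 l3 l21
  w10 : l4 + pa (P23 4) l4 = pc 2 0 1 l2 l32 - pc 2 1 1 l3 l21 + pc 2 1 0 l2 l31
        - pc 2 0 2 l31 l2 - pa (P12 4) (pc 2 1 1 l31 l2) - pa (P132 4) (pc 2 2 0 l31 l2)
  w11 : l4 + pa (P34 4) l4 = pc 2 0 1 l21 l3 - pc 2 0 2 l32 l2 + pc 2 1 1 l32 l2
        - pa (P12 4) (pc 2 1 1 l32 l2) + pc 2 2 0 l3 l21 + pa (P23 4) (pc 2 2 0 l32 l2)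
        - pa (P132 4) (pc 2 2 0 l32 l2) + pc 2 1 0 l2 l32 - pa (P12 4) (pc 2 1 0 l2 l32)
        + pa (P123 4) (pc 2 1 0 l21 l3)

end WL3
namespace WL3

open Finset

variable (k : Type) [CommRing k]

/-- A weak morphism of weak Lie 3-algebras `(f1,f2,f21,f3) : A → B`, i.e. a solution of
equations (M1)–(M8). -/
structure IsWeakMorphism {L M : ℤ → Type} [∀ i, AddCommGroup (L i)] [∀ i, Module k (L i)]
    [∀ i, AddCommGroup (M i)] [∀ i, Module k (M i)]
    (A : WeakLie3 k L) (B : WeakLie3 k M)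
    (f1 : MMap L M 1 0) (f2 : MMap L M 2 1) (f21 : MMap L M 2 2) (f3 : MMap L M 3 2) :
    Prop where
  lin1 : IsMultilinear k f1
  lin2 : IsMultilinear k f2
  lin21 : IsMultilinear k f21
  lin3 : IsMultilinear k f3
  m1 : bd (-1) B.D A.D f1 = 0
  m2 : bd 0 B.D A.D f2 = fc1 0 f1 A.l2 - fc2 0 B.l2 f1 f1
  m3 : bd 1 B.D A.D f3 = fc1 1 f1 A.l3 - pc 1 1 0 f2 A.l2 + pc 1 0 1 f2 A.l2
        + pa (P12 3) (pc 1 1 0 f2 A.l2) - fc3 1 B.l3 f1 f1 f1 - fc2 1 B.l2 f1 f2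
        + fc2 1 B.l2 f2 f1 + pa (P12 3) (fc2 1 B.l2 f1 f2)
  m4 : fc1 2 f1 A.l4 - fc4 2 B.l4 f1 f1 f1 f1 =
        pc 2 0 1 f2 A.l3 + pc 2 1 0 f2 A.l3 - pa (P12 4) (pc 2 1 0 f2 A.l3)
        + pa (P123 4) (pc 2 1 0 f2 A.l3) - pc 2 0 2 f3 A.l2 + pc 2 1 1 f3 A.l2
        - pa (P12 4) (pc 2 1 1 f3 A.l2) - pc 2 2 0 f3 A.l2 + pa (P23 4) (pc 2 2 0 f3 A.l2)
        - pa (P132 4) (pc 2 2 0 f3 A.l2) + fc2 2 B.l2 f3 f1 + fc2 2 B.l2 f1 f3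
        - pa (P12 4) (fc2 2 B.l2 f1 f3) + pa (P123 4) (fc2 2 B.l2 f1 f3)
        - fc2 2 B.l2 f2 f2 + pa (P23 4) (fc2 2 B.l2 f2 f2) - pa (P132 4) (fc2 2 B.l2 f2 f2)
        + fc3 2 B.l3 f2 f1 f1 - fc3 2 B.l3 f1 f2 f1 + pa (P12 4) (fc3 2 B.l3 f1 f2 f1)
        + fc3 2 B.l3 f1 f1 f2 - pa (P23 4) (fc3 2 B.l3 f1 f1 f2)
        + pa (P132 4) (fc3 2 B.l3 f1 f1 f2)
  m5 : bd 1 B.D A.D f21 = - f2 - pa (P12 2) f2 + fc1 1 f1 A.l21 - fc2 1 B.l21 f1 f1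
  m6 : fc1 2 f1 A.l211 - fc2 2 B.l211 f1 f1 = f21 - pa (P12 2) f21
  m7 : fc1 2 f1 A.l31 - fc3 2 B.l31 f1 f1 f1 =
        f3 + pa (P12 3) f3 + pc 2 0 1 f2 A.l21 + fc2 2 B.l2 f21 f1
  m8 : fc1 2 f1 A.l32 - fc3 2 B.l32 f1 f1 f1 =
        f3 + pa (P23 3) f3 - pc 2 1 0 f2 A.l21 + pc 2 0 1 f21 A.l2
        + pa (P12 3) (pc 2 1 0 f21 A.l2) - fc2 2 B.l2 f1 f21 - fc2 2 B.l21 f2 f1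
        - pa (P12 3) (fc2 2 B.l21 f1 f2)

/-- A morphism of (semi-strict) Lie 3-algebras / Leibniz 3-algebras: equations (M1)–(M4)
for structure maps `(a2,a3,a4)` on the source and `(b2,b3,b4)` on the target. -/
structure IsLeibMorphism {L M : ℤ → Type} [∀ i, AddCommGroup (L i)] [∀ i, Module k (L i)]
    [∀ i, AddCommGroup (M i)] [∀ i, Module k (M i)]
    (DL : MMap L L 1 (-1)) (DM : MMap M M 1 (-1))
    (a2 : MMap L L 2 0) (a3 : MMap L L 3 1) (a4 : MMap L L 4 2)
    (b2 : MMap M M 2 0) (b3 : MMap M M 3 1) (b4 : MMap M M 4 2)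
    (f1 : MMap L M 1 0) (f2 : MMap L M 2 1) (f3 : MMap L M 3 2) : Prop where
  lin1 : IsMultilinear k f1
  lin2 : IsMultilinear k f2
  lin3 : IsMultilinear k f3
  m1 : bd (-1) DM DL f1 = 0
  m2 : bd 0 DM DL f2 = fc1 0 f1 a2 - fc2 0 b2 f1 f1
  m3 : bd 1 DM DL f3 = fc1 1 f1 a3 - pc 1 1 0 f2 a2 + pc 1 0 1 f2 a2
        + pa (P12 3) (pc 1 1 0 f2 a2) - fc3 1 b3 f1 f1 f1 - fc2 1 b2 f1 f2
        + fc2 1 b2 f2 f1 + pa (P12 3) (fc2 1 b2 f1 f2)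
  m4 : fc1 2 f1 a4 - fc4 2 b4 f1 f1 f1 f1 =
        pc 2 0 1 f2 a3 + pc 2 1 0 f2 a3 - pa (P12 4) (pc 2 1 0 f2 a3)
        + pa (P123 4) (pc 2 1 0 f2 a3) - pc 2 0 2 f3 a2 + pc 2 1 1 f3 a2
        - pa (P12 4) (pc 2 1 1 f3 a2) - pc 2 2 0 f3 a2 + pa (P23 4) (pc 2 2 0 f3 a2)
        - pa (P132 4) (pc 2 2 0 f3 a2) + fc2 2 b2 f3 f1 + fc2 2 b2 f1 f3
        - pa (P12 4) (fc2 2 b2 f1 f3) + pa (P123 4) (fc2 2 b2 f1 f3)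
        - fc2 2 b2 f2 f2 + pa (P23 4) (fc2 2 b2 f2 f2) - pa (P132 4) (fc2 2 b2 f2 f2)
        + fc3 2 b3 f2 f1 f1 - fc3 2 b3 f1 f2 f1 + pa (P12 4) (fc3 2 b3 f1 f2 f1)
        + fc3 2 b3 f1 f1 f2 - pa (P23 4) (fc3 2 b3 f1 f1 f2)
        + pa (P132 4) (fc3 2 b3 f1 f1 f2)

/-- A deformation retract `(p, i, h)` of `(L, D)` onto `(L', D')`:
`p`, `i` are chain maps, `id - i∘p = D∘h + h∘D` and `p∘i = id`. -/
structure IsDefRetract {L L' : ℤ → Type} [∀ i, AddCommGroup (L i)] [∀ i, Module k (L i)]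
    [∀ i, AddCommGroup (L' i)] [∀ i, Module k (L' i)]
    (D : MMap L L 1 (-1)) (D' : MMap L' L' 1 (-1))
    (p : MMap L L' 1 0) (i : MMap L' L 1 0) (h : MMap L L 1 1) : Prop where
  linp : IsMultilinear k p
  lini : IsMultilinear k i
  linh : IsMultilinear k h
  chainp : bd (-1) D' D p = 0
  chaini : bd (-1) D D' i = 0
  homotopy : idm - fc1 0 i p = fc1 0 D h + fc1 0 h D
  retract : fc1 0 p i = idm

/-- A weak Lie 2-algebra in the sense of Roytenberg (a 2-term truncation of a weak
Lie 3-algebra). -/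
structure WeakLie2 (L : ℤ → Type) [∀ i, AddCommGroup (L i)] [∀ i, Module k (L i)] where
  D : MMap L L 1 (-1)
  linD : IsMultilinear k D
  dd : fc1 (-2) D D = 0
  bound : ∀ i : ℤ, (i < 0 ∨ 1 < i) → ∀ x : L i, x = 0
  l2 : MMap L L 2 0
  l3 : MMap L L 3 1
  l21 : MMap L L 2 1
  lin2 : IsMultilinear k l2
  lin3 : IsMultilinear k l3
  lin21 : IsMultilinear k l21
  e1 : bd (-1) D D l2 = 0
  e2 : bd 0 D D l3 = pc 0 1 0 l2 l2 - pc 0 0 1 l2 l2 - pa (P12 3) (pc 0 1 0 l2 l2)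
  e3 : (0 : MMap L L 4 1) =
    pc 1 0 1 l2 l3 + pc 1 1 0 l2 l3 - pa (P12 4) (pc 1 1 0 l2 l3)
      + pa (P123 4) (pc 1 1 0 l2 l3) - pc 1 0 2 l3 l2
      + pc 1 1 1 l3 l2 - pa (P12 4) (pc 1 1 1 l3 l2)
      - pc 1 2 0 l3 l2 + pa (P23 4) (pc 1 2 0 l3 l2) - pa (P132 4) (pc 1 2 0 l3 l2)
  e4 : bd 0 D D l21 = l2 + pa (P12 2) l2
  e5 : (0 : MMap L L 2 1) = l21 - pa (P12 2) l21
  e6 : (0 : MMap L L 3 1) = l3 + pa (P12 3) l3 + pc 1 0 1 l2 l21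
  e7 : (0 : MMap L L 3 1) = l3 + pa (P23 3) l3 - pc 1 1 0 l2 l21 + pc 1 0 1 l21 l2
        + pa (P12 3) (pc 1 1 0 l21 l2)

end WL3
namespace WL3

open Finset

section Transfer

variable {k : Type} [CommRing k] {L L' : ℤ → Type}
  [∀ i, AddCommGroup (L i)] [∀ i, Module k (L i)]
  [∀ i, AddCommGroup (L' i)] [∀ i, Module k (L' i)]
variable (A : WeakLie3 k L) (p : MMap L L' 1 0) (i : MMap L' L 1 0) (h : MMap L L 1 1)

/-- `h ∘ λ2` -/
def hl2 : MMap L L 2 1 := fc1 1 h A.l2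
/-- `h ∘ λ3` -/
def hl3 : MMap L L 3 2 := fc1 2 h A.l3
/-- `h ∘ λ21` -/
def hl21 : MMap L L 2 2 := fc1 2 h A.l21

/-- Transferred `λ2' = p ∘ λ2 ∘ (i,i)`. -/
def tl2 : MMap L' L' 2 0 := fc1 0 p (fc2 0 A.l2 i i)

/-- Transferred `λ3'`. -/
def tl3 : MMap L' L' 3 1 :=
  fc1 1 p (fc3 1 A.l3 i i i)
  + fc1 1 p (fc3 1 (pc 1 0 1 A.l2 (hl2 A h)
      - (pc 1 1 0 A.l2 (hl2 A h) - pa (P12 3) (pc 1 1 0 A.l2 (hl2 A h)))) i i i)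

/-- Transferred `λ4'`. -/
def tl4 : MMap L' L' 4 2 :=
  fc1 2 p (fc4 2 A.l4 i i i i)
  - fc1 2 p (fc4 2
      (pc 2 0 1 A.l2 (hl3 A h)
        + (pc 2 1 0 A.l2 (hl3 A h) - pa (P12 4) (pc 2 1 0 A.l2 (hl3 A h))
            + pa (P123 4) (pc 2 1 0 A.l2 (hl3 A h)))
        + pc 2 0 2 A.l3 (hl2 A h)
        - (pc 2 1 1 A.l3 (hl2 A h) - pa (P12 4) (pc 2 1 1 A.l3 (hl2 A h)))
        + (pc 2 2 0 A.l3 (hl2 A h) - pa (P23 4) (pc 2 2 0 A.l3 (hl2 A h))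
            + pa (P132 4) (pc 2 2 0 A.l3 (hl2 A h)))) i i i i)
  - fc1 2 p (fc4 2
      (pc 2 0 2 (pc 1 0 1 A.l2 (hl2 A h)) (hl2 A h)
        - (pc 2 1 1 (pc 1 0 1 A.l2 (hl2 A h)) (hl2 A h)
            - pa (P12 4) (pc 2 1 1 (pc 1 0 1 A.l2 (hl2 A h)) (hl2 A h)))
        + (fc2 2 A.l2 (hl2 A h) (hl2 A h) - pa (P23 4) (fc2 2 A.l2 (hl2 A h) (hl2 A h))
            + pa (P132 4) (fc2 2 A.l2 (hl2 A h) (hl2 A h)))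
        + (pc 2 1 1 (pc 1 1 0 A.l2 (hl2 A h)) (hl2 A h)
            - pa (P12 4) (pc 2 1 1 (pc 1 1 0 A.l2 (hl2 A h)) (hl2 A h))
            + pa (P123 4) (pc 2 1 1 (pc 1 1 0 A.l2 (hl2 A h)) (hl2 A h)))
        - (pc 2 2 0 (pc 1 1 0 A.l2 (hl2 A h)) (hl2 A h)
            - pa (P12 4) (pc 2 2 0 (pc 1 1 0 A.l2 (hl2 A h)) (hl2 A h))
            + pa (P123 4) (pc 2 2 0 (pc 1 1 0 A.l2 (hl2 A h)) (hl2 A h))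
            - pa (P23 4) (pc 2 2 0 (pc 1 1 0 A.l2 (hl2 A h)) (hl2 A h))
            + pa (P132 4) (pc 2 2 0 (pc 1 1 0 A.l2 (hl2 A h)) (hl2 A h))
            - pa (P13 4) (pc 2 2 0 (pc 1 1 0 A.l2 (hl2 A h)) (hl2 A h)))) i i i i)

/-- Transferred `λ21' = p ∘ λ21 ∘ (i,i)`. -/
def tl21 : MMap L' L' 2 1 := fc1 1 p (fc2 1 A.l21 i i)

/-- Transferred `λ211' = p ∘ λ211 ∘ (i,i)`. -/
def tl211 : MMap L' L' 2 2 := fc1 2 p (fc2 2 A.l211 i i)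

/-- Transferred `λ31'`. -/
def tl31 : MMap L' L' 3 2 :=
  fc1 2 p (fc3 2 A.l31 i i i) - fc1 2 p (fc3 2 (pc 2 0 1 A.l2 (hl21 A h)) i i i)

/-- Transferred `λ32'`. -/
def tl32 : MMap L' L' 3 2 :=
  fc1 2 p (fc3 2 A.l32 i i i)
  + fc1 2 p (fc3 2 (pc 2 0 1 A.l21 (hl2 A h) + pc 2 1 0 A.l2 (hl21 A h)
      + pa (P12 3) (pc 2 1 0 A.l21 (hl2 A h))) i i i)

/-- Extension of `i`: `i₂ = -h ∘ λ2 ∘ (i,i)`. -/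
def ti2 : MMap L' L 2 1 := - fc1 1 h (fc2 0 A.l2 i i)

/-- Extension of `i`: `i₂₁ = -h ∘ λ21 ∘ (i,i)`. -/
def ti21 : MMap L' L 2 2 := - fc1 2 h (fc2 1 A.l21 i i)

/-- Extension of `i`: `i₃`. -/
def ti3 : MMap L' L 3 2 :=
  - fc1 2 h (fc3 1 A.l3 i i i)
  - fc1 2 h (fc3 1 (pc 1 0 1 A.l2 (hl2 A h)
      - (pc 1 1 0 A.l2 (hl2 A h) - pa (P12 3) (pc 1 1 0 A.l2 (hl2 A h)))) i i i)

end Transfer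

section Skew

variable (k : Type) [CommRing k] [Invertible (2 : k)] [Invertible (3 : k)]
variable {L M : ℤ → Type} [∀ i, AddCommGroup (L i)] [∀ i, Module k (L i)]
  [∀ i, AddCommGroup (M i)] [∀ i, Module k (M i)]

/-- Skew-symmetrization `λ̄2` of a weak Lie 3-algebra. -/
def skew2 (A : WeakLie3 k L) : MMap L L 2 0 :=
  (⅟ (2 : k)) • ∑ σ : Equiv.Perm (Fin 2), (Equiv.Perm.sign σ : ℤ) • pa σ A.l2

/-- Skew-symmetrization `λ̄3` of a weak Lie 3-algebra. -/
def skew3 (A : WeakLie3 k L) : MMap L L 3 1 :=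
  (⅟ (2 : k) * ⅟ (3 : k)) • ∑ σ : Equiv.Perm (Fin 3), (Equiv.Perm.sign σ : ℤ) • pa σ A.l3
  - (⅟ (2 : k) * ⅟ (2 : k) * ⅟ (2 : k) * ⅟ (3 : k)) •
      ∑ σ : Equiv.Perm (Fin 3), (Equiv.Perm.sign σ : ℤ) •
        pa σ (pc 1 0 1 A.l21 A.l2 + pc 1 1 0 A.l21 A.l2)

/-- Skew-symmetrization `λ̄4` of a weak Lie 3-algebra. -/
def skew4 (A : WeakLie3 k L) : MMap L L 4 2 :=
  (⅟ (2 : k) * ⅟ (2 : k) * ⅟ (2 : k) * ⅟ (3 : k)) •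
      ∑ σ : Equiv.Perm (Fin 4), (Equiv.Perm.sign σ : ℤ) • pa σ A.l4
  + (⅟ (2 : k) * ⅟ (2 : k) * ⅟ (2 : k) * ⅟ (2 : k) * ⅟ (3 : k)) •
      ∑ σ : Equiv.Perm (Fin 4), (Equiv.Perm.sign σ : ℤ) •
        pa σ (pc 2 0 1 A.l21 A.l3 - pc 2 0 2 A.l31 A.l2 + pc 2 1 1 A.l32 A.l2
          - pc 2 1 0 A.l21 A.l3 - pc 2 1 1 A.l31 A.l2 + pc 2 2 0 A.l32 A.l2)

/-- Skew-symmetrization `f̄2` of the second component of a weak morphism. -/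
def skewMor2 (f2 : MMap L M 2 1) : MMap L M 2 1 :=
  (⅟ (2 : k)) • ∑ σ : Equiv.Perm (Fin 2), (Equiv.Perm.sign σ : ℤ) • pa σ f2

/-- Skew-symmetrization `f̄3` of the third component of a weak morphism `A → B`. -/
def skewMor3 (A : WeakLie3 k L) (B : WeakLie3 k M) (f1 : MMap L M 1 0) (f2 : MMap L M 2 1)
    (f21 : MMap L M 2 2) (f3 : MMap L M 3 2) : MMap L M 3 2 :=
  (⅟ (2 : k) * ⅟ (3 : k)) • ∑ σ : Equiv.Perm (Fin 3), (Equiv.Perm.sign σ : ℤ) • pa σ f3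
  - (⅟ (2 : k) * ⅟ (2 : k) * ⅟ (2 : k) * ⅟ (3 : k)) •
      ∑ σ : Equiv.Perm (Fin 3), (Equiv.Perm.sign σ : ℤ) •
        pa σ (pc 2 0 1 f21 A.l2 + pc 2 1 0 f21 A.l2
          - fc2 2 B.l21 f2 f1 - fc2 2 B.l21 f1 f2)

end Skew

section Comp

variable {k : Type} [CommRing k] {L M N : ℤ → Type}
  [∀ i, AddCommGroup (L i)] [∀ i, Module k (L i)]
  [∀ i, AddCommGroup (M i)] [∀ i, Module k (M i)]
  [∀ i, AddCommGroup (N i)] [∀ i, Module k (N i)]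

/-- First component of the composition of weak morphisms. -/
def cmp1 (f1' : MMap M N 1 0) (f1 : MMap L M 1 0) : MMap L N 1 0 := fc1 0 f1' f1

/-- Second component of the composition of weak morphisms. -/
def cmp2 (f1' : MMap M N 1 0) (f2' : MMap M N 2 1) (f1 : MMap L M 1 0) (f2 : MMap L M 2 1) :
    MMap L N 2 1 := fc2 1 f2' f1 f1 + fc1 1 f1' f2

/-- `(f'∘f)21` component of the composition of weak morphisms. -/
def cmp21 (f1' : MMap M N 1 0) (f21' : MMap M N 2 2) (f1 : MMap L M 1 0)
    (f21 : MMap L M 2 2) : MMap L N 2 2 := fc2 2 f21' f1 f1 + fc1 2 f1' f21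

/-- Third component of the composition of weak morphisms. -/
def cmp3 (f1' : MMap M N 1 0) (f2' : MMap M N 2 1) (f3' : MMap M N 3 2)
    (f1 : MMap L M 1 0) (f2 : MMap L M 2 1) (f3 : MMap L M 3 2) : MMap L N 3 2 :=
  fc3 2 f3' f1 f1 f1 - fc2 2 f2' f2 f1 + fc2 2 f2' f1 f2 - pa (P12 3) (fc2 2 f2' f1 f2)
    + fc1 2 f1' f3

end Comp

end WL3

namespace WL3

open Finset

section Total

set_option linter.unusedSectionVars false

/-! ## Total spaces and homogeneous elements -/

/-- The total space of a graded module, as a product over all degrees. -/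
def V (L : ℤ → Type) : Type := ∀ i, L i

instance (L : ℤ → Type) [∀ i, AddCommGroup (L i)] : AddCommGroup (V L) :=
  inferInstanceAs (AddCommGroup (∀ i, L i))

instance (k : Type) [CommRing k] (L : ℤ → Type) [∀ i, AddCommGroup (L i)]
    [∀ i, Module k (L i)] : Module k (V L) :=
  inferInstanceAs (Module k (∀ i, L i))

/-- The element of the total space concentrated in degree `a` with component `x`. -/
def inj {L : ℤ → Type} [∀ i, AddCommGroup (L i)] (a : ℤ) (x : L a) : V L :=
  Pi.single (M := L) a x

/-- `u` is homogeneous of degree `a`. -/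
class Deg {L : ℤ → Type} [∀ i, AddCommGroup (L i)] (u : V L) (a : outParam ℤ) : Prop where
  out : ∀ j, j ≠ a → u j = 0

/-- `L` is concentrated in degrees `0, 1, 2`. -/
class Bdd (L : ℤ → Type) [∀ i, AddCommGroup (L i)] : Prop where
  out : ∀ i : ℤ, (i < 0 ∨ 2 < i) → ∀ x : L i, x = 0

/-- A graded map which vanishes as soon as one of its arguments does. -/
class ZP {L M : ℤ → Type} [∀ i, AddCommGroup (L i)] [∀ i, AddCommGroup (M i)] {m : ℕ} {r : ℤ}
    (μ : MMap L M m r) : Prop where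
  out : ∀ (d : Fin m → ℤ) (x : ∀ j, L (d j)) (j : Fin m), x j = 0 → μ d x = 0

/-- A multiadditive graded map. -/
class MA {L M : ℤ → Type} [∀ i, AddCommGroup (L i)] [∀ i, AddCommGroup (M i)] {m : ℕ} {r : ℤ}
    (μ : MMap L M m r) : Prop where
  out : ∀ (d : Fin m → ℤ) (x : ∀ j, L (d j)) (j : Fin m) (a b : L (d j)),
    μ d (Function.update x j (a + b))
        = μ d (Function.update x j a) + μ d (Function.update x j b)

/-- A graded map which is homogeneous in each argument for the scalars in `k`. -/
class MS (k : Type) [CommRing k] {L M : ℤ → Type} [∀ i, AddCommGroup (L i)]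
    [∀ i, AddCommGroup (M i)] [∀ i, Module k (L i)] [∀ i, Module k (M i)] {m : ℕ} {r : ℤ}
    (μ : MMap L M m r) : Prop where
  out : ∀ (d : Fin m → ℤ) (x : ∀ j, L (d j)) (j : Fin m) (c : k) (a : L (d j)),
    μ d (Function.update x j (c • a)) = c • μ d (Function.update x j a)

variable {L M N : ℤ → Type} [∀ i, AddCommGroup (L i)] [∀ i, AddCommGroup (M i)]
  [∀ i, AddCommGroup (N i)]

theorem inj_zero (a : ℤ) : inj a (0 : L a) = 0 := Pi.single_zero (M := L) a

theorem inj_add (a : ℤ) (x y : L a) : inj a (x + y) = inj a x + inj a y :=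
  Pi.single_add (f := L) a x y

theorem inj_zsmul (a : ℤ) (n : ℤ) (x : L a) : inj a (n • x) = n • inj a x :=
  Pi.single_smul (f := L) a n x

theorem inj_smul {k : Type} [CommRing k] [∀ i, Module k (L i)] (a : ℤ) (n : k) (x : L a) :
    inj a (n • x) = n • inj a x :=
  Pi.single_smul (f := L) a n x

theorem inj_injective (a : ℤ) : Function.Injective (inj (L := L) a) :=
  Pi.single_injective (M := L) a

theorem inj_gcast {a b : ℤ} (h : a = b) (x : L a) : inj b (gcast h x) = inj a x := by
  subst h; rfl

theorem gcast_eq_zero {a b : ℤ} (h : a = b) {x : L a} (hx : x = 0) : gcast h x = 0 := by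
  subst h; exact hx

theorem zsmul_gcast_eq_zero {a b : ℤ} (n : ℤ) (h : a = b) {x : L a} (hx : x = 0) :
    n • gcast h x = 0 := by
  subst hx; subst h; exact smul_zero n

theorem cons_zero_eq_zero {n : ℕ} {e : Fin (n + 1) → ℤ} {x : L (e 0)}
    {y : ∀ j : Fin n, L (e j.succ)} (hx : x = 0) :
    (Fin.cons x y : ∀ j, L (e j)) 0 = 0 := hx

theorem cons_succ_eq_zero {n : ℕ} {e : Fin (n + 1) → ℤ} {x : L (e 0)}
    {y : ∀ j : Fin n, L (e j.succ)} {j : Fin n} (hy : y j = 0) :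
    (Fin.cons x y : ∀ j, L (e j)) j.succ = 0 := hy

theorem inj_cons_zero {n : ℕ} {e : Fin (n + 1) → ℤ} {x : L (e 0)}
    {y : ∀ j : Fin n, L (e j.succ)} :
    inj (e 0) ((Fin.cons x y : ∀ j, L (e j)) 0) = inj (e 0) x := rfl

theorem inj_cons_succ {n : ℕ} {e : Fin (n + 1) → ℤ} {x : L (e 0)}
    {y : ∀ j : Fin n, L (e j.succ)} {j : Fin n} :
    inj (e j.succ) ((Fin.cons x y : ∀ j, L (e j)) j.succ) = inj (e j.succ) (y j) := rfl

theorem cons3_eq_zero_1 {e : Fin 3 → ℤ}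
    {x0 : L (e 0)} {x1 : L (e 1)} 
    {x2 : ∀ j : Fin 1, L (e j.succ.succ)} (hx : x1 = 0) :
    (Fin.cons x0 (Fin.cons x1 x2) : ∀ j, L (e j)) 1 = 0 := hx

theorem cons3_eq_zero_2 {e : Fin 3 → ℤ}
    {x0 : L (e 0)} {x1 : L (e 1)} 
    {x2 : ∀ j : Fin 1, L (e j.succ.succ)} (hx : x2 0 = 0) :
    (Fin.cons x0 (Fin.cons x1 x2) : ∀ j, L (e j)) 2 = 0 := hx

theorem inj_cons3_1 {e : Fin 3 → ℤ}
    {x0 : L (e 0)} {x1 : L (e 1)} 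
    {x2 : ∀ j : Fin 1, L (e j.succ.succ)} :
    inj (e 1) ((Fin.cons x0 (Fin.cons x1 x2) : ∀ j, L (e j)) 1) = inj (e 1) x1 := rfl

theorem inj_cons3_2 {e : Fin 3 → ℤ}
    {x0 : L (e 0)} {x1 : L (e 1)} 
    {x2 : ∀ j : Fin 1, L (e j.succ.succ)} :
    inj (e 2) ((Fin.cons x0 (Fin.cons x1 x2) : ∀ j, L (e j)) 2) = inj (e 2) (x2 0) := rfl

theorem cons4_eq_zero_1 {e : Fin 4 → ℤ}
    {x0 : L (e 0)} {x1 : L (e 1)} {x2 : L (e 2)} 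
    {x3 : ∀ j : Fin 1, L (e j.succ.succ.succ)} (hx : x1 = 0) :
    (Fin.cons x0 (Fin.cons x1 (Fin.cons x2 x3)) : ∀ j, L (e j)) 1 = 0 := hx

theorem cons4_eq_zero_2 {e : Fin 4 → ℤ}
    {x0 : L (e 0)} {x1 : L (e 1)} {x2 : L (e 2)} 
    {x3 : ∀ j : Fin 1, L (e j.succ.succ.succ)} (hx : x2 = 0) :
    (Fin.cons x0 (Fin.cons x1 (Fin.cons x2 x3)) : ∀ j, L (e j)) 2 = 0 := hx

theorem cons4_eq_zero_3 {e : Fin 4 → ℤ}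
    {x0 : L (e 0)} {x1 : L (e 1)} {x2 : L (e 2)} 
    {x3 : ∀ j : Fin 1, L (e j.succ.succ.succ)} (hx : x3 0 = 0) :
    (Fin.cons x0 (Fin.cons x1 (Fin.cons x2 x3)) : ∀ j, L (e j)) 3 = 0 := hx

theorem inj_cons4_1 {e : Fin 4 → ℤ}
    {x0 : L (e 0)} {x1 : L (e 1)} {x2 : L (e 2)} 
    {x3 : ∀ j : Fin 1, L (e j.succ.succ.succ)} :
    inj (e 1) ((Fin.cons x0 (Fin.cons x1 (Fin.cons x2 x3)) : ∀ j, L (e j)) 1) = inj (e 1) x1 := rfl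

theorem inj_cons4_2 {e : Fin 4 → ℤ}
    {x0 : L (e 0)} {x1 : L (e 1)} {x2 : L (e 2)} 
    {x3 : ∀ j : Fin 1, L (e j.succ.succ.succ)} :
    inj (e 2) ((Fin.cons x0 (Fin.cons x1 (Fin.cons x2 x3)) : ∀ j, L (e j)) 2) = inj (e 2) x2 := rfl

theorem inj_cons4_3 {e : Fin 4 → ℤ}
    {x0 : L (e 0)} {x1 : L (e 1)} {x2 : L (e 2)} 
    {x3 : ∀ j : Fin 1, L (e j.succ.succ.succ)} :
    inj (e 3) ((Fin.cons x0 (Fin.cons x1 (Fin.cons x2 x3)) : ∀ j, L (e j)) 3) = inj (e 3) (x3 0) := rfl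

theorem gcast_zero {a b : ℤ} (h : a = b) : gcast h (0 : L a) = 0 := by
  subst h; rfl

instance deg_inj (a : ℤ) (x : L a) : Deg (inj a x) a :=
  ⟨fun _ hj => Pi.single_eq_of_ne (M := L) hj x⟩

theorem Deg.eq_inj {u : V L} {a : ℤ} (h : Deg u a) : u = inj a (u a) := by
  refine funext (fun j => ?_)
  by_cases hj : j = a
  · subst hj; exact (Pi.single_eq_same (M := L) _ _).symm
  · rw [h.out j hj]; exact (Pi.single_eq_of_ne (M := L) hj _).symm

theorem Deg.congr {u : V L} {a b : ℤ} (h : Deg u a) (hab : a = b) : Deg u b := hab ▸ h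

theorem Deg.add {u v : V L} {a : ℤ} (hu : Deg u a) (hv : Deg v a) : Deg (u + v) a :=
  ⟨fun j hj => by
    change u j + v j = 0
    rw [hu.out j hj, hv.out j hj, add_zero]⟩

theorem Deg.smul {k : Type} [CommRing k] [∀ i, Module k (L i)] (c : k) {u : V L} {a : ℤ}
    (hu : Deg u a) : Deg (c • u) a :=
  ⟨fun j hj => by
    change c • u j = 0
    rw [hu.out j hj, smul_zero]⟩

theorem Deg.eq_zero [Bdd L] {u : V L} {a : ℤ} (h : Deg u a) (ha : a < 0 ∨ 2 < a) : u = 0 := by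
  rw [h.eq_inj, Bdd.out a ha (u a), inj_zero]

instance (priority := 50) MA.toZP {m : ℕ} {r : ℤ} (μ : MMap L M m r) [h : MA μ] : ZP μ :=
  ⟨fun d x j hx => by
    have := h.out d x j 0 0
    rw [add_zero, left_eq_add] at this
    rwa [← hx, Function.update_eq_self] at this⟩

theorem IsMultilinear.ma {k : Type} [CommRing k] [∀ i, Module k (L i)] [∀ i, Module k (M i)]
    {m : ℕ} {r : ℤ} {μ : MMap L M m r} (h : IsMultilinear k μ) : MA μ :=
  ⟨fun d x j a b => (h d x j).1 a b⟩

theorem IsMultilinear.ms {k : Type} [CommRing k] [∀ i, Module k (L i)] [∀ i, Module k (M i)]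
    {m : ℕ} {r : ℤ} {μ : MMap L M m r} (h : IsMultilinear k μ) : MS k μ :=
  ⟨fun d x j c a => (h d x j).2 c a⟩

/-! ## Extension of graded maps to total spaces -/

/-- The extension of a graded map to total spaces. -/
noncomputable def tot {m : ℕ} {r : ℤ} (μ : MMap L M m r) (u : Fin m → V L) : V M :=
  ∑ d ∈ Fintype.piFinset (fun _ : Fin m => Finset.Icc (0 : ℤ) 2),
    inj (r + ∑ j, d j) (μ d (fun j => u j (d j)))

theorem tot_inj [Bdd L] {m : ℕ} {r : ℤ} (μ : MMap L M m r) [hμ : ZP μ] (d : Fin m → ℤ)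
    (x : ∀ j, L (d j)) : tot μ (fun j => inj (d j) (x j)) = inj (r + ∑ j, d j) (μ d x) := by
  have hx : (fun j => inj (d j) (x j) (d j)) = x := by
    funext j; exact Pi.single_eq_same (M := L) _ _
  unfold tot
  rw [Finset.sum_eq_single d]
  · rw [hx]
  · intro e _ hne
    obtain ⟨j, hj⟩ := Function.ne_iff.mp hne
    rw [hμ.out e _ j ((deg_inj (d j) (x j)).out _ hj), inj_zero]
  · intro hd
    simp only [Fintype.mem_piFinset, Finset.mem_Icc, not_forall, not_and_or, not_le] at hd
    obtain ⟨j, hj⟩ := hd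
    rw [hx, hμ.out d x j (Bdd.out _ hj _), inj_zero]

theorem tot_eq [Bdd L] {m : ℕ} {r : ℤ} (μ : MMap L M m r) [ZP μ] {d : Fin m → ℤ}
    {u : Fin m → V L} (hu : ∀ j, Deg (u j) (d j)) :
    tot μ u = inj (r + ∑ j, d j) (μ d (fun j => u j (d j))) := by
  rw [← tot_inj]
  congr 1
  funext j
  exact (hu j).eq_inj

theorem deg_tot [Bdd L] {m : ℕ} {r : ℤ} (μ : MMap L M m r) [ZP μ] {d : Fin m → ℤ}
    {u : Fin m → V L} (hu : ∀ j, Deg (u j) (d j)) : Deg (tot μ u) (r + ∑ j, d j) := by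
  rw [tot_eq μ hu]; infer_instance

/-- Graded maps into a bounded module agree as soon as they agree on homogeneous elements in the
relevant range of degrees. -/
theorem ext_tot [Bdd L] [Bdd M] {m : ℕ} {r : ℤ} {μ ν : MMap L M m r} [hμ : ZP μ] [hν : ZP ν]
    (h : ∀ d : Fin m → ℤ, (∀ j, 0 ≤ d j) → r + ∑ j, d j ≤ 2 →
      ∀ u : Fin m → V L, (∀ j, Deg (u j) (d j)) → tot μ u = tot ν u) : μ = ν := by
  funext d x
  by_cases h0 : ∀ j, 0 ≤ d j
  · by_cases h2 : r + ∑ j, d j ≤ 2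
    · have := h d h0 h2 (fun j => inj (d j) (x j)) (fun j => inferInstance)
      rw [tot_inj, tot_inj] at this
      exact inj_injective _ this
    · rw [Bdd.out _ (Or.inr (not_le.mp h2)) (μ d x), Bdd.out _ (Or.inr (not_le.mp h2)) (ν d x)]
  · push Not at h0
    obtain ⟨j, hj⟩ := h0
    have hx := Bdd.out _ (Or.inl hj) (x j)
    rw [hμ.out d x j hx, hν.out d x j hx]

theorem update_apply_V {m : ℕ} (u : Fin m → V L) (j : Fin m) (w : V L) (d : Fin m → ℤ) :
    (fun i => Function.update u j w i (d i))
      = Function.update (fun i => u i (d i)) j (w (d j)) := by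
  funext i
  by_cases hi : i = j
  · subst hi; simp
  · simp [Function.update_of_ne hi]

theorem tot_update_add {m : ℕ} {r : ℤ} (μ : MMap L M m r) [hμ : MA μ] (u : Fin m → V L)
    (j : Fin m) (v w : V L) : tot μ (Function.update u j (v + w))
      = tot μ (Function.update u j v) + tot μ (Function.update u j w) := by
  unfold tot
  rw [← Finset.sum_add_distrib]
  refine Finset.sum_congr rfl (fun d _ => ?_)
  rw [update_apply_V, update_apply_V, update_apply_V, ← inj_add, ← hμ.out]
  rfl

theorem tot_update_smul {k : Type} [CommRing k] [∀ i, Module k (L i)] [∀ i, Module k (M i)]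
    {m : ℕ} {r : ℤ} (μ : MMap L M m r) [hμ : MS k μ] (u : Fin m → V L)
    (j : Fin m) (c : k) (v : V L) : tot μ (Function.update u j (c • v))
      = c • tot μ (Function.update u j v) := by
  unfold tot
  rw [Finset.smul_sum]
  refine Finset.sum_congr rfl (fun d _ => ?_)
  rw [update_apply_V, update_apply_V, ← inj_smul, ← hμ.out]
  rfl

/-- Multilinearity can be checked on total spaces. -/
theorem isMultilinear_of_tot {k : Type} [CommRing k] [∀ i, Module k (L i)] [∀ i, Module k (M i)]
    [Bdd L] {m : ℕ} {r : ℤ} (μ : MMap L M m r) [ZP μ]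
    (h : ∀ (d : Fin m → ℤ) (u : Fin m → V L), (∀ i, Deg (u i) (d i)) → ∀ j : Fin m,
      (∀ v w, Deg v (d j) → Deg w (d j) → tot μ (Function.update u j (v + w))
        = tot μ (Function.update u j v) + tot μ (Function.update u j w)) ∧
      (∀ (c : k) v, Deg v (d j) → tot μ (Function.update u j (c • v))
        = c • tot μ (Function.update u j v))) : IsMultilinear k μ := by
  intro d x j
  have hup : ∀ y : L (d j), Function.update (fun i => inj (d i) (x i)) j (inj (d j) y)
      = fun i => inj (d i) (Function.update x j y i) := by
    intro y; funext i
    by_cases hi : i = j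
    · subst hi; simp
    · simp [Function.update_of_ne hi]
  obtain ⟨h1, h2⟩ := h d (fun i => inj (d i) (x i)) (fun i => inferInstance) j
  constructor
  · intro a b
    have := h1 (inj (d j) a) (inj (d j) b) inferInstance inferInstance
    rw [← inj_add, hup, hup, hup, tot_inj, tot_inj, tot_inj, ← inj_add] at this
    exact inj_injective _ this
  · intro c a
    have := h2 c (inj (d j) a) inferInstance
    rw [← inj_smul, hup, hup, tot_inj, tot_inj, ← inj_smul] at this
    exact inj_injective _ this

/-! ## Operations on graded maps -/

instance {m : ℕ} {r : ℤ} (μ ν : MMap L M m r) [hμ : ZP μ] [hν : ZP ν] : ZP (μ + ν) :=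
  ⟨fun d x j hx => by
    change μ d x + ν d x = 0
    rw [hμ.out d x j hx, hν.out d x j hx, add_zero]⟩

instance {m : ℕ} {r : ℤ} (μ ν : MMap L M m r) [hμ : ZP μ] [hν : ZP ν] : ZP (μ - ν) :=
  ⟨fun d x j hx => by
    change μ d x - ν d x = 0
    rw [hμ.out d x j hx, hν.out d x j hx, sub_zero]⟩

instance {m : ℕ} {r : ℤ} (μ : MMap L M m r) [hμ : ZP μ] : ZP (-μ) :=
  ⟨fun d x j hx => by
    change -μ d x = 0
    rw [hμ.out d x j hx, neg_zero]⟩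

instance {m : ℕ} {r : ℤ} (n : ℤ) (μ : MMap L M m r) [hμ : ZP μ] : ZP (n • μ) :=
  ⟨fun d x j hx => by
    change n • μ d x = 0
    rw [hμ.out d x j hx, smul_zero]⟩

instance {m : ℕ} {r : ℤ} : ZP (0 : MMap L M m r) := ⟨fun _ _ _ _ => rfl⟩

theorem tot_add {m : ℕ} {r : ℤ} (μ ν : MMap L M m r) (u : Fin m → V L) :
    tot (μ + ν) u = tot μ u + tot ν u := by
  unfold tot
  rw [← Finset.sum_add_distrib]
  exact Finset.sum_congr rfl (fun d _ => inj_add _ _ _)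

theorem tot_zsmul {m : ℕ} {r : ℤ} (n : ℤ) (μ : MMap L M m r) (u : Fin m → V L) :
    tot (n • μ) u = n • tot μ u := by
  unfold tot
  rw [Finset.smul_sum]
  exact Finset.sum_congr rfl (fun d _ => inj_zsmul _ _ _)

theorem tot_zero {m : ℕ} {r : ℤ} (u : Fin m → V L) : tot (0 : MMap L M m r) u = 0 :=
  Finset.sum_eq_zero (fun _ _ => inj_zero _)

theorem tot_neg {m : ℕ} {r : ℤ} (μ : MMap L M m r) (u : Fin m → V L) :
    tot (-μ) u = -tot μ u := by
  rw [← neg_one_zsmul, tot_zsmul, neg_one_zsmul]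

theorem tot_sub {m : ℕ} {r : ℤ} (μ ν : MMap L M m r) (u : Fin m → V L) :
    tot (μ - ν) u = tot μ u - tot ν u := by
  rw [sub_eq_add_neg, tot_add, tot_neg, sub_eq_add_neg]

instance {m : ℕ} {r R : ℤ} (h : r = R) (μ : MMap L M m r) [ZP μ] : ZP (mcast rfl h μ) := by
  subst h; assumption

theorem tot_mcast {m : ℕ} {r R : ℤ} (h : r = R) (μ : MMap L M m r) (u : Fin m → V L) :
    tot (mcast rfl h μ) u = tot μ u := by
  subst h; rfl

instance {m : ℕ} {r : ℤ} (σ : Equiv.Perm (Fin m)) (μ : MMap L M m r) [hμ : ZP μ] :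
    ZP (pa σ μ) :=
  ⟨fun d x j hx => by
    have : (fun i => x (σ.symm i)) (σ j) = 0 := by
      have e : σ.symm (σ j) = j := σ.symm_apply_apply j
      have : ∀ i, i = j → x i = 0 := fun i hi => by subst hi; exact hx
      exact this _ e
    unfold pa
    rw [hμ.out _ _ (σ j) this, gcast_zero, smul_zero]⟩

theorem tot_pa [Bdd L] {m : ℕ} {r : ℤ} (σ : Equiv.Perm (Fin m)) (μ : MMap L M m r) [ZP μ]
    {d : Fin m → ℤ} {u : Fin m → V L} (hu : ∀ j, Deg (u j) (d j)) :
    tot (pa σ μ) u = koszulSign d σ • tot μ (fun j => u (σ.symm j)) := by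
  rw [tot_eq _ hu, tot_eq μ (fun j => hu (σ.symm j))]
  unfold pa
  rw [inj_zsmul, inj_gcast]

instance {m₁ m₂ n : ℕ} {r s : ℤ} (μ : MMap L M (m₁ + 1 + m₂) r) (ν : MMap L L n s)
    [hμ : ZP μ] [hν : ZP ν] : ZP (pcomp m₁ m₂ μ ν) :=
  ⟨fun _ x j hx => by
    unfold pcomp
    induction j using Fin.addCases with
    | left j =>
      induction j using Fin.addCases with
      | left j =>
        rw [hμ.out _ _ (Fin.castAdd m₂ (Fin.castAdd 1 j)), gcast_zero, smul_zero]
        simp only [Fin.addCases_left]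
        rw [hx, gcast_zero]
      | right j =>
        rw [hμ.out _ _ (Fin.castAdd m₂ (Fin.natAdd m₁ 0)), gcast_zero, smul_zero]
        simp only [Fin.addCases_left, Fin.addCases_right]
        rw [hν.out _ _ j hx, gcast_zero]
    | right j =>
      rw [hμ.out _ _ (Fin.natAdd (m₁ + 1) j), gcast_zero, smul_zero]
      simp only [Fin.addCases_right]
      rw [hx, gcast_zero]⟩

instance {m₁ m₂ n : ℕ} {r s R : ℤ} (μ : MMap L M (m₁ + 1 + m₂) r) (ν : MMap L L n s)
    (h : r + s = R) [ZP μ] [ZP ν] : ZP (pc R m₁ m₂ μ ν h) := by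
  unfold pc; infer_instance

theorem tot_pc [Bdd L] {m₁ m₂ n : ℕ} {r s R : ℤ} (μ : MMap L M (m₁ + 1 + m₂) r)
    (ν : MMap L L n s) (h : r + s = R) [ZP μ] [ZP ν] {d : Fin (m₁ + n + m₂) → ℤ}
    {u : Fin (m₁ + n + m₂) → V L} (hu : ∀ j, Deg (u j) (d j)) :
    tot (pc R m₁ m₂ μ ν h) u
      = ((-1 : ℤ) ^ (s * ∑ j : Fin m₁, d (Fin.castAdd m₂ (Fin.castAdd n j))).natAbs) •
        tot μ (Fin.append (Fin.append (fun j => u (Fin.castAdd m₂ (Fin.castAdd n j)))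
          (fun _ : Fin 1 => tot ν (fun j => u (Fin.castAdd m₂ (Fin.natAdd m₁ j)))))
          (fun j => u (Fin.natAdd (m₁ + n) j))) := by
  unfold pc
  rw [tot_mcast, tot_eq _ hu]
  unfold pcomp
  rw [inj_zsmul, inj_gcast, ← tot_inj]
  congr 2
  funext j
  induction j using Fin.addCases with
  | left j =>
    induction j using Fin.addCases with
    | left j =>
      simp only [Fin.addCases_left, inj_gcast, Fin.append_left]
      exact (hu _).eq_inj.symm
    | right j =>
      simp only [Fin.addCases_left, Fin.addCases_right, inj_gcast, Fin.append_left,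
        Fin.append_right]
      rw [tot_eq ν (fun j => hu (Fin.castAdd m₂ (Fin.natAdd m₁ j)))]
  | right j =>
    simp only [Fin.addCases_right, inj_gcast, Fin.append_right]
    exact (hu _).eq_inj.symm

instance {a : ℕ} {r s R : ℤ} (μ : MMap M N 1 r) (g : MMap L M a s) (h : r + s = R)
    [hμ : ZP μ] [hg : ZP g] : ZP (fc1 R μ g h) := by
  subst h
  refine ⟨fun d x j hx => ?_⟩
  change comp₁ μ g d x = 0
  unfold comp₁
  rw [hμ.out _ _ 0 (hg.out d x j hx), gcast_zero]

theorem tot_fc1 [Bdd L] [Bdd M] {a : ℕ} {r s R : ℤ} (μ : MMap M N 1 r) (g : MMap L M a s)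
    (h : r + s = R) [ZP μ] [ZP g] {d : Fin a → ℤ} {u : Fin a → V L}
    (hu : ∀ j, Deg (u j) (d j)) :
    tot (fc1 R μ g h) u = tot μ (fun _ => tot g u) := by
  unfold fc1
  rw [tot_mcast]
  have : ZP (comp₁ μ g) := inferInstanceAs (ZP (fc1 (r + s) μ g rfl))
  rw [tot_eq _ hu]
  unfold comp₁
  rw [inj_gcast, tot_eq g hu, tot_inj]

instance {a b : ℕ} {r s₁ s₂ R : ℤ} (μ : MMap M N 2 r) (g₁ : MMap L M a s₁)
    (g₂ : MMap L M b s₂) (h : r + (s₁ + s₂) = R) [hμ : ZP μ] [hg₁ : ZP g₁] [hg₂ : ZP g₂] :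
    ZP (fc2 R μ g₁ g₂ h) := by
  subst h
  refine ⟨fun d x j hx => ?_⟩
  change comp₂ μ g₁ g₂ d x = 0
  unfold comp₂
  induction j using Fin.addCases with
  | left j => exact zsmul_gcast_eq_zero _ _ (hμ.out _ _ 0 (cons_zero_eq_zero (gcast_eq_zero _ (hg₁.out _ _ j (by exact hx)))))
  | right j => exact zsmul_gcast_eq_zero _ _ (hμ.out _ _ 1 (cons_succ_eq_zero (j := 0) (gcast_eq_zero _ (hg₂.out _ _ j (by exact hx)))))

theorem tot_fc2 [Bdd L] [Bdd M] {a b : ℕ} {r s₁ s₂ R : ℤ} (μ : MMap M N 2 r)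
    (g₁ : MMap L M a s₁) (g₂ : MMap L M b s₂) (h : r + (s₁ + s₂) = R) [ZP μ] [ZP g₁] [ZP g₂]
    {d : Fin (a + b) → ℤ} {u : Fin (a + b) → V L} (hu : ∀ j, Deg (u j) (d j)) :
    tot (fc2 R μ g₁ g₂ h) u = ((-1 : ℤ) ^ (s₂ * ∑ j : Fin a, d (Fin.castAdd b j)).natAbs) •
      tot μ ![tot g₁ (fun j => u (Fin.castAdd b j)), tot g₂ (fun j => u (Fin.natAdd a j))] := by
  unfold fc2
  rw [tot_mcast]
  have : ZP (comp₂ μ g₁ g₂) := inferInstanceAs (ZP (fc2 _ μ g₁ g₂ rfl))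
  rw [tot_eq _ hu]
  unfold comp₂
  rw [inj_zsmul, inj_gcast, ← tot_inj, tot_eq g₁ (fun j => hu (Fin.castAdd b j)),
    tot_eq g₂ (fun j => hu (Fin.natAdd a j))]
  congr 2
  funext j
  refine Fin.cases (inj_cons_zero.trans (inj_gcast _ _)) (fun j => ?_) j
  exact Fin.cases (inj_cons_succ.trans (inj_gcast _ _)) (fun j => j.elim0) j

instance {a b c : ℕ} {r s₁ s₂ s₃ R : ℤ} (μ : MMap M N 3 r) (g₁ : MMap L M a s₁)
    (g₂ : MMap L M b s₂) (g₃ : MMap L M c s₃) (h : r + (s₁ + s₂ + s₃) = R)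
    [hμ : ZP μ] [hg₁ : ZP g₁] [hg₂ : ZP g₂] [hg₃ : ZP g₃] : ZP (fc3 R μ g₁ g₂ g₃ h) := by
  subst h
  refine ⟨fun d x j hx => ?_⟩
  change comp₃ μ g₁ g₂ g₃ d x = 0
  unfold comp₃
  induction j using Fin.addCases with
  | left j =>
    induction j using Fin.addCases with
    | left j => exact zsmul_gcast_eq_zero _ _ (hμ.out _ _ 0 (cons_zero_eq_zero (gcast_eq_zero _ (hg₁.out _ _ j (by exact hx)))))
    | right j => exact zsmul_gcast_eq_zero _ _ (hμ.out _ _ 1 (cons3_eq_zero_1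
        (gcast_eq_zero _ (hg₂.out _ _ j (by exact hx)))))
  | right j => exact zsmul_gcast_eq_zero _ _ (hμ.out _ _ 2 (cons3_eq_zero_2
        (gcast_eq_zero _ (hg₃.out _ _ j (by exact hx)))))

theorem tot_fc3 [Bdd L] [Bdd M] {a b c : ℕ} {r s₁ s₂ s₃ R : ℤ} (μ : MMap M N 3 r)
    (g₁ : MMap L M a s₁) (g₂ : MMap L M b s₂) (g₃ : MMap L M c s₃)
    (h : r + (s₁ + s₂ + s₃) = R) [ZP μ] [ZP g₁] [ZP g₂] [ZP g₃]
    {d : Fin (a + b + c) → ℤ} {u : Fin (a + b + c) → V L} (hu : ∀ j, Deg (u j) (d j)) :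
    tot (fc3 R μ g₁ g₂ g₃ h) u =
      ((-1 : ℤ) ^ (s₂ * (∑ j : Fin a, d (Fin.castAdd c (Fin.castAdd b j)))
        + s₃ * ((∑ j : Fin a, d (Fin.castAdd c (Fin.castAdd b j)))
          + ∑ j : Fin b, d (Fin.castAdd c (Fin.natAdd a j)))).natAbs) •
      tot μ ![tot g₁ (fun j => u (Fin.castAdd c (Fin.castAdd b j))),
        tot g₂ (fun j => u (Fin.castAdd c (Fin.natAdd a j))),
        tot g₃ (fun j => u (Fin.natAdd (a + b) j))] := by
  unfold fc3
  rw [tot_mcast]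
  have : ZP (comp₃ μ g₁ g₂ g₃) := inferInstanceAs (ZP (fc3 _ μ g₁ g₂ g₃ rfl))
  rw [tot_eq _ hu]
  unfold comp₃
  rw [inj_zsmul, inj_gcast, ← tot_inj, tot_eq g₁ (fun j => hu (Fin.castAdd c (Fin.castAdd b j))),
    tot_eq g₂ (fun j => hu (Fin.castAdd c (Fin.natAdd a j))),
    tot_eq g₃ (fun j => hu (Fin.natAdd (a + b) j))]
  congr 2
  funext j
  refine Fin.cases (inj_cons_zero.trans (inj_gcast _ _)) (fun j => ?_) j
  refine Fin.cases (inj_cons3_1.trans (inj_gcast _ _)) (fun j => ?_) j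
  exact Fin.cases (inj_cons3_2.trans (inj_gcast _ _)) (fun j => j.elim0) j

instance {a b c e : ℕ} {r s₁ s₂ s₃ s₄ R : ℤ} (μ : MMap M N 4 r) (g₁ : MMap L M a s₁)
    (g₂ : MMap L M b s₂) (g₃ : MMap L M c s₃) (g₄ : MMap L M e s₄)
    (h : r + (s₁ + s₂ + s₃ + s₄) = R)
    [hμ : ZP μ] [hg₁ : ZP g₁] [hg₂ : ZP g₂] [hg₃ : ZP g₃] [hg₄ : ZP g₄] :
    ZP (fc4 R μ g₁ g₂ g₃ g₄ h) := by
  subst h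
  refine ⟨fun d x j hx => ?_⟩
  change comp₄ μ g₁ g₂ g₃ g₄ d x = 0
  unfold comp₄
  induction j using Fin.addCases with
  | left j =>
    induction j using Fin.addCases with
    | left j =>
      induction j using Fin.addCases with
      | left j => exact zsmul_gcast_eq_zero _ _ (hμ.out _ _ 0 (cons_zero_eq_zero (gcast_eq_zero _ (hg₁.out _ _ j (by exact hx)))))
      | right j => exact zsmul_gcast_eq_zero _ _ (hμ.out _ _ 1 (cons4_eq_zero_1
        (gcast_eq_zero _ (hg₂.out _ _ j (by exact hx)))))
    | right j => exact zsmul_gcast_eq_zero _ _ (hμ.out _ _ 2 (cons4_eq_zero_2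
        (gcast_eq_zero _ (hg₃.out _ _ j (by exact hx)))))
  | right j => exact zsmul_gcast_eq_zero _ _ (hμ.out _ _ 3 (cons4_eq_zero_3
        (gcast_eq_zero _ (hg₄.out _ _ j (by exact hx)))))

theorem tot_fc4 [Bdd L] [Bdd M] {a b c e : ℕ} {r s₁ s₂ s₃ s₄ R : ℤ} (μ : MMap M N 4 r)
    (g₁ : MMap L M a s₁) (g₂ : MMap L M b s₂) (g₃ : MMap L M c s₃) (g₄ : MMap L M e s₄)
    (h : r + (s₁ + s₂ + s₃ + s₄) = R) [ZP μ] [ZP g₁] [ZP g₂] [ZP g₃] [ZP g₄]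
    {d : Fin (a + b + c + e) → ℤ} {u : Fin (a + b + c + e) → V L}
    (hu : ∀ j, Deg (u j) (d j)) :
    tot (fc4 R μ g₁ g₂ g₃ g₄ h) u =
      ((-1 : ℤ) ^ (s₂ * (∑ j : Fin a, d (Fin.castAdd e (Fin.castAdd c (Fin.castAdd b j))))
        + s₃ * ((∑ j : Fin a, d (Fin.castAdd e (Fin.castAdd c (Fin.castAdd b j))))
          + ∑ j : Fin b, d (Fin.castAdd e (Fin.castAdd c (Fin.natAdd a j))))
        + s₄ * ((∑ j : Fin a, d (Fin.castAdd e (Fin.castAdd c (Fin.castAdd b j))))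
          + (∑ j : Fin b, d (Fin.castAdd e (Fin.castAdd c (Fin.natAdd a j))))
          + ∑ j : Fin c, d (Fin.castAdd e (Fin.natAdd (a + b) j)))).natAbs) •
      tot μ ![tot g₁ (fun j => u (Fin.castAdd e (Fin.castAdd c (Fin.castAdd b j)))),
        tot g₂ (fun j => u (Fin.castAdd e (Fin.castAdd c (Fin.natAdd a j)))),
        tot g₃ (fun j => u (Fin.castAdd e (Fin.natAdd (a + b) j))),
        tot g₄ (fun j => u (Fin.natAdd (a + b + c) j))] := by
  unfold fc4
  rw [tot_mcast]
  have : ZP (comp₄ μ g₁ g₂ g₃ g₄) := inferInstanceAs (ZP (fc4 _ μ g₁ g₂ g₃ g₄ rfl))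
  rw [tot_eq _ hu]
  unfold comp₄
  rw [inj_zsmul, inj_gcast, ← tot_inj,
    tot_eq g₁ (fun j => hu (Fin.castAdd e (Fin.castAdd c (Fin.castAdd b j)))),
    tot_eq g₂ (fun j => hu (Fin.castAdd e (Fin.castAdd c (Fin.natAdd a j)))),
    tot_eq g₃ (fun j => hu (Fin.castAdd e (Fin.natAdd (a + b) j))),
    tot_eq g₄ (fun j => hu (Fin.natAdd (a + b + c) j))]
  congr 2
  funext j
  refine Fin.cases (inj_cons_zero.trans (inj_gcast _ _)) (fun j => ?_) j
  refine Fin.cases (inj_cons4_1.trans (inj_gcast _ _)) (fun j => ?_) j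
  refine Fin.cases (inj_cons4_2.trans (inj_gcast _ _)) (fun j => ?_) j
  exact Fin.cases (inj_cons4_3.trans (inj_gcast _ _)) (fun j => j.elim0) j

end Total

end WL3

namespace WL3

open Finset

section Curry

set_option linter.unusedSectionVars false
set_option linter.unnecessarySeqFocus false

variable {L M N : ℤ → Type} [∀ i, AddCommGroup (L i)] [∀ i, AddCommGroup (M i)]
  [∀ i, AddCommGroup (N i)]

/-! ## Signs and homogeneous tuples -/

/-- The Koszul sign `(-1) ^ n`. -/
def sg (n : ℤ) : ℤ := (-1) ^ n.natAbs

theorem sg_zero : sg 0 = 1 := rfl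

theorem sg_add (m n : ℤ) : sg (m + n) = sg m * sg n := by
  rcases Int.even_or_odd m with hm | hm <;> rcases Int.even_or_odd n with hn | hn
  · rw [sg, sg, sg, (Int.natAbs_even.mpr (hm.add hn)).neg_one_pow,
      (Int.natAbs_even.mpr hm).neg_one_pow, (Int.natAbs_even.mpr hn).neg_one_pow]; rfl
  · rw [sg, sg, sg, (Int.natAbs_odd.mpr (hm.add_odd hn)).neg_one_pow,
      (Int.natAbs_even.mpr hm).neg_one_pow, (Int.natAbs_odd.mpr hn).neg_one_pow]; rfl
  · rw [sg, sg, sg, (Int.natAbs_odd.mpr (hm.add_even hn)).neg_one_pow,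
      (Int.natAbs_odd.mpr hm).neg_one_pow, (Int.natAbs_even.mpr hn).neg_one_pow]; rfl
  · rw [sg, sg, sg, (Int.natAbs_even.mpr (hm.add_odd hn)).neg_one_pow,
      (Int.natAbs_odd.mpr hm).neg_one_pow, (Int.natAbs_odd.mpr hn).neg_one_pow]; rfl

/-- The entries of the tuple `u` are homogeneous of the degrees `d`. -/
class DegV {m : ℕ} (u : Fin m → V L) (d : outParam (Fin m → ℤ)) : Prop where
  out : ∀ j, Deg (u j) (d j)

instance : DegV (L := L) ![] ![] := ⟨fun j => j.elim0⟩

instance {m : ℕ} {u : V L} {a : ℤ} {x : Fin m → V L} {d : Fin m → ℤ} [hu : Deg u a]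
    [hx : DegV x d] : DegV (Matrix.vecCons u x) (Matrix.vecCons a d) :=
  ⟨fun j => by
    induction j using Fin.cases with
    | zero => exact hu
    | succ j => exact hx.out j⟩

theorem tot_eq_add {m : ℕ} {r : ℤ} (μ : MMap L M m r) [MA μ] {x y z : Fin m → V L} (j : Fin m)
    (hj : z j = x j + y j) (hx : ∀ i, i ≠ j → x i = z i) (hy : ∀ i, i ≠ j → y i = z i) :
    tot μ z = tot μ x + tot μ y := by
  have h := tot_update_add μ z j (x j) (y j)
  have e : ∀ w : Fin m → V L, (∀ i, i ≠ j → w i = z i) → Function.update z j (w j) = w :=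
    fun w hw => by
      funext i
      by_cases hi : i = j
      · subst hi; simp
      · rw [Function.update_of_ne hi, hw i hi]
  rwa [← hj, Function.update_eq_self, e x hx, e y hy] at h

theorem tot_eq_zero {m : ℕ} {r : ℤ} (μ : MMap L M m r) [hμ : ZP μ] {z : Fin m → V L} (j : Fin m)
    (hj : z j = 0) : tot μ z = 0 :=
  Finset.sum_eq_zero fun d _ => by
    rw [hμ.out d _ j (by rw [hj]; rfl), inj_zero]

theorem tot_eq_neg {m : ℕ} {r : ℤ} (μ : MMap L M m r) [MA μ] {x z : Fin m → V L} (j : Fin m)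
    (hj : z j = -x j) (hx : ∀ i, i ≠ j → x i = z i) : tot μ z = -tot μ x := by
  rw [eq_neg_iff_add_eq_zero, ← tot_eq_add μ (z := Function.update z j 0) j]
  · exact tot_eq_zero μ j (by simp)
  · rw [hj, Function.update_self, neg_add_cancel]
  · intro i hi; rw [Function.update_of_ne hi]
  · intro i hi; rw [Function.update_of_ne hi, hx i hi]

theorem tot_pc_eq [Bdd L] {m₁ m₂ n : ℕ} {r s R : ℤ} (μ : MMap L M (m₁ + 1 + m₂) r)
    (ν : MMap L L n s) (h : r + s = R) [ZP μ] [ZP ν] {d : Fin (m₁ + n + m₂) → ℤ}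
    {u : Fin (m₁ + n + m₂) → V L} [hu : DegV u d] {y : Fin n → V L}
    {w : Fin (m₁ + 1 + m₂) → V L} {e : ℤ}
    (he : ∑ j : Fin m₁, d (Fin.castAdd m₂ (Fin.castAdd n j)) = e)
    (hy : ∀ j, u (Fin.castAdd m₂ (Fin.natAdd m₁ j)) = y j := by intro j; fin_cases j <;> rfl)
    (hw : ∀ j, Fin.append (Fin.append (fun j => u (Fin.castAdd m₂ (Fin.castAdd n j)))
      (fun _ : Fin 1 => tot ν y)) (fun j => u (Fin.natAdd (m₁ + n) j)) j = w j := by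
        intro j; fin_cases j <;> rfl) :
    tot (pc R m₁ m₂ μ ν h) u = sg (s * e) • tot μ w := by
  subst he
  rw [tot_pc μ ν h hu.out, funext hy, funext hw]
  rfl

theorem tot_pa_eq [Bdd L] {m : ℕ} {r : ℤ} (σ : Equiv.Perm (Fin m)) (μ : MMap L M m r) [ZP μ]
    {d : Fin m → ℤ} {u w : Fin m → V L} {e : ℤ} [hu : DegV u d] (s : Finset (Fin m × Fin m))
    (hs : Finset.univ.filter (fun p : Fin m × Fin m => p.1 < p.2 ∧ σ p.2 < σ p.1) = s)
    (he : ∑ p ∈ s, d p.1 * d p.2 = e)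
    (hw : ∀ j, u (σ.symm j) = w j := by intro j; fin_cases j <;> rfl) :
    tot (pa σ μ) u = sg e • tot μ w := by
  have : koszulSign d σ = sg e := by
    have hk : koszulSign d σ = ∏ p ∈ s, sg (d p.1 * d p.2) := by subst hs; rfl
    rw [hk, ← he]
    refine Finset.induction_on s rfl (fun p t hp ih => ?_)
    rw [Finset.prod_insert hp, Finset.sum_insert hp, sg_add, ih]
  rw [tot_pa σ μ hu.out, this, funext hw]

theorem tot_fc1_eq [Bdd L] [Bdd M] {a : ℕ} {r s R : ℤ} (μ : MMap M N 1 r) (g : MMap L M a s)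
    (h : r + s = R) [ZP μ] [ZP g] {d : Fin a → ℤ} {u : Fin a → V L} [hu : DegV u d] :
    tot (fc1 R μ g h) u = tot μ ![tot g u] :=
  (tot_fc1 μ g h hu.out).trans (congrArg (tot μ) (funext fun j => by fin_cases j; rfl))

theorem tot_fc2_eq [Bdd L] [Bdd M] {a b : ℕ} {r s₁ s₂ R : ℤ} (μ : MMap M N 2 r)
    (g₁ : MMap L M a s₁) (g₂ : MMap L M b s₂) (h : r + (s₁ + s₂) = R) [ZP μ] [ZP g₁] [ZP g₂]
    {d : Fin (a + b) → ℤ} {u : Fin (a + b) → V L} [hu : DegV u d] {x : Fin a → V L}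
    {y : Fin b → V L} {e : ℤ} (he : ∑ j : Fin a, d (Fin.castAdd b j) = e)
    (hx : ∀ j, u (Fin.castAdd b j) = x j := by intro j; fin_cases j <;> rfl)
    (hy : ∀ j, u (Fin.natAdd a j) = y j := by intro j; fin_cases j <;> rfl) :
    tot (fc2 R μ g₁ g₂ h) u = sg (s₂ * e) • tot μ ![tot g₁ x, tot g₂ y] := by
  rw [tot_fc2 μ g₁ g₂ h hu.out, funext hx, funext hy, he]; rfl

theorem tot_fc3_eq [Bdd L] [Bdd M] {a b c : ℕ} {r s₁ s₂ s₃ R : ℤ} (μ : MMap M N 3 r)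
    (g₁ : MMap L M a s₁) (g₂ : MMap L M b s₂) (g₃ : MMap L M c s₃) (h : r + (s₁ + s₂ + s₃) = R)
    [ZP μ] [ZP g₁] [ZP g₂] [ZP g₃] {d : Fin (a + b + c) → ℤ} {u : Fin (a + b + c) → V L}
    [hu : DegV u d] {x : Fin a → V L} {y : Fin b → V L} {z : Fin c → V L} {e f : ℤ}
    (he : ∑ j : Fin a, d (Fin.castAdd c (Fin.castAdd b j)) = e)
    (hf : ∑ j : Fin b, d (Fin.castAdd c (Fin.natAdd a j)) = f)
    (hx : ∀ j, u (Fin.castAdd c (Fin.castAdd b j)) = x j := by intro j; fin_cases j <;> rfl)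
    (hy : ∀ j, u (Fin.castAdd c (Fin.natAdd a j)) = y j := by intro j; fin_cases j <;> rfl)
    (hz : ∀ j, u (Fin.natAdd (a + b) j) = z j := by intro j; fin_cases j <;> rfl) :
    tot (fc3 R μ g₁ g₂ g₃ h) u =
      sg (s₂ * e + s₃ * (e + f)) • tot μ ![tot g₁ x, tot g₂ y, tot g₃ z] := by
  rw [tot_fc3 μ g₁ g₂ g₃ h hu.out, funext hx, funext hy, funext hz, he, hf]; rfl

/-! ## Curried forms of graded maps on total spaces -/

/-- The extension of a graded map of arity 1 to total spaces, in curried form. -/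
noncomputable def T1 {r : ℤ} (μ : MMap L M 1 r) (u : V L) : V M :=
  tot μ ![u]

theorem tot_one {r : ℤ} (μ : MMap L M 1 r) (u : V L) :
    tot μ ![u] = T1 μ u := rfl

instance deg_T1 {r : ℤ} [Bdd L] (μ : MMap L M 1 r) [ZP μ] (u : V L) {a : ℤ} [Deg u a] :
    Deg (T1 μ u) (r + (a)) :=
  (deg_tot μ (DegV.out (u := ![u]))).congr (by rw [Fin.sum_univ_one]; rfl)

/-- The extension of a graded map of arity 2 to total spaces, in curried form. -/
noncomputable def T2 {r : ℤ} (μ : MMap L M 2 r) (u v : V L) : V M :=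
  tot μ ![u, v]

theorem tot_two {r : ℤ} (μ : MMap L M 2 r) (u v : V L) :
    tot μ ![u, v] = T2 μ u v := rfl

instance deg_T2 {r : ℤ} [Bdd L] (μ : MMap L M 2 r) [ZP μ] (u v : V L) {a b : ℤ} [Deg u a] [Deg v b] :
    Deg (T2 μ u v) (r + (a + b)) :=
  (deg_tot μ (DegV.out (u := ![u, v]))).congr (by rw [Fin.sum_univ_two]; rfl)

theorem ext_T2 [Bdd L] [Bdd M] {r : ℤ} {μ ν : MMap L M 2 r} [ZP μ] [ZP ν]
    (H : ∀ (a b : ℤ) (u v : V L) [Deg u a] [Deg v b],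
      0 ≤ a → 0 ≤ b → r + (a + b) ≤ 2 → T2 μ u v = T2 ν u v) : μ = ν := by
  refine ext_tot (fun d h0 h2 u hu => ?_)
  rw [Fin.sum_univ_two] at h2
  have := hu 0
  have := hu 1
  have e : u = ![u 0, u 1] := by funext j; fin_cases j <;> rfl
  rw [e]
  exact H _ _ _ _ (h0 0) (h0 1) h2

/-- The extension of a graded map of arity 3 to total spaces, in curried form. -/
noncomputable def T3 {r : ℤ} (μ : MMap L M 3 r) (u v w : V L) : V M :=
  tot μ ![u, v, w]

theorem tot_three {r : ℤ} (μ : MMap L M 3 r) (u v w : V L) :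
    tot μ ![u, v, w] = T3 μ u v w := rfl

instance deg_T3 {r : ℤ} [Bdd L] (μ : MMap L M 3 r) [ZP μ] (u v w : V L) {a b c : ℤ} [Deg u a] [Deg v b] [Deg w c] :
    Deg (T3 μ u v w) (r + (a + b + c)) :=
  (deg_tot μ (DegV.out (u := ![u, v, w]))).congr (by rw [Fin.sum_univ_three]; rfl)

theorem ext_T3 [Bdd L] [Bdd M] {r : ℤ} {μ ν : MMap L M 3 r} [ZP μ] [ZP ν]
    (H : ∀ (a b c : ℤ) (u v w : V L) [Deg u a] [Deg v b] [Deg w c],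
      0 ≤ a → 0 ≤ b → 0 ≤ c → r + (a + b + c) ≤ 2 → T3 μ u v w = T3 ν u v w) : μ = ν := by
  refine ext_tot (fun d h0 h2 u hu => ?_)
  rw [Fin.sum_univ_three] at h2
  have := hu 0
  have := hu 1
  have := hu 2
  have e : u = ![u 0, u 1, u 2] := by funext j; fin_cases j <;> rfl
  rw [e]
  exact H _ _ _ _ _ _ (h0 0) (h0 1) (h0 2) h2

/-- The extension of a graded map of arity 4 to total spaces, in curried form. -/
noncomputable def T4 {r : ℤ} (μ : MMap L M 4 r) (u v w x : V L) : V M :=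
  tot μ ![u, v, w, x]

theorem tot_four {r : ℤ} (μ : MMap L M 4 r) (u v w x : V L) :
    tot μ ![u, v, w, x] = T4 μ u v w x := rfl

instance deg_T4 {r : ℤ} [Bdd L] (μ : MMap L M 4 r) [ZP μ] (u v w x : V L) {a b c e : ℤ} [Deg u a] [Deg v b] [Deg w c] [Deg x e] :
    Deg (T4 μ u v w x) (r + (a + b + c + e)) :=
  (deg_tot μ (DegV.out (u := ![u, v, w, x]))).congr (by rw [Fin.sum_univ_four]; rfl)

theorem ext_T4 [Bdd L] [Bdd M] {r : ℤ} {μ ν : MMap L M 4 r} [ZP μ] [ZP ν]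
    (H : ∀ (a b c e : ℤ) (u v w x : V L) [Deg u a] [Deg v b] [Deg w c] [Deg x e],
      0 ≤ a → 0 ≤ b → 0 ≤ c → 0 ≤ e → r + (a + b + c + e) ≤ 2 → T4 μ u v w x = T4 ν u v w x) : μ = ν := by
  refine ext_tot (fun d h0 h2 u hu => ?_)
  rw [Fin.sum_univ_four] at h2
  have := hu 0
  have := hu 1
  have := hu 2
  have := hu 3
  have e : u = ![u 0, u 1, u 2, u 3] := by funext j; fin_cases j <;> rfl
  rw [e]
  exact H _ _ _ _ _ _ _ _ (h0 0) (h0 1) (h0 2) (h0 3) h2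

/-- The extension of a graded map of arity 5 to total spaces, in curried form. -/
noncomputable def T5 {r : ℤ} (μ : MMap L M 5 r) (u v w x y : V L) : V M :=
  tot μ ![u, v, w, x, y]

theorem tot_five {r : ℤ} (μ : MMap L M 5 r) (u v w x y : V L) :
    tot μ ![u, v, w, x, y] = T5 μ u v w x y := rfl

instance deg_T5 {r : ℤ} [Bdd L] (μ : MMap L M 5 r) [ZP μ] (u v w x y : V L) {a b c e f : ℤ} [Deg u a] [Deg v b] [Deg w c] [Deg x e] [Deg y f] :
    Deg (T5 μ u v w x y) (r + (a + b + c + e + f)) :=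
  (deg_tot μ (DegV.out (u := ![u, v, w, x, y]))).congr (by rw [Fin.sum_univ_five]; rfl)

theorem ext_T5 [Bdd L] [Bdd M] {r : ℤ} {μ ν : MMap L M 5 r} [ZP μ] [ZP ν]
    (H : ∀ (a b c e f : ℤ) (u v w x y : V L) [Deg u a] [Deg v b] [Deg w c] [Deg x e] [Deg y f],
      0 ≤ a → 0 ≤ b → 0 ≤ c → 0 ≤ e → 0 ≤ f → r + (a + b + c + e + f) ≤ 2 → T5 μ u v w x y = T5 ν u v w x y) : μ = ν := by
  refine ext_tot (fun d h0 h2 u hu => ?_)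
  rw [Fin.sum_univ_five] at h2
  have := hu 0
  have := hu 1
  have := hu 2
  have := hu 3
  have := hu 4
  have e : u = ![u 0, u 1, u 2, u 3, u 4] := by funext j; fin_cases j <;> rfl
  rw [e]
  exact H _ _ _ _ _ _ _ _ _ _ (h0 0) (h0 1) (h0 2) (h0 3) (h0 4) h2

theorem T1_idm [Bdd L] (u : V L) {a : ℤ} [Deg u a] : T1 (idm : MMap L L 1 0) u = u := by
  have : ZP (idm : MMap L L 1 0) := ⟨fun d x j hx => by
    obtain rfl : j = 0 := Subsingleton.elim _ _
    exact gcast_eq_zero _ hx⟩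
  refine (tot_eq (idm : MMap L L 1 0) (DegV.out (u := ![u]))).trans ?_
  unfold idm
  rw [inj_gcast]
  exact (Deg.eq_inj ‹Deg u a›).symm

theorem T1_map_add {r : ℤ} (μ : MMap L M 1 r) [MA μ] :
      (∀ u t, T1 μ (u + t) = T1 μ u + T1 μ t) := by
  refine fun _ _ => tot_eq_add μ 0 rfl ?_ ?_ <;>
    (intro i hi; fin_cases i <;> first | rfl | exact absurd rfl hi)

theorem T1_map_neg {r : ℤ} (μ : MMap L M 1 r) [MA μ] :
      (∀ u, T1 μ (-u) = -T1 μ u) := by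
  refine fun _ => tot_eq_neg μ 0 rfl ?_
  (intro i hi; fin_cases i <;> first | rfl | exact absurd rfl hi)

theorem T1_map_zero {r : ℤ} (μ : MMap L M 1 r) [ZP μ] : T1 μ 0 = 0 :=
  tot_eq_zero μ 0 rfl

theorem T2_map_add {r : ℤ} (μ : MMap L M 2 r) [MA μ] :
      (∀ u v t, T2 μ (u + t) v = T2 μ u v + T2 μ t v) ∧
      (∀ u v t, T2 μ u (v + t) = T2 μ u v + T2 μ u t) := by
  refine ⟨fun _ _ _ => tot_eq_add μ 0 rfl ?_ ?_, fun _ _ _ => tot_eq_add μ 1 rfl ?_ ?_⟩ <;>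
    (intro i hi; fin_cases i <;> first | rfl | exact absurd rfl hi)

theorem T2_map_neg {r : ℤ} (μ : MMap L M 2 r) [MA μ] :
      (∀ u v, T2 μ (-u) v = -T2 μ u v) ∧
      (∀ u v, T2 μ u (-v) = -T2 μ u v) := by
  refine ⟨fun _ _ => tot_eq_neg μ 0 rfl ?_, fun _ _ => tot_eq_neg μ 1 rfl ?_⟩ <;>
    (intro i hi; fin_cases i <;> first | rfl | exact absurd rfl hi)

theorem T2_map_zero {r : ℤ} (μ : MMap L M 2 r) [ZP μ] :
      (∀ v : V L, T2 μ 0 v = 0) ∧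
      (∀ u : V L, T2 μ u 0 = 0) :=
  ⟨fun _ => tot_eq_zero μ 0 rfl, fun _ => tot_eq_zero μ 1 rfl⟩

theorem T3_map_add {r : ℤ} (μ : MMap L M 3 r) [MA μ] :
      (∀ u v w t, T3 μ (u + t) v w = T3 μ u v w + T3 μ t v w) ∧
      (∀ u v w t, T3 μ u (v + t) w = T3 μ u v w + T3 μ u t w) ∧
      (∀ u v w t, T3 μ u v (w + t) = T3 μ u v w + T3 μ u v t) := by
  refine ⟨fun _ _ _ _ => tot_eq_add μ 0 rfl ?_ ?_, fun _ _ _ _ => tot_eq_add μ 1 rfl ?_ ?_, fun _ _ _ _ => tot_eq_add μ 2 rfl ?_ ?_⟩ <;>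
    (intro i hi; fin_cases i <;> first | rfl | exact absurd rfl hi)

theorem T3_map_neg {r : ℤ} (μ : MMap L M 3 r) [MA μ] :
      (∀ u v w, T3 μ (-u) v w = -T3 μ u v w) ∧
      (∀ u v w, T3 μ u (-v) w = -T3 μ u v w) ∧
      (∀ u v w, T3 μ u v (-w) = -T3 μ u v w) := by
  refine ⟨fun _ _ _ => tot_eq_neg μ 0 rfl ?_, fun _ _ _ => tot_eq_neg μ 1 rfl ?_, fun _ _ _ => tot_eq_neg μ 2 rfl ?_⟩ <;>
    (intro i hi; fin_cases i <;> first | rfl | exact absurd rfl hi)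

theorem T3_map_zero {r : ℤ} (μ : MMap L M 3 r) [ZP μ] :
      (∀ v w : V L, T3 μ 0 v w = 0) ∧
      (∀ u w : V L, T3 μ u 0 w = 0) ∧
      (∀ u v : V L, T3 μ u v 0 = 0) :=
  ⟨fun _ _ => tot_eq_zero μ 0 rfl, fun _ _ => tot_eq_zero μ 1 rfl, fun _ _ => tot_eq_zero μ 2 rfl⟩

theorem T4_map_add {r : ℤ} (μ : MMap L M 4 r) [MA μ] :
      (∀ u v w x t, T4 μ (u + t) v w x = T4 μ u v w x + T4 μ t v w x) ∧
      (∀ u v w x t, T4 μ u (v + t) w x = T4 μ u v w x + T4 μ u t w x) ∧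
      (∀ u v w x t, T4 μ u v (w + t) x = T4 μ u v w x + T4 μ u v t x) ∧
      (∀ u v w x t, T4 μ u v w (x + t) = T4 μ u v w x + T4 μ u v w t) := by
  refine ⟨fun _ _ _ _ _ => tot_eq_add μ 0 rfl ?_ ?_, fun _ _ _ _ _ => tot_eq_add μ 1 rfl ?_ ?_, fun _ _ _ _ _ => tot_eq_add μ 2 rfl ?_ ?_, fun _ _ _ _ _ => tot_eq_add μ 3 rfl ?_ ?_⟩ <;>
    (intro i hi; fin_cases i <;> first | rfl | exact absurd rfl hi)

theorem T4_map_zero {r : ℤ} (μ : MMap L M 4 r) [ZP μ] :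
      (∀ v w x : V L, T4 μ 0 v w x = 0) ∧
      (∀ u w x : V L, T4 μ u 0 w x = 0) ∧
      (∀ u v x : V L, T4 μ u v 0 x = 0) ∧
      (∀ u v w : V L, T4 μ u v w 0 = 0) :=
  ⟨fun _ _ _ => tot_eq_zero μ 0 rfl, fun _ _ _ => tot_eq_zero μ 1 rfl, fun _ _ _ => tot_eq_zero μ 2 rfl, fun _ _ _ => tot_eq_zero μ 3 rfl⟩

theorem T1_pc_0_0 {r s R : ℤ} [Bdd L] (μ : MMap L M 1 r) (ν : MMap L L 1 s) (h : r + s = R)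
    [ZP μ] [ZP ν] (u : V L) {a : ℤ} [Deg u a] :
    T1 (pc R 0 0 μ ν h) u = T1 μ (T1 ν u) :=
  (tot_pc_eq (m₁ := 0) (m₂ := 0) (n := 1) μ ν h (u := ![u]) (y := ![u])
    (w := ![(T1 ν u)]) (e := 0) rfl).trans (by rw [mul_zero, sg_zero, one_smul]; rfl)

theorem T2_pc_0_1 {r s R : ℤ} [Bdd L] (μ : MMap L M 2 r) (ν : MMap L L 1 s) (h : r + s = R)
    [ZP μ] [ZP ν] (u v : V L) {a b : ℤ} [Deg u a] [Deg v b] :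
    T2 (pc R 0 1 μ ν h) u v = T2 μ (T1 ν u) v :=
  (tot_pc_eq (m₁ := 0) (m₂ := 1) (n := 1) μ ν h (u := ![u, v]) (y := ![u])
    (w := ![(T1 ν u), v]) (e := 0) rfl).trans (by rw [mul_zero, sg_zero, one_smul]; rfl)

theorem T2_pc_1_0 {r s R : ℤ} [Bdd L] (μ : MMap L M 2 r) (ν : MMap L L 1 s) (h : r + s = R)
    [ZP μ] [ZP ν] (u v : V L) {a b : ℤ} [Deg u a] [Deg v b] :
    T2 (pc R 1 0 μ ν h) u v = sg (s * a) • T2 μ u (T1 ν v) :=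
  tot_pc_eq (m₁ := 1) (m₂ := 0) (n := 1) μ ν h (u := ![u, v]) (y := ![v])
    (w := ![u, (T1 ν v)]) (Fin.sum_univ_one _)

theorem T3_pc_0_2 {r s R : ℤ} [Bdd L] (μ : MMap L M 3 r) (ν : MMap L L 1 s) (h : r + s = R)
    [ZP μ] [ZP ν] (u v w : V L) {a b c : ℤ} [Deg u a] [Deg v b] [Deg w c] :
    T3 (pc R 0 2 μ ν h) u v w = T3 μ (T1 ν u) v w :=
  (tot_pc_eq (m₁ := 0) (m₂ := 2) (n := 1) μ ν h (u := ![u, v, w]) (y := ![u])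
    (w := ![(T1 ν u), v, w]) (e := 0) rfl).trans (by rw [mul_zero, sg_zero, one_smul]; rfl)

theorem T3_pc_1_1 {r s R : ℤ} [Bdd L] (μ : MMap L M 3 r) (ν : MMap L L 1 s) (h : r + s = R)
    [ZP μ] [ZP ν] (u v w : V L) {a b c : ℤ} [Deg u a] [Deg v b] [Deg w c] :
    T3 (pc R 1 1 μ ν h) u v w = sg (s * a) • T3 μ u (T1 ν v) w :=
  tot_pc_eq (m₁ := 1) (m₂ := 1) (n := 1) μ ν h (u := ![u, v, w]) (y := ![v])
    (w := ![u, (T1 ν v), w]) (Fin.sum_univ_one _)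

theorem T3_pc_2_0 {r s R : ℤ} [Bdd L] (μ : MMap L M 3 r) (ν : MMap L L 1 s) (h : r + s = R)
    [ZP μ] [ZP ν] (u v w : V L) {a b c : ℤ} [Deg u a] [Deg v b] [Deg w c] :
    T3 (pc R 2 0 μ ν h) u v w = sg (s * (a + b)) • T3 μ u v (T1 ν w) :=
  tot_pc_eq (m₁ := 2) (m₂ := 0) (n := 1) μ ν h (u := ![u, v, w]) (y := ![w])
    (w := ![u, v, (T1 ν w)]) (Fin.sum_univ_two _)

theorem T4_pc_0_3 {r s R : ℤ} [Bdd L] (μ : MMap L M 4 r) (ν : MMap L L 1 s) (h : r + s = R)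
    [ZP μ] [ZP ν] (u v w x : V L) {a b c e : ℤ} [Deg u a] [Deg v b] [Deg w c] [Deg x e] :
    T4 (pc R 0 3 μ ν h) u v w x = T4 μ (T1 ν u) v w x :=
  (tot_pc_eq (m₁ := 0) (m₂ := 3) (n := 1) μ ν h (u := ![u, v, w, x]) (y := ![u])
    (w := ![(T1 ν u), v, w, x]) (e := 0) rfl).trans (by rw [mul_zero, sg_zero, one_smul]; rfl)

theorem T4_pc_1_2 {r s R : ℤ} [Bdd L] (μ : MMap L M 4 r) (ν : MMap L L 1 s) (h : r + s = R)
    [ZP μ] [ZP ν] (u v w x : V L) {a b c e : ℤ} [Deg u a] [Deg v b] [Deg w c] [Deg x e] :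
    T4 (pc R 1 2 μ ν h) u v w x = sg (s * a) • T4 μ u (T1 ν v) w x :=
  tot_pc_eq (m₁ := 1) (m₂ := 2) (n := 1) μ ν h (u := ![u, v, w, x]) (y := ![v])
    (w := ![u, (T1 ν v), w, x]) (Fin.sum_univ_one _)

theorem T4_pc_2_1 {r s R : ℤ} [Bdd L] (μ : MMap L M 4 r) (ν : MMap L L 1 s) (h : r + s = R)
    [ZP μ] [ZP ν] (u v w x : V L) {a b c e : ℤ} [Deg u a] [Deg v b] [Deg w c] [Deg x e] :
    T4 (pc R 2 1 μ ν h) u v w x = sg (s * (a + b)) • T4 μ u v (T1 ν w) x :=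
  tot_pc_eq (m₁ := 2) (m₂ := 1) (n := 1) μ ν h (u := ![u, v, w, x]) (y := ![w])
    (w := ![u, v, (T1 ν w), x]) (Fin.sum_univ_two _)

theorem T4_pc_3_0 {r s R : ℤ} [Bdd L] (μ : MMap L M 4 r) (ν : MMap L L 1 s) (h : r + s = R)
    [ZP μ] [ZP ν] (u v w x : V L) {a b c e : ℤ} [Deg u a] [Deg v b] [Deg w c] [Deg x e] :
    T4 (pc R 3 0 μ ν h) u v w x = sg (s * (a + b + c)) • T4 μ u v w (T1 ν x) :=
  tot_pc_eq (m₁ := 3) (m₂ := 0) (n := 1) μ ν h (u := ![u, v, w, x]) (y := ![x])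
    (w := ![u, v, w, (T1 ν x)]) (Fin.sum_univ_three _)

theorem T3_pc_0_1 {r s R : ℤ} [Bdd L] (μ : MMap L M 2 r) (ν : MMap L L 2 s) (h : r + s = R)
    [ZP μ] [ZP ν] (u v w : V L) {a b c : ℤ} [Deg u a] [Deg v b] [Deg w c] :
    T3 (pc R 0 1 μ ν h) u v w = T2 μ (T2 ν u v) w :=
  (tot_pc_eq (m₁ := 0) (m₂ := 1) (n := 2) μ ν h (u := ![u, v, w]) (y := ![u, v])
    (w := ![(T2 ν u v), w]) (e := 0) rfl).trans (by rw [mul_zero, sg_zero, one_smul]; rfl)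

theorem T3_pc_1_0 {r s R : ℤ} [Bdd L] (μ : MMap L M 2 r) (ν : MMap L L 2 s) (h : r + s = R)
    [ZP μ] [ZP ν] (u v w : V L) {a b c : ℤ} [Deg u a] [Deg v b] [Deg w c] :
    T3 (pc R 1 0 μ ν h) u v w = sg (s * a) • T2 μ u (T2 ν v w) :=
  tot_pc_eq (m₁ := 1) (m₂ := 0) (n := 2) μ ν h (u := ![u, v, w]) (y := ![v, w])
    (w := ![u, (T2 ν v w)]) (Fin.sum_univ_one _)

theorem T4_pc_0_2 {r s R : ℤ} [Bdd L] (μ : MMap L M 3 r) (ν : MMap L L 2 s) (h : r + s = R)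
    [ZP μ] [ZP ν] (u v w x : V L) {a b c e : ℤ} [Deg u a] [Deg v b] [Deg w c] [Deg x e] :
    T4 (pc R 0 2 μ ν h) u v w x = T3 μ (T2 ν u v) w x :=
  (tot_pc_eq (m₁ := 0) (m₂ := 2) (n := 2) μ ν h (u := ![u, v, w, x]) (y := ![u, v])
    (w := ![(T2 ν u v), w, x]) (e := 0) rfl).trans (by rw [mul_zero, sg_zero, one_smul]; rfl)

theorem T4_pc_1_1 {r s R : ℤ} [Bdd L] (μ : MMap L M 3 r) (ν : MMap L L 2 s) (h : r + s = R)
    [ZP μ] [ZP ν] (u v w x : V L) {a b c e : ℤ} [Deg u a] [Deg v b] [Deg w c] [Deg x e] :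
    T4 (pc R 1 1 μ ν h) u v w x = sg (s * a) • T3 μ u (T2 ν v w) x :=
  tot_pc_eq (m₁ := 1) (m₂ := 1) (n := 2) μ ν h (u := ![u, v, w, x]) (y := ![v, w])
    (w := ![u, (T2 ν v w), x]) (Fin.sum_univ_one _)

theorem T4_pc_2_0 {r s R : ℤ} [Bdd L] (μ : MMap L M 3 r) (ν : MMap L L 2 s) (h : r + s = R)
    [ZP μ] [ZP ν] (u v w x : V L) {a b c e : ℤ} [Deg u a] [Deg v b] [Deg w c] [Deg x e] :
    T4 (pc R 2 0 μ ν h) u v w x = sg (s * (a + b)) • T3 μ u v (T2 ν w x) :=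
  tot_pc_eq (m₁ := 2) (m₂ := 0) (n := 2) μ ν h (u := ![u, v, w, x]) (y := ![w, x])
    (w := ![u, v, (T2 ν w x)]) (Fin.sum_univ_two _)

theorem T4_pc_0_1 {r s R : ℤ} [Bdd L] (μ : MMap L M 2 r) (ν : MMap L L 3 s) (h : r + s = R)
    [ZP μ] [ZP ν] (u v w x : V L) {a b c e : ℤ} [Deg u a] [Deg v b] [Deg w c] [Deg x e] :
    T4 (pc R 0 1 μ ν h) u v w x = T2 μ (T3 ν u v w) x :=
  (tot_pc_eq (m₁ := 0) (m₂ := 1) (n := 3) μ ν h (u := ![u, v, w, x]) (y := ![u, v, w])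
    (w := ![(T3 ν u v w), x]) (e := 0) rfl).trans (by rw [mul_zero, sg_zero, one_smul]; rfl)

theorem T4_pc_1_0 {r s R : ℤ} [Bdd L] (μ : MMap L M 2 r) (ν : MMap L L 3 s) (h : r + s = R)
    [ZP μ] [ZP ν] (u v w x : V L) {a b c e : ℤ} [Deg u a] [Deg v b] [Deg w c] [Deg x e] :
    T4 (pc R 1 0 μ ν h) u v w x = sg (s * a) • T2 μ u (T3 ν v w x) :=
  tot_pc_eq (m₁ := 1) (m₂ := 0) (n := 3) μ ν h (u := ![u, v, w, x]) (y := ![v, w, x])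
    (w := ![u, (T3 ν v w x)]) (Fin.sum_univ_one _)

theorem T5_pc_0_3 {r s R : ℤ} [Bdd L] (μ : MMap L M 4 r) (ν : MMap L L 2 s) (h : r + s = R)
    [ZP μ] [ZP ν] (u v w x y : V L) {a b c e f : ℤ} [Deg u a] [Deg v b] [Deg w c] [Deg x e]
    [Deg y f] :
    T5 (pc R 0 3 μ ν h) u v w x y = T4 μ (T2 ν u v) w x y :=
  (tot_pc_eq (m₁ := 0) (m₂ := 3) (n := 2) μ ν h (u := ![u, v, w, x, y]) (y := ![u, v])
    (w := ![(T2 ν u v), w, x, y]) (e := 0) rfl).trans (by rw [mul_zero, sg_zero, one_smul]; rfl)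

theorem T5_pc_1_2 {r s R : ℤ} [Bdd L] (μ : MMap L M 4 r) (ν : MMap L L 2 s) (h : r + s = R)
    [ZP μ] [ZP ν] (u v w x y : V L) {a b c e f : ℤ} [Deg u a] [Deg v b] [Deg w c] [Deg x e]
    [Deg y f] :
    T5 (pc R 1 2 μ ν h) u v w x y = sg (s * a) • T4 μ u (T2 ν v w) x y :=
  tot_pc_eq (m₁ := 1) (m₂ := 2) (n := 2) μ ν h (u := ![u, v, w, x, y]) (y := ![v, w])
    (w := ![u, (T2 ν v w), x, y]) (Fin.sum_univ_one _)

theorem T5_pc_2_1 {r s R : ℤ} [Bdd L] (μ : MMap L M 4 r) (ν : MMap L L 2 s) (h : r + s = R)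
    [ZP μ] [ZP ν] (u v w x y : V L) {a b c e f : ℤ} [Deg u a] [Deg v b] [Deg w c] [Deg x e]
    [Deg y f] :
    T5 (pc R 2 1 μ ν h) u v w x y = sg (s * (a + b)) • T4 μ u v (T2 ν w x) y :=
  tot_pc_eq (m₁ := 2) (m₂ := 1) (n := 2) μ ν h (u := ![u, v, w, x, y]) (y := ![w, x])
    (w := ![u, v, (T2 ν w x), y]) (Fin.sum_univ_two _)

theorem T5_pc_3_0 {r s R : ℤ} [Bdd L] (μ : MMap L M 4 r) (ν : MMap L L 2 s) (h : r + s = R)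
    [ZP μ] [ZP ν] (u v w x y : V L) {a b c e f : ℤ} [Deg u a] [Deg v b] [Deg w c] [Deg x e]
    [Deg y f] :
    T5 (pc R 3 0 μ ν h) u v w x y = sg (s * (a + b + c)) • T4 μ u v w (T2 ν x y) :=
  tot_pc_eq (m₁ := 3) (m₂ := 0) (n := 2) μ ν h (u := ![u, v, w, x, y]) (y := ![x, y])
    (w := ![u, v, w, (T2 ν x y)]) (Fin.sum_univ_three _)

theorem T5_pc_0_2 {r s R : ℤ} [Bdd L] (μ : MMap L M 3 r) (ν : MMap L L 3 s) (h : r + s = R)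
    [ZP μ] [ZP ν] (u v w x y : V L) {a b c e f : ℤ} [Deg u a] [Deg v b] [Deg w c] [Deg x e]
    [Deg y f] :
    T5 (pc R 0 2 μ ν h) u v w x y = T3 μ (T3 ν u v w) x y :=
  (tot_pc_eq (m₁ := 0) (m₂ := 2) (n := 3) μ ν h (u := ![u, v, w, x, y]) (y := ![u, v, w])
    (w := ![(T3 ν u v w), x, y]) (e := 0) rfl).trans (by rw [mul_zero, sg_zero, one_smul]; rfl)

theorem T5_pc_1_1 {r s R : ℤ} [Bdd L] (μ : MMap L M 3 r) (ν : MMap L L 3 s) (h : r + s = R)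
    [ZP μ] [ZP ν] (u v w x y : V L) {a b c e f : ℤ} [Deg u a] [Deg v b] [Deg w c] [Deg x e]
    [Deg y f] :
    T5 (pc R 1 1 μ ν h) u v w x y = sg (s * a) • T3 μ u (T3 ν v w x) y :=
  tot_pc_eq (m₁ := 1) (m₂ := 1) (n := 3) μ ν h (u := ![u, v, w, x, y]) (y := ![v, w, x])
    (w := ![u, (T3 ν v w x), y]) (Fin.sum_univ_one _)

theorem T5_pc_2_0 {r s R : ℤ} [Bdd L] (μ : MMap L M 3 r) (ν : MMap L L 3 s) (h : r + s = R)
    [ZP μ] [ZP ν] (u v w x y : V L) {a b c e f : ℤ} [Deg u a] [Deg v b] [Deg w c] [Deg x e]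
    [Deg y f] :
    T5 (pc R 2 0 μ ν h) u v w x y = sg (s * (a + b)) • T3 μ u v (T3 ν w x y) :=
  tot_pc_eq (m₁ := 2) (m₂ := 0) (n := 3) μ ν h (u := ![u, v, w, x, y]) (y := ![w, x, y])
    (w := ![u, v, (T3 ν w x y)]) (Fin.sum_univ_two _)

theorem T5_pc_0_1 {r s R : ℤ} [Bdd L] (μ : MMap L M 2 r) (ν : MMap L L 4 s) (h : r + s = R)
    [ZP μ] [ZP ν] (u v w x y : V L) {a b c e f : ℤ} [Deg u a] [Deg v b] [Deg w c] [Deg x e]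
    [Deg y f] :
    T5 (pc R 0 1 μ ν h) u v w x y = T2 μ (T4 ν u v w x) y :=
  (tot_pc_eq (m₁ := 0) (m₂ := 1) (n := 4) μ ν h (u := ![u, v, w, x, y]) (y := ![u, v, w, x])
    (w := ![(T4 ν u v w x), y]) (e := 0) rfl).trans (by rw [mul_zero, sg_zero, one_smul]; rfl)

theorem T5_pc_1_0 {r s R : ℤ} [Bdd L] (μ : MMap L M 2 r) (ν : MMap L L 4 s) (h : r + s = R)
    [ZP μ] [ZP ν] (u v w x y : V L) {a b c e f : ℤ} [Deg u a] [Deg v b] [Deg w c] [Deg x e]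
    [Deg y f] :
    T5 (pc R 1 0 μ ν h) u v w x y = sg (s * a) • T2 μ u (T4 ν v w x y) :=
  tot_pc_eq (m₁ := 1) (m₂ := 0) (n := 4) μ ν h (u := ![u, v, w, x, y]) (y := ![v, w, x, y])
    (w := ![u, (T4 ν v w x y)]) (Fin.sum_univ_one _)

theorem bd_one {r R : ℤ} (D' : MMap M M 1 (-1)) (D : MMap L L 1 (-1)) (μ : MMap L M 1 r)
    (h : -1 + r = R) : bd R D' D μ h = fc1 R D' μ h - sg r • (pc R 0 0 μ D (by rw [← h, add_comm]))
    := by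
  subst h
  unfold bd bdry
  rw [Fin.sum_univ_one]
  rfl

theorem bd_two {r R : ℤ} (D' : MMap M M 1 (-1)) (D : MMap L L 1 (-1)) (μ : MMap L M 2 r)
    (h : -1 + r = R) : bd R D' D μ h = fc1 R D' μ h - sg r •
    (pc R 0 1 μ D (by rw [← h, add_comm]) + pc R 1 0 μ D (by rw [← h, add_comm])) := by
  subst h
  unfold bd bdry
  rw [Fin.sum_univ_two]
  rfl

theorem bd_three {r R : ℤ} (D' : MMap M M 1 (-1)) (D : MMap L L 1 (-1)) (μ : MMap L M 3 r)
    (h : -1 + r = R) : bd R D' D μ h = fc1 R D' μ h - sg r •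
    (pc R 0 2 μ D (by rw [← h, add_comm]) + pc R 1 1 μ D (by rw [← h, add_comm]) + pc R 2 0 μ D (by rw [← h, add_comm])) := by
  subst h
  unfold bd bdry
  rw [Fin.sum_univ_three]
  rfl

theorem bd_four {r R : ℤ} (D' : MMap M M 1 (-1)) (D : MMap L L 1 (-1)) (μ : MMap L M 4 r)
    (h : -1 + r = R) : bd R D' D μ h = fc1 R D' μ h - sg r •
    (pc R 0 3 μ D (by rw [← h, add_comm]) + pc R 1 2 μ D (by rw [← h, add_comm]) + pc R 2 1 μ D (by rw [← h, add_comm]) + pc R 3 0 μ D (by rw [← h, add_comm])) := by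
  subst h
  unfold bd bdry
  rw [Fin.sum_univ_four]
  rfl

theorem T1_fc1 {r s R : ℤ} [Bdd L] [Bdd M] (μ : MMap M N 1 r) (g : MMap L M 1 s)
    (h : r + s = R) [ZP μ] [ZP g] (u : V L)
    {a : ℤ} [Deg u a] :
    T1 (fc1 R μ g h) u = T1 μ (T1 g u) :=
  tot_fc1_eq μ g h

theorem T2_fc1 {r s R : ℤ} [Bdd L] [Bdd M] (μ : MMap M N 1 r) (g : MMap L M 2 s)
    (h : r + s = R) [ZP μ] [ZP g] (u v : V L)
    {a b : ℤ} [Deg u a] [Deg v b] :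
    T2 (fc1 R μ g h) u v = T1 μ (T2 g u v) :=
  tot_fc1_eq μ g h

theorem T3_fc1 {r s R : ℤ} [Bdd L] [Bdd M] (μ : MMap M N 1 r) (g : MMap L M 3 s)
    (h : r + s = R) [ZP μ] [ZP g] (u v w : V L)
    {a b c : ℤ} [Deg u a] [Deg v b] [Deg w c] :
    T3 (fc1 R μ g h) u v w = T1 μ (T3 g u v w) :=
  tot_fc1_eq μ g h

theorem T4_fc1 {r s R : ℤ} [Bdd L] [Bdd M] (μ : MMap M N 1 r) (g : MMap L M 4 s)
    (h : r + s = R) [ZP μ] [ZP g] (u v w x : V L)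
    {a b c e : ℤ} [Deg u a] [Deg v b] [Deg w c] [Deg x e] :
    T4 (fc1 R μ g h) u v w x = T1 μ (T4 g u v w x) :=
  tot_fc1_eq μ g h

theorem T2_fc2_1_1 {r s₁ s₂ R : ℤ} [Bdd L] [Bdd M] (μ : MMap M N 2 r) (g₁ : MMap L M 1 s₁)
    (g₂ : MMap L M 1 s₂)
    (h : r + (s₁ + s₂) = R) [ZP μ] [ZP g₁] [ZP g₂] (u v : V L)
    {a b : ℤ} [Deg u a] [Deg v b] :
    T2 (fc2 R μ g₁ g₂ h) u v = sg (s₂ * a) • T2 μ (T1 g₁ u) (T1 g₂ v) :=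
  tot_fc2_eq (a := 1) (b := 1) μ g₁ g₂ h (u := ![u, v])
    (x := ![u]) (y := ![v]) (e := a)
    (Fin.sum_univ_one _)

theorem T3_fc2_1_2 {r s₁ s₂ R : ℤ} [Bdd L] [Bdd M] (μ : MMap M N 2 r) (g₁ : MMap L M 1 s₁)
    (g₂ : MMap L M 2 s₂)
    (h : r + (s₁ + s₂) = R) [ZP μ] [ZP g₁] [ZP g₂] (u v w : V L)
    {a b c : ℤ} [Deg u a] [Deg v b] [Deg w c] :
    T3 (fc2 R μ g₁ g₂ h) u v w = sg (s₂ * a) • T2 μ (T1 g₁ u) (T2 g₂ v w) :=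
  tot_fc2_eq (a := 1) (b := 2) μ g₁ g₂ h (u := ![u, v, w])
    (x := ![u]) (y := ![v, w]) (e := a)
    (Fin.sum_univ_one _)

theorem T3_fc2_2_1 {r s₁ s₂ R : ℤ} [Bdd L] [Bdd M] (μ : MMap M N 2 r) (g₁ : MMap L M 2 s₁)
    (g₂ : MMap L M 1 s₂)
    (h : r + (s₁ + s₂) = R) [ZP μ] [ZP g₁] [ZP g₂] (u v w : V L)
    {a b c : ℤ} [Deg u a] [Deg v b] [Deg w c] :
    T3 (fc2 R μ g₁ g₂ h) u v w = sg (s₂ * (a + b)) • T2 μ (T2 g₁ u v) (T1 g₂ w) :=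
  tot_fc2_eq (a := 2) (b := 1) μ g₁ g₂ h (u := ![u, v, w])
    (x := ![u, v]) (y := ![w]) (e := a + b)
    (Fin.sum_univ_two _)

theorem T4_fc2_1_3 {r s₁ s₂ R : ℤ} [Bdd L] [Bdd M] (μ : MMap M N 2 r) (g₁ : MMap L M 1 s₁)
    (g₂ : MMap L M 3 s₂)
    (h : r + (s₁ + s₂) = R) [ZP μ] [ZP g₁] [ZP g₂] (u v w x : V L)
    {a b c e : ℤ} [Deg u a] [Deg v b] [Deg w c] [Deg x e] :
    T4 (fc2 R μ g₁ g₂ h) u v w x = sg (s₂ * a) • T2 μ (T1 g₁ u) (T3 g₂ v w x) :=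
  tot_fc2_eq (a := 1) (b := 3) μ g₁ g₂ h (u := ![u, v, w, x])
    (x := ![u]) (y := ![v, w, x]) (e := a)
    (Fin.sum_univ_one _)

theorem T4_fc2_3_1 {r s₁ s₂ R : ℤ} [Bdd L] [Bdd M] (μ : MMap M N 2 r) (g₁ : MMap L M 3 s₁)
    (g₂ : MMap L M 1 s₂)
    (h : r + (s₁ + s₂) = R) [ZP μ] [ZP g₁] [ZP g₂] (u v w x : V L)
    {a b c e : ℤ} [Deg u a] [Deg v b] [Deg w c] [Deg x e] :
    T4 (fc2 R μ g₁ g₂ h) u v w x = sg (s₂ * (a + b + c)) • T2 μ (T3 g₁ u v w) (T1 g₂ x) :=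
  tot_fc2_eq (a := 3) (b := 1) μ g₁ g₂ h (u := ![u, v, w, x])
    (x := ![u, v, w]) (y := ![x]) (e := a + b + c)
    (Fin.sum_univ_three _)

theorem T4_fc2_2_2 {r s₁ s₂ R : ℤ} [Bdd L] [Bdd M] (μ : MMap M N 2 r) (g₁ : MMap L M 2 s₁)
    (g₂ : MMap L M 2 s₂)
    (h : r + (s₁ + s₂) = R) [ZP μ] [ZP g₁] [ZP g₂] (u v w x : V L)
    {a b c e : ℤ} [Deg u a] [Deg v b] [Deg w c] [Deg x e] :
    T4 (fc2 R μ g₁ g₂ h) u v w x = sg (s₂ * (a + b)) • T2 μ (T2 g₁ u v) (T2 g₂ w x) :=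
  tot_fc2_eq (a := 2) (b := 2) μ g₁ g₂ h (u := ![u, v, w, x])
    (x := ![u, v]) (y := ![w, x]) (e := a + b)
    (Fin.sum_univ_two _)

theorem T3_fc3_1_1_1 {r s₁ s₂ s₃ R : ℤ} [Bdd L] [Bdd M] (μ : MMap M N 3 r) (g₁ : MMap L M 1 s₁)
    (g₂ : MMap L M 1 s₂) (g₃ : MMap L M 1 s₃)
    (h : r + (s₁ + s₂ + s₃) = R) [ZP μ] [ZP g₁] [ZP g₂] [ZP g₃] (u v w : V L)
    {a b c : ℤ} [Deg u a] [Deg v b] [Deg w c] :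
    T3 (fc3 R μ g₁ g₂ g₃ h) u v w =
      sg (s₂ * a + s₃ * (a + b)) • T3 μ (T1 g₁ u) (T1 g₂ v) (T1 g₃ w) :=
  tot_fc3_eq (a := 1) (b := 1) (c := 1) μ g₁ g₂ g₃ h (u := ![u, v, w])
    (x := ![u]) (y := ![v]) (z := ![w]) (e := a) (f := b)
    (Fin.sum_univ_one _) (Fin.sum_univ_one _)

theorem T4_fc3_2_1_1 {r s₁ s₂ s₃ R : ℤ} [Bdd L] [Bdd M] (μ : MMap M N 3 r) (g₁ : MMap L M 2 s₁)
    (g₂ : MMap L M 1 s₂) (g₃ : MMap L M 1 s₃)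
    (h : r + (s₁ + s₂ + s₃) = R) [ZP μ] [ZP g₁] [ZP g₂] [ZP g₃] (u v w x : V L)
    {a b c e : ℤ} [Deg u a] [Deg v b] [Deg w c] [Deg x e] :
    T4 (fc3 R μ g₁ g₂ g₃ h) u v w x =
      sg (s₂ * (a + b) + s₃ * ((a + b) + c)) • T3 μ (T2 g₁ u v) (T1 g₂ w) (T1 g₃ x) :=
  tot_fc3_eq (a := 2) (b := 1) (c := 1) μ g₁ g₂ g₃ h (u := ![u, v, w, x])
    (x := ![u, v]) (y := ![w]) (z := ![x]) (e := a + b) (f := c)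
    (Fin.sum_univ_two _) (Fin.sum_univ_one _)

theorem T4_fc3_1_2_1 {r s₁ s₂ s₃ R : ℤ} [Bdd L] [Bdd M] (μ : MMap M N 3 r) (g₁ : MMap L M 1 s₁)
    (g₂ : MMap L M 2 s₂) (g₃ : MMap L M 1 s₃)
    (h : r + (s₁ + s₂ + s₃) = R) [ZP μ] [ZP g₁] [ZP g₂] [ZP g₃] (u v w x : V L)
    {a b c e : ℤ} [Deg u a] [Deg v b] [Deg w c] [Deg x e] :
    T4 (fc3 R μ g₁ g₂ g₃ h) u v w x =
      sg (s₂ * a + s₃ * (a + (b + c))) • T3 μ (T1 g₁ u) (T2 g₂ v w) (T1 g₃ x) :=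
  tot_fc3_eq (a := 1) (b := 2) (c := 1) μ g₁ g₂ g₃ h (u := ![u, v, w, x])
    (x := ![u]) (y := ![v, w]) (z := ![x]) (e := a) (f := b + c)
    (Fin.sum_univ_one _) (Fin.sum_univ_two _)

theorem T4_fc3_1_1_2 {r s₁ s₂ s₃ R : ℤ} [Bdd L] [Bdd M] (μ : MMap M N 3 r) (g₁ : MMap L M 1 s₁)
    (g₂ : MMap L M 1 s₂) (g₃ : MMap L M 2 s₃)
    (h : r + (s₁ + s₂ + s₃) = R) [ZP μ] [ZP g₁] [ZP g₂] [ZP g₃] (u v w x : V L)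
    {a b c e : ℤ} [Deg u a] [Deg v b] [Deg w c] [Deg x e] :
    T4 (fc3 R μ g₁ g₂ g₃ h) u v w x =
      sg (s₂ * a + s₃ * (a + b)) • T3 μ (T1 g₁ u) (T1 g₂ v) (T2 g₃ w x) :=
  tot_fc3_eq (a := 1) (b := 1) (c := 2) μ g₁ g₂ g₃ h (u := ![u, v, w, x])
    (x := ![u]) (y := ![v]) (z := ![w, x]) (e := a) (f := b)
    (Fin.sum_univ_one _) (Fin.sum_univ_one _)

theorem T4_fc4_1_1_1_1 {r s₁ s₂ s₃ s₄ R : ℤ} [Bdd L] [Bdd M] (μ : MMap M N 4 r) (g₁ : MMap L M 1 s₁)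
    (g₂ : MMap L M 1 s₂) (g₃ : MMap L M 1 s₃) (g₄ : MMap L M 1 s₄)
    (h : r + (s₁ + s₂ + s₃ + s₄) = R) [ZP μ] [ZP g₁] [ZP g₂] [ZP g₃] [ZP g₄] (u v w x : V L)
    {a b c e : ℤ} [Deg u a] [Deg v b] [Deg w c] [Deg x e] :
    T4 (fc4 R μ g₁ g₂ g₃ g₄ h) u v w x =
      sg (s₂ * a + s₃ * (a + b) + s₄ * (a + b + c)) • T4 μ (T1 g₁ u) (T1 g₂ v) (T1 g₃ w) (T1 g₄ x)
      :=
  (tot_fc4 (a := 1) (b := 1) (c := 1) (e := 1) μ g₁ g₂ g₃ g₄ h (DegV.out (u := ![u, v, w, x]))).trans (by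
    simp only [Fin.sum_univ_one]
    refine congrArg (HSMul.hSMul _) (congrArg (tot μ) (funext fun j => ?_))
    fin_cases j
    · exact congrArg (tot g₁) (funext fun j => by fin_cases j; rfl)
    · exact congrArg (tot g₂) (funext fun j => by fin_cases j; rfl)
    · exact congrArg (tot g₃) (funext fun j => by fin_cases j; rfl)
    · exact congrArg (tot g₄) (funext fun j => by fin_cases j; rfl))

theorem T2_P12 {r : ℤ} [Bdd L] (μ : MMap L M 2 r) [ZP μ] (u v : V L)
    {a b : ℤ} [Deg u a] [Deg v b] :
    T2 (pa (P12 2) μ) u v = sg (a * b) • T2 μ v u :=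
  tot_pa_eq (P12 2) μ (u := ![u, v]) (w := ![v, u])
    {(0, 1)} (by decide) (Finset.sum_singleton _ _)

theorem T3_P12 {r : ℤ} [Bdd L] (μ : MMap L M 3 r) [ZP μ] (u v w : V L)
    {a b c : ℤ} [Deg u a] [Deg v b] [Deg w c] :
    T3 (pa (P12 3) μ) u v w = sg (a * b) • T3 μ v u w :=
  tot_pa_eq (P12 3) μ (u := ![u, v, w]) (w := ![v, u, w])
    {(0, 1)} (by decide) (Finset.sum_singleton _ _)

theorem T3_P23 {r : ℤ} [Bdd L] (μ : MMap L M 3 r) [ZP μ] (u v w : V L)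
    {a b c : ℤ} [Deg u a] [Deg v b] [Deg w c] :
    T3 (pa (P23 3) μ) u v w = sg (b * c) • T3 μ u w v :=
  tot_pa_eq (P23 3) μ (u := ![u, v, w]) (w := ![u, w, v])
    {(1, 2)} (by decide) (Finset.sum_singleton _ _)

theorem T3_P123 {r : ℤ} [Bdd L] (μ : MMap L M 3 r) [ZP μ] (u v w : V L)
    {a b c : ℤ} [Deg u a] [Deg v b] [Deg w c] :
    T3 (pa (P123 3) μ) u v w = sg (a * c + b * c) • T3 μ w u v :=
  tot_pa_eq (P123 3) μ (u := ![u, v, w]) (w := ![w, u, v])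
    {(0, 2), (1, 2)} (by decide) (Finset.sum_pair (by decide))

theorem T3_P132 {r : ℤ} [Bdd L] (μ : MMap L M 3 r) [ZP μ] (u v w : V L)
    {a b c : ℤ} [Deg u a] [Deg v b] [Deg w c] :
    T3 (pa (P132 3) μ) u v w = sg (a * b + a * c) • T3 μ v w u :=
  tot_pa_eq (P132 3) μ (u := ![u, v, w]) (w := ![v, w, u])
    {(0, 1), (0, 2)} (by decide) (Finset.sum_pair (by decide))

theorem T4_P12 {r : ℤ} [Bdd L] (μ : MMap L M 4 r) [ZP μ] (u v w x : V L)
    {a b c e : ℤ} [Deg u a] [Deg v b] [Deg w c] [Deg x e] :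
    T4 (pa (P12 4) μ) u v w x = sg (a * b) • T4 μ v u w x :=
  tot_pa_eq (P12 4) μ (u := ![u, v, w, x]) (w := ![v, u, w, x])
    {(0, 1)} (by decide) (Finset.sum_singleton _ _)

theorem T4_P23 {r : ℤ} [Bdd L] (μ : MMap L M 4 r) [ZP μ] (u v w x : V L)
    {a b c e : ℤ} [Deg u a] [Deg v b] [Deg w c] [Deg x e] :
    T4 (pa (P23 4) μ) u v w x = sg (b * c) • T4 μ u w v x :=
  tot_pa_eq (P23 4) μ (u := ![u, v, w, x]) (w := ![u, w, v, x])
    {(1, 2)} (by decide) (Finset.sum_singleton _ _)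

theorem T4_P34 {r : ℤ} [Bdd L] (μ : MMap L M 4 r) [ZP μ] (u v w x : V L)
    {a b c e : ℤ} [Deg u a] [Deg v b] [Deg w c] [Deg x e] :
    T4 (pa (P34 4) μ) u v w x = sg (c * e) • T4 μ u v x w :=
  tot_pa_eq (P34 4) μ (u := ![u, v, w, x]) (w := ![u, v, x, w])
    {(2, 3)} (by decide) (Finset.sum_singleton _ _)

theorem T4_P13 {r : ℤ} [Bdd L] (μ : MMap L M 4 r) [ZP μ] (u v w x : V L)
    {a b c e : ℤ} [Deg u a] [Deg v b] [Deg w c] [Deg x e] :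
    T4 (pa (P13 4) μ) u v w x = sg (a * b + (a * c + b * c)) • T4 μ w v u x :=
  tot_pa_eq (P13 4) μ (u := ![u, v, w, x]) (w := ![w, v, u, x])
    {(0, 1), (0, 2), (1, 2)} (by decide)
    ((Finset.sum_insert (by decide)).trans (congrArg _ (Finset.sum_pair (by decide))))

theorem T4_P123 {r : ℤ} [Bdd L] (μ : MMap L M 4 r) [ZP μ] (u v w x : V L)
    {a b c e : ℤ} [Deg u a] [Deg v b] [Deg w c] [Deg x e] :
    T4 (pa (P123 4) μ) u v w x = sg (a * c + b * c) • T4 μ w u v x :=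
  tot_pa_eq (P123 4) μ (u := ![u, v, w, x]) (w := ![w, u, v, x])
    {(0, 2), (1, 2)} (by decide) (Finset.sum_pair (by decide))

theorem T4_P132 {r : ℤ} [Bdd L] (μ : MMap L M 4 r) [ZP μ] (u v w x : V L)
    {a b c e : ℤ} [Deg u a] [Deg v b] [Deg w c] [Deg x e] :
    T4 (pa (P132 4) μ) u v w x = sg (a * b + a * c) • T4 μ v w u x :=
  tot_pa_eq (P132 4) μ (u := ![u, v, w, x]) (w := ![v, w, u, x])
    {(0, 1), (0, 2)} (by decide) (Finset.sum_pair (by decide))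

theorem T5_pa [Bdd L] {r : ℤ} (σ : Equiv.Perm (Fin 5)) (μ : MMap L M 5 r) [ZP μ] (u v w x y : V L)
    [Deg u 0] [Deg v 0] [Deg w 0] [Deg x 0] [Deg y 0] {w' : Fin 5 → V L}
    (hw : ∀ j, ![u, v, w, x, y] (σ.symm j) = w' j := by intro j; fin_cases j <;> rfl) : T5 (pa σ μ)
    u v w x y = tot μ w' := by
  refine (tot_pa σ μ (DegV.out (u := ![u, v, w, x, y]))).trans ?_
  rw [funext hw, koszulSign, Finset.prod_eq_one, one_smul]
  rintro ⟨i, j⟩ -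
  fin_cases i <;> fin_cases j <;> rfl

theorem T5_P12 {r : ℤ} [Bdd L] (μ : MMap L M 5 r) [ZP μ] (u v w x y : V L)
    [Deg u 0] [Deg v 0] [Deg w 0] [Deg x 0] [Deg y 0] :
    T5 (pa (P12 5) μ) u v w x y = T5 μ v u w x y :=
  T5_pa _ μ u v w x y (w' := ![v, u, w, x, y])

theorem T5_P23 {r : ℤ} [Bdd L] (μ : MMap L M 5 r) [ZP μ] (u v w x y : V L)
    [Deg u 0] [Deg v 0] [Deg w 0] [Deg x 0] [Deg y 0] :
    T5 (pa (P23 5) μ) u v w x y = T5 μ u w v x y :=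
  T5_pa _ μ u v w x y (w' := ![u, w, v, x, y])

theorem T5_P34 {r : ℤ} [Bdd L] (μ : MMap L M 5 r) [ZP μ] (u v w x y : V L)
    [Deg u 0] [Deg v 0] [Deg w 0] [Deg x 0] [Deg y 0] :
    T5 (pa (P34 5) μ) u v w x y = T5 μ u v x w y :=
  T5_pa _ μ u v w x y (w' := ![u, v, x, w, y])

theorem T5_P123 {r : ℤ} [Bdd L] (μ : MMap L M 5 r) [ZP μ] (u v w x y : V L)
    [Deg u 0] [Deg v 0] [Deg w 0] [Deg x 0] [Deg y 0] :
    T5 (pa (P123 5) μ) u v w x y = T5 μ w u v x y :=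
  T5_pa _ μ u v w x y (w' := ![w, u, v, x, y])

theorem T5_P132 {r : ℤ} [Bdd L] (μ : MMap L M 5 r) [ZP μ] (u v w x y : V L)
    [Deg u 0] [Deg v 0] [Deg w 0] [Deg x 0] [Deg y 0] :
    T5 (pa (P132 5) μ) u v w x y = T5 μ v w u x y :=
  T5_pa _ μ u v w x y (w' := ![v, w, u, x, y])

theorem T5_P234 {r : ℤ} [Bdd L] (μ : MMap L M 5 r) [ZP μ] (u v w x y : V L)
    [Deg u 0] [Deg v 0] [Deg w 0] [Deg x 0] [Deg y 0] :
    T5 (pa (P234 5) μ) u v w x y = T5 μ u x v w y :=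
  T5_pa _ μ u v w x y (w' := ![u, x, v, w, y])

theorem T5_P243 {r : ℤ} [Bdd L] (μ : MMap L M 5 r) [ZP μ] (u v w x y : V L)
    [Deg u 0] [Deg v 0] [Deg w 0] [Deg x 0] [Deg y 0] :
    T5 (pa (P243 5) μ) u v w x y = T5 μ u w x v y :=
  T5_pa _ μ u v w x y (w' := ![u, w, x, v, y])

theorem T5_P1234 {r : ℤ} [Bdd L] (μ : MMap L M 5 r) [ZP μ] (u v w x y : V L)
    [Deg u 0] [Deg v 0] [Deg w 0] [Deg x 0] [Deg y 0] :
    T5 (pa (P1234 5) μ) u v w x y = T5 μ x u v w y :=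
  T5_pa _ μ u v w x y (w' := ![x, u, v, w, y])

theorem T5_P1432 {r : ℤ} [Bdd L] (μ : MMap L M 5 r) [ZP μ] (u v w x y : V L)
    [Deg u 0] [Deg v 0] [Deg w 0] [Deg x 0] [Deg y 0] :
    T5 (pa (P1432 5) μ) u v w x y = T5 μ v w x u y :=
  T5_pa _ μ u v w x y (w' := ![v, w, x, u, y])

theorem T5_P1342 {r : ℤ} [Bdd L] (μ : MMap L M 5 r) [ZP μ] (u v w x y : V L)
    [Deg u 0] [Deg v 0] [Deg w 0] [Deg x 0] [Deg y 0] :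
    T5 (pa (P1342 5) μ) u v w x y = T5 μ v x u w y :=
  T5_pa _ μ u v w x y (w' := ![v, x, u, w, y])

theorem T5_P13P24 {r : ℤ} [Bdd L] (μ : MMap L M 5 r) [ZP μ] (u v w x y : V L)
    [Deg u 0] [Deg v 0] [Deg w 0] [Deg x 0] [Deg y 0] :
    T5 (pa (P13P24 5) μ) u v w x y = T5 μ w x u v y :=
  T5_pa _ μ u v w x y (w' := ![w, x, u, v, y])

end Curry

end WL3

namespace WL3

open Finset

section Multilinear

/-! ## Multilinearity of composite maps -/

variable {k : Type} [CommRing k] {L M N : ℤ → Type} [∀ i, AddCommGroup (L i)]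
  [∀ i, Module k (L i)] [∀ i, AddCommGroup (M i)] [∀ i, Module k (M i)]
  [∀ i, AddCommGroup (N i)] [∀ i, Module k (N i)]

theorem IsMultilinear.zp {m : ℕ} {r : ℤ} {μ : MMap L M m r} (h : IsMultilinear k μ) : ZP μ :=
  have := h.ma
  inferInstance

theorem IsMultilinear.add {m : ℕ} {r : ℤ} {μ ν : MMap L M m r} (hμ : IsMultilinear k μ)
    (hν : IsMultilinear k ν) : IsMultilinear k (μ + ν) := fun d x j =>
  ⟨fun a b => by
    change μ d _ + ν d _ = (μ d _ + ν d _) + (μ d _ + ν d _)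
    rw [(hμ d x j).1, (hν d x j).1, add_add_add_comm],
  fun c a => by
    change μ d _ + ν d _ = c • (μ d _ + ν d _)
    rw [(hμ d x j).2, (hν d x j).2, smul_add]⟩

theorem IsMultilinear.neg {m : ℕ} {r : ℤ} {μ : MMap L M m r} (hμ : IsMultilinear k μ) :
    IsMultilinear k (-μ) := fun d x j =>
  ⟨fun a b => by
    change -μ d _ = -μ d _ + -μ d _
    rw [(hμ d x j).1, neg_add],
  fun c a => by
    change -μ d _ = c • -μ d _
    rw [(hμ d x j).2, smul_neg]⟩

theorem IsMultilinear.sub {m : ℕ} {r : ℤ} {μ ν : MMap L M m r} (hμ : IsMultilinear k μ)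
    (hν : IsMultilinear k ν) : IsMultilinear k (μ - ν) := sub_eq_add_neg μ ν ▸ hμ.add hν.neg

/-- The linear map obtained from a multilinear graded map by fixing all arguments but one. -/
noncomputable def IsMultilinear.slot {m : ℕ} {r : ℤ} {μ : MMap L M m r} (h : IsMultilinear k μ)
    (W : Fin m → V L) (j : Fin m) : V L →ₗ[k] V M where
  toFun v := tot μ (Function.update W j v)
  map_add' v w := have := h.ma; tot_update_add μ W j v w
  map_smul' c v := have := h.ms; tot_update_smul μ W j c v

theorem IsMultilinear.slot_apply {m : ℕ} {r : ℤ} {μ : MMap L M m r} (h : IsMultilinear k μ)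
    {W z : Fin m → V L} {j : Fin m} {v : V L} (hj : z j = v) (hz : ∀ i, i ≠ j → z i = W i) :
    tot μ z = h.slot W j v := by
  refine congrArg (tot μ) (funext fun i => ?_)
  by_cases hi : i = j
  · subst hi; rw [Function.update_self, hj]
  · rw [Function.update_of_ne hi, hz i hi]

theorem isMultilinear_of_slot [Bdd L] {m : ℕ} {r : ℤ} (μ : MMap L M m r) [ZP μ]
    (h : ∀ (d : Fin m → ℤ) (u : Fin m → V L) (j : Fin m), ∃ F : V L →ₗ[k] V M,
      ∀ z : Fin m → V L, (∀ i, Deg (z i) (d i)) → (∀ i, i ≠ j → z i = u i) →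
        tot μ z = F (z j)) : IsMultilinear k μ := by
  refine isMultilinear_of_tot μ (fun d u hu j => ?_)
  obtain ⟨F, hF⟩ := h d u j
  have key : ∀ v, Deg v (d j) → tot μ (Function.update u j v) = F v := fun v hv => by
    rw [hF _ (fun i => ?_) (fun i hi => Function.update_of_ne hi _ _), Function.update_self]
    by_cases hi : i = j
    · subst hi; rwa [Function.update_self]
    · rw [Function.update_of_ne hi]; exact hu i
  constructor
  · intro v w hv hw
    rw [key v hv, key w hw, key _ (hv.add hw), map_add]
  · intro c v hv
    rw [key v hv, key _ (hv.smul c), map_smul]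

theorem IsMultilinear.pa [Bdd L] {m : ℕ} {r : ℤ} {μ : MMap L M m r} (h : IsMultilinear k μ)
    (σ : Equiv.Perm (Fin m)) : IsMultilinear k (pa σ μ) := by
  have := h.zp
  refine isMultilinear_of_slot _ (fun d u j =>
    ⟨koszulSign d σ • h.slot (fun i => u (σ.symm i)) (σ j), fun z hz hzu => ?_⟩)
  rw [tot_pa σ μ hz, h.slot_apply (j := σ j) (v := z j) (W := fun i => u (σ.symm i))]
  · rfl
  · rw [σ.symm_apply_apply]
  · intro i hi
    exact hzu _ (fun e => hi (by rw [← e, σ.apply_symm_apply]))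

theorem IsMultilinear.pc [Bdd L] {m₁ m₂ n : ℕ} {r s R : ℤ} {μ : MMap L M (m₁ + 1 + m₂) r}
    {ν : MMap L L n s} (hμ : IsMultilinear k μ) (hν : IsMultilinear k ν) (h : r + s = R) :
    IsMultilinear k (pc R m₁ m₂ μ ν h) := by
  have := hμ.zp
  have := hν.zp
  refine isMultilinear_of_slot _ (fun d u j => ?_)
  set c := ((-1 : ℤ) ^ (s * ∑ j : Fin m₁, d (Fin.castAdd m₂ (Fin.castAdd n j))).natAbs)
  set W := Fin.append (Fin.append (fun j => u (Fin.castAdd m₂ (Fin.castAdd n j)))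
    (fun _ : Fin 1 => tot ν (fun j => u (Fin.castAdd m₂ (Fin.natAdd m₁ j)))))
    (fun j => u (Fin.natAdd (m₁ + n) j)) with hW
  induction j using Fin.addCases with
  | left j =>
    induction j using Fin.addCases with
    | left j =>
      refine ⟨c • hμ.slot W (Fin.castAdd m₂ (Fin.castAdd 1 j)), fun z hz hzu => ?_⟩
      rw [tot_pc μ ν h hz, hμ.slot_apply (W := W) (j := Fin.castAdd m₂ (Fin.castAdd 1 j)) rfl]
      · simp only [Fin.append_left]; rfl
      · intro i hi
        induction i using Fin.addCases with
        | left i =>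
          induction i using Fin.addCases with
          | left i =>
            simp only [hW, Fin.append_left]
            exact hzu _ (fun e => hi (by simpa [Fin.ext_iff] using e))
          | right i =>
            simp only [hW, Fin.append_left, Fin.append_right]
            exact congrArg (tot ν) (funext fun i => hzu _ (by simp [Fin.ext_iff]; omega))
        | right i =>
          simp only [hW, Fin.append_right]
          exact hzu _ (by simp [Fin.ext_iff]; omega)
    | right j =>
      refine ⟨c • hμ.slot W (Fin.castAdd m₂ (Fin.natAdd m₁ 0)) ∘ₗ
        hν.slot (fun j => u (Fin.castAdd m₂ (Fin.natAdd m₁ j))) j, fun z hz hzu => ?_⟩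
      rw [tot_pc μ ν h hz, hμ.slot_apply (W := W) (j := Fin.castAdd m₂ (Fin.natAdd m₁ 0)) rfl]
      · simp only [Fin.append_left, Fin.append_right]
        rw [hν.slot_apply (W := fun j => u (Fin.castAdd m₂ (Fin.natAdd m₁ j))) (j := j) rfl]
        · rfl
        · intro i hi
          exact hzu _ (fun e => hi (by simpa [Fin.ext_iff] using e))
      · intro i hi
        induction i using Fin.addCases with
        | left i =>
          induction i using Fin.addCases with
          | left i =>
            simp only [hW, Fin.append_left]
            exact hzu _ (by simp [Fin.ext_iff]; omega)
          | right i =>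
            obtain rfl : i = 0 := Subsingleton.elim _ _
            exact absurd rfl hi
        | right i =>
          simp only [hW, Fin.append_right]
          exact hzu _ (by simp [Fin.ext_iff]; omega)
  | right j =>
    refine ⟨c • hμ.slot W (Fin.natAdd (m₁ + 1) j), fun z hz hzu => ?_⟩
    rw [tot_pc μ ν h hz, hμ.slot_apply (W := W) (j := Fin.natAdd (m₁ + 1) j) rfl]
    · simp only [Fin.append_right]; rfl
    · intro i hi
      induction i using Fin.addCases with
      | left i =>
        induction i using Fin.addCases with
        | left i =>
          simp only [hW, Fin.append_left]
          exact hzu _ (by simp [Fin.ext_iff]; omega)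
        | right i =>
          simp only [hW, Fin.append_left, Fin.append_right]
          exact congrArg (tot ν) (funext fun i => hzu _ (by simp [Fin.ext_iff]; omega))
      | right i =>
        simp only [hW, Fin.append_right]
        exact hzu _ (fun e => hi (by simpa [Fin.ext_iff] using e))

theorem IsMultilinear.fc1 [Bdd L] [Bdd M] {a : ℕ} {r s R : ℤ} {μ : MMap M N 1 r}
    {g : MMap L M a s} (hμ : IsMultilinear k μ) (hg : IsMultilinear k g) (h : r + s = R) :
    IsMultilinear k (fc1 R μ g h) := by
  have := hμ.zp
  have := hg.zp
  refine isMultilinear_of_slot _ (fun d u j => ⟨hμ.slot 0 0 ∘ₗ hg.slot u j, fun z hz hzu => ?_⟩)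
  rw [tot_fc1 μ g h hz, hg.slot_apply rfl hzu]
  exact hμ.slot_apply rfl (fun i hi => absurd (Subsingleton.elim _ _) hi)

theorem IsMultilinear.fc2 [Bdd L] [Bdd M] {a b : ℕ} {r s₁ s₂ R : ℤ} {μ : MMap M N 2 r}
    {g₁ : MMap L M a s₁} {g₂ : MMap L M b s₂} (hμ : IsMultilinear k μ)
    (h₁ : IsMultilinear k g₁) (h₂ : IsMultilinear k g₂) (h : r + (s₁ + s₂) = R) :
    IsMultilinear k (fc2 R μ g₁ g₂ h) := by
  have := hμ.zp
  have := h₁.zp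
  have := h₂.zp
  refine isMultilinear_of_slot _ (fun d u j => ?_)
  set c := ((-1 : ℤ) ^ (s₂ * ∑ j : Fin a, d (Fin.castAdd b j)).natAbs)
  induction j using Fin.addCases with
  | left j =>
    refine ⟨c • hμ.slot ![0, tot g₂ (fun j => u (Fin.natAdd a j))] 0 ∘ₗ
      h₁.slot (fun j => u (Fin.castAdd b j)) j, fun z hz hzu => ?_⟩
    rw [tot_fc2 μ g₁ g₂ h hz]
    refine congrArg (HSMul.hSMul c) ((hμ.slot_apply rfl ?_).trans (congrArg _ ?_))
    · intro i hi
      fin_cases i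
      · exact absurd rfl hi
      · exact congrArg (tot g₂) (funext fun i => hzu _ (by simp [Fin.ext_iff]; omega))
    · exact h₁.slot_apply rfl (fun i hi => hzu _ (fun e => hi (by simpa [Fin.ext_iff] using e)))
  | right j =>
    refine ⟨c • hμ.slot ![tot g₁ (fun j => u (Fin.castAdd b j)), 0] 1 ∘ₗ
      h₂.slot (fun j => u (Fin.natAdd a j)) j, fun z hz hzu => ?_⟩
    rw [tot_fc2 μ g₁ g₂ h hz]
    refine congrArg (HSMul.hSMul c) ((hμ.slot_apply rfl ?_).trans (congrArg _ ?_))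
    · intro i hi
      fin_cases i
      · exact congrArg (tot g₁) (funext fun i => hzu _ (by simp [Fin.ext_iff]; omega))
      · exact absurd rfl hi
    · exact h₂.slot_apply rfl (fun i hi => hzu _ (fun e => hi (by simpa [Fin.ext_iff] using e)))

theorem IsMultilinear.comp_all [Bdd L] {m : ℕ} {r : ℤ} {μ : MMap M N m r} {ν : MMap L N m r}
    [ZP ν] {g : MMap L M 1 0} (hμ : IsMultilinear k μ) (hg : IsMultilinear k g)
    (h : ∀ (d : Fin m → ℤ) (u : Fin m → V L), (∀ j, Deg (u j) (d j)) →
      tot ν u = tot μ (fun j => tot g ![u j])) : IsMultilinear k ν := by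
  refine isMultilinear_of_slot _ (fun d u j =>
    ⟨hμ.slot (fun j => tot g ![u j]) j ∘ₗ hg.slot 0 0, fun z hz hzu => ?_⟩)
  rw [h d z hz, hμ.slot_apply (W := fun j => tot g ![u j]) (j := j) rfl
    (fun i hi => by rw [hzu i hi])]
  exact congrArg (hμ.slot _ j) (hg.slot_apply rfl
    (fun i hi => absurd (Subsingleton.elim _ _) hi))

theorem IsMultilinear.fc3 [Bdd L] [Bdd M] {r : ℤ} {μ : MMap M N 3 r} {g : MMap L M 1 0}
    (hμ : IsMultilinear k μ) (hg : IsMultilinear k g) (h : r + (0 + 0 + 0) = r) :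
    IsMultilinear k (fc3 r μ g g g h) := by
  have := hμ.zp
  have := hg.zp
  refine hμ.comp_all hg (fun d u hu => ?_)
  rw [tot_fc3 μ g g g h hu]
  simp only [zero_mul, add_zero, Int.natAbs_zero, pow_zero, one_smul]
  refine congrArg (tot μ) (funext fun j => ?_)
  fin_cases j <;> exact congrArg (tot g) (funext fun i => by fin_cases i; rfl)

theorem IsMultilinear.fc4 [Bdd L] [Bdd M] {r : ℤ} {μ : MMap M N 4 r} {g : MMap L M 1 0}
    (hμ : IsMultilinear k μ) (hg : IsMultilinear k g) (h : r + (0 + 0 + 0 + 0) = r) :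
    IsMultilinear k (fc4 r μ g g g g h) := by
  have := hμ.zp
  have := hg.zp
  refine hμ.comp_all hg (fun d u hu => ?_)
  rw [tot_fc4 μ g g g g h hu]
  simp only [zero_mul, add_zero, Int.natAbs_zero, pow_zero, one_smul]
  refine congrArg (tot μ) (funext fun j => ?_)
  fin_cases j <;> exact congrArg (tot g) (funext fun i => by fin_cases i; rfl)

end Multilinear

end WL3

namespace WL3

open Finset

section Laws


variable {L M : ℤ → Type} [∀ i, AddCommGroup (L i)]
  [∀ i, AddCommGroup (M i)]

theorem sg_vals : sg (-2) = 1 ∧ sg (-1) = -1 ∧ sg 0 = 1 ∧ sg 1 = -1 ∧ sg 2 = 1 ∧ sg 3 = -1 ∧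
    sg 4 = 1 ∧ sg 5 = -1 ∧ sg 6 = 1 ∧ sg 7 = -1 ∧ sg 8 = 1 := by
  decide

theorem sg_neg (n : ℤ) : sg (-n) = sg n := by
  rw [sg, Int.natAbs_neg]; rfl

section Push

variable [Bdd L] {D : MMap L L 1 (-1)} {l2 : MMap L L 2 0} {l3 : MMap L L 3 1}
  {l4 : MMap L L 4 2} {l21 : MMap L L 2 1} {l211 : MMap L L 2 2} {l31 l32 : MMap L L 3 2}
  [MA D] [ZP l2] [ZP l3] [ZP l4] [ZP l21] [ZP l211] [ZP l31] [ZP l32]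

theorem push_l2 (e : bd (-1) D D l2 = 0) (u v : V L) {a b : ℤ} [Deg u a] [Deg v b] :
    T1 D (T2 l2 u v) = T2 l2 (T1 D u) v + sg a • T2 l2 u (T1 D v) := by
  have E := congrArg (tot · ![u, v]) e
  simp only [bd_two, tot_sub, tot_add, tot_zsmul, tot_zero] at E
  simp only [tot_two, T2_fc1, T2_pc_0_1, T2_pc_1_0, sg_vals, one_smul, neg_one_mul] at E
  rw [sub_eq_zero.mp E, sg_neg]

theorem push_l3 (e : bd 0 D D l3 =
    pc 0 1 0 l2 l2 - pc 0 0 1 l2 l2 - pa (P12 3) (pc 0 1 0 l2 l2)) (u v w : V L) {a b c : ℤ}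
    [Deg u a] [Deg v b] [Deg w c] :
    T1 D (T3 l3 u v w) = -T3 l3 (T1 D u) v w - sg a • T3 l3 u (T1 D v) w
      - sg (a + b) • T3 l3 u v (T1 D w) + T2 l2 u (T2 l2 v w) - T2 l2 (T2 l2 u v) w
      - sg (a * b) • T2 l2 v (T2 l2 u w) := by
  have E := congrArg (tot · ![u, v, w]) e
  simp only [bd_three, tot_sub, tot_add, tot_zsmul] at E
  simp only [tot_three, T3_fc1, T3_P12, T3_pc_0_1, T3_pc_1_0, T3_pc_0_2, T3_pc_1_1, T3_pc_2_0,
    sg_vals, one_smul, neg_one_mul, zero_mul, sg_neg] at E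
  linear_combination (norm := module) E

theorem push_l4 (he : bd 1 D D l4 =
    pc 1 0 1 l2 l3 + pc 1 1 0 l2 l3 - pa (P12 4) (pc 1 1 0 l2 l3)
      + pa (P123 4) (pc 1 1 0 l2 l3) - pc 1 0 2 l3 l2
      + pc 1 1 1 l3 l2 - pa (P12 4) (pc 1 1 1 l3 l2)
      - pc 1 2 0 l3 l2 + pa (P23 4) (pc 1 2 0 l3 l2) - pa (P132 4) (pc 1 2 0 l3 l2))
    (u v w x : V L) {a b c e : ℤ} [Deg u a] [Deg v b] [Deg w c] [Deg x e] :
    T1 D (T4 l4 u v w x) = T4 l4 (T1 D u) v w x + sg a • T4 l4 u (T1 D v) w x + sg (a + b) • T4 l4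
      u v (T1 D w) x + sg (a + b + c) • T4 l4 u v w (T1 D x) + T2 l2 (T3 l3 u v w) x + sg a • T2
      l2 u (T3 l3 v w x) - sg (a * b + b) • T2 l2 v (T3 l3 u w x) + sg (a * c + b * c + c) • T2 l2
      w (T3 l3 u v x) - T3 l3 (T2 l2 u v) w x + T3 l3 u (T2 l2 v w) x - sg (a * b) • T3 l3 v (T2
      l2 u w) x - T3 l3 u v (T2 l2 w x) + sg (b * c) • T3 l3 u w (T2 l2 v x) - sg (a * b + a * c)
      • T3 l3 v w (T2 l2 u x) := by
  have E := congrArg (tot · ![u, v, w, x]) he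
  simp only [bd_four, tot_sub, tot_add, tot_zsmul] at E
  simp only [tot_four, T4_P12, T4_P123, T4_P132, T4_P23, T4_fc1, T4_pc_0_1, T4_pc_0_2, T4_pc_0_3,
    T4_pc_1_0, T4_pc_1_1, T4_pc_1_2, T4_pc_2_0, T4_pc_2_1, T4_pc_3_0, sg_vals, sg_neg, sg_add,
    one_mul, one_smul, neg_one_mul, zero_mul] at E
  simp only [sg_add]
  linear_combination (norm := module) E

theorem push_l21 (he : bd 0 D D l21 =
    l2 + pa (P12 2) l2)
    (u v : V L) {a b : ℤ} [Deg u a] [Deg v b] :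
    T1 D (T2 l21 u v) = -T2 l21 (T1 D u) v - sg a • T2 l21 u (T1 D v) + T2 l2 u v + sg (a * b) •
      T2 l2 v u := by
  have E := congrArg (tot · ![u, v]) he
  simp only [bd_two, tot_sub, tot_add, tot_zsmul] at E
  simp only [tot_two, T2_P12, T2_fc1, T2_pc_0_1, T2_pc_1_0, sg_vals, sg_neg, neg_one_mul] at E
  linear_combination (norm := module) E

theorem push_l211 (he : bd 1 D D l211 =
    l21 - pa (P12 2) l21)
    (u v : V L) {a b : ℤ} [Deg u a] [Deg v b] :
    T1 D (T2 l211 u v) = T2 l211 (T1 D u) v + sg a • T2 l211 u (T1 D v) + T2 l21 u v - sg (a * b)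
      • T2 l21 v u := by
  have E := congrArg (tot · ![u, v]) he
  simp only [bd_two, tot_sub, tot_add, tot_zsmul] at E
  simp only [tot_two, T2_P12, T2_fc1, T2_pc_0_1, T2_pc_1_0, sg_vals, sg_neg, one_smul,
    neg_one_mul] at E
  linear_combination (norm := module) E

theorem push_l31 (he : bd 1 D D l31 =
    l3 + pa (P12 3) l3 + pc 1 0 1 l2 l21)
    (u v w : V L) {a b c : ℤ} [Deg u a] [Deg v b] [Deg w c] :
    T1 D (T3 l31 u v w) = T3 l31 (T1 D u) v w + sg a • T3 l31 u (T1 D v) w + sg (a + b) • T3 l31 u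
      v (T1 D w) + T3 l3 u v w + sg (a * b) • T3 l3 v u w + T2 l2 (T2 l21 u v) w := by
  have E := congrArg (tot · ![u, v, w]) he
  simp only [bd_three, tot_sub, tot_add, tot_zsmul] at E
  simp only [tot_three, T3_P12, T3_fc1, T3_pc_0_1, T3_pc_0_2, T3_pc_1_1, T3_pc_2_0, sg_vals, sg_neg,
    sg_add, one_smul, neg_one_mul] at E
  simp only [sg_add]
  linear_combination (norm := module) E

theorem push_l32 (he : bd 1 D D l32 =
    l3 + pa (P23 3) l3 - pc 1 1 0 l2 l21 + pc 1 0 1 l21 l2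
        + pa (P12 3) (pc 1 1 0 l21 l2))
    (u v w : V L) {a b c : ℤ} [Deg u a] [Deg v b] [Deg w c] :
    T1 D (T3 l32 u v w) = T3 l32 (T1 D u) v w + sg a • T3 l32 u (T1 D v) w + sg (a + b) • T3 l32 u
      v (T1 D w) + T3 l3 u v w + sg (b * c) • T3 l3 u w v - sg a • T2 l2 u (T2 l21 v w) + T2 l21
      (T2 l2 u v) w + sg (a * b) • T2 l21 v (T2 l2 u w) := by
  have E := congrArg (tot · ![u, v, w]) he
  simp only [bd_three, tot_sub, tot_add, tot_zsmul] at E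
  simp only [tot_three, T3_P12, T3_P23, T3_fc1, T3_pc_0_1, T3_pc_0_2, T3_pc_1_0, T3_pc_1_1,
    T3_pc_2_0, sg_vals, sg_neg, sg_add, one_mul, one_smul, neg_one_mul, zero_mul] at E
  simp only [sg_add]
  linear_combination (norm := module) E


end Push

end Laws

end WL3

namespace WL3

open Finset

section Low

set_option linter.unusedSectionVars false

variable {k : Type} [CommRing k] {L L' : ℤ → Type} [∀ i, AddCommGroup (L i)]
  [∀ i, Module k (L i)] [∀ i, AddCommGroup (L' i)] [∀ i, Module k (L' i)]

theorem WeakLie3.bdd (A : WeakLie3 k L) : Bdd L := ⟨A.bound⟩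

section Instances

variable (A : WeakLie3 k L)

instance : MA A.D := A.linD.ma
instance : MA A.l2 := A.leib.lin2.ma
instance : MA A.l3 := A.leib.lin3.ma
instance : MA A.l4 := A.leib.lin4.ma
instance : MA A.l21 := A.lin21.ma
instance : MA A.l211 := A.lin211.ma
instance : MA A.l31 := A.lin31.ma
instance : MA A.l32 := A.lin32.ma

end Instances

section Retract

variable [Bdd L] [Bdd L'] {D : MMap L L 1 (-1)} {D' : MMap L' L' 1 (-1)} {p : MMap L L' 1 0}
  {i : MMap L' L 1 0} {h : MMap L L 1 1} [MA D] [MA D'] [MA p] [MA i] [MA h]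

theorem IsDefRetract.push_i (H : IsDefRetract k D D' p i h) (u : V L') {a : ℤ} [Deg u a] :
    T1 D (T1 i u) = T1 i (T1 D' u) := by
  have E := congrArg (tot · ![u]) H.chaini
  simp only [bd_one, tot_sub, tot_zsmul, tot_zero] at E
  simp only [tot_one, T1_fc1, T1_pc_0_0, sg_vals, one_smul] at E
  exact sub_eq_zero.mp E

theorem IsDefRetract.push_p (H : IsDefRetract k D D' p i h) (u : V L) {a : ℤ} [Deg u a] :
    T1 D' (T1 p u) = T1 p (T1 D u) := by
  have E := congrArg (tot · ![u]) H.chainp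
  simp only [bd_one, tot_sub, tot_zsmul, tot_zero] at E
  simp only [tot_one, T1_fc1, T1_pc_0_0, sg_vals, one_smul] at E
  exact sub_eq_zero.mp E

theorem IsDefRetract.push_h (H : IsDefRetract k D D' p i h) (u : V L) {a : ℤ} [Deg u a] :
    T1 D (T1 h u) = u + -T1 i (T1 p u) + -T1 h (T1 D u) := by
  have E := congrArg (tot · ![u]) H.homotopy
  simp only [tot_sub, tot_add] at E
  simp only [tot_one, T1_fc1, T1_idm] at E
  rw [← sub_eq_add_neg, ← sub_eq_add_neg, E, add_sub_cancel_right]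

theorem IsDefRetract.pi (H : IsDefRetract k D D' p i h) (u : V L') {a : ℤ} [Deg u a] :
    T1 p (T1 i u) = u := by
  have E := congrArg (tot · ![u]) H.retract
  simpa only [tot_one, T1_fc1, T1_idm] using E

end Retract

section Transfer

variable (A : WeakLie3 k L) {D' : MMap L' L' 1 (-1)} {p : MMap L L' 1 0} {i : MMap L' L 1 0}
  {h : MMap L L 1 1} [Bdd L] [Bdd L']

section Multilinear

variable (H : IsDefRetract k A.D D' p i h)

include H

theorem hl2_lin : IsMultilinear k (hl2 A h) := H.linh.fc1 A.leib.lin2 _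

theorem hl3_lin : IsMultilinear k (hl3 A h) := H.linh.fc1 A.leib.lin3 _

theorem hl21_lin : IsMultilinear k (hl21 A h) := H.linh.fc1 A.lin21 _

theorem tl2_lin : IsMultilinear k (tl2 A p i) :=
  H.linp.fc1 (A.leib.lin2.fc2 H.lini H.lini _) _

theorem tl21_lin : IsMultilinear k (tl21 A p i) :=
  H.linp.fc1 (A.lin21.fc2 H.lini H.lini _) _

theorem tl211_lin : IsMultilinear k (tl211 A p i) :=
  H.linp.fc1 (A.lin211.fc2 H.lini H.lini _) _

theorem ti2_lin : IsMultilinear k (ti2 A i h) :=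
  (H.linh.fc1 (A.leib.lin2.fc2 H.lini H.lini _) _).neg

theorem ti21_lin : IsMultilinear k (ti21 A i h) :=
  (H.linh.fc1 (A.lin21.fc2 H.lini H.lini _) _).neg

theorem tl31_lin : IsMultilinear k (tl31 A p i h) :=
  (H.linp.fc1 (A.lin31.fc3 H.lini _) _).sub
    (H.linp.fc1 ((A.leib.lin2.pc (hl21_lin A H) _).fc3 H.lini _) _)

theorem tl32_lin : IsMultilinear k (tl32 A p i h) := by
  have h2 := hl2_lin A H
  have a := A.lin21.pc (m₁ := 1) (m₂ := 0) h2 (R := 2) (by decide)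
  have b := A.leib.lin2.pc (m₁ := 1) (m₂ := 0) (hl21_lin A H) (R := 2) (by decide)
  have c := A.lin21.pc (m₁ := 0) (m₂ := 1) h2 (R := 2) (by decide)
  exact (H.linp.fc1 (A.lin32.fc3 H.lini _) _).add
    (H.linp.fc1 (((c.add b).add (a.pa (P12 3))).fc3 H.lini _) _)

theorem l2_hl2_lin : IsMultilinear k (pc 1 0 1 A.l2 (hl2 A h)) ∧
    IsMultilinear k (pc 1 1 0 A.l2 (hl2 A h)) :=
  ⟨A.leib.lin2.pc (hl2_lin A H) _, A.leib.lin2.pc (hl2_lin A H) _⟩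

theorem l2_hl2_sum_lin : IsMultilinear k (pc 1 0 1 A.l2 (hl2 A h)
      - (pc 1 1 0 A.l2 (hl2 A h) - pa (P12 3) (pc 1 1 0 A.l2 (hl2 A h)))) :=
  have Z := l2_hl2_lin A H
  Z.1.sub (Z.2.sub (Z.2.pa _))

theorem tl3_lin : IsMultilinear k (tl3 A p i h) :=
  (H.linp.fc1 (A.leib.lin3.fc3 H.lini _) _).add
    (H.linp.fc1 ((l2_hl2_sum_lin A H).fc3 H.lini _) _)

theorem ti3_lin : IsMultilinear k (ti3 A i h) :=
  (H.linh.fc1 (A.leib.lin3.fc3 H.lini _) _).neg.sub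
    (H.linh.fc1 ((l2_hl2_sum_lin A H).fc3 H.lini _) _)

theorem tl4_lin : IsMultilinear k (tl4 A p i h) := by
  have h2 := hl2_lin A H
  have h3 := hl3_lin A H
  have Z := l2_hl2_lin A H
  have a := A.leib.lin2.pc (m₁ := 0) (m₂ := 1) h3 (R := 2) (by decide)
  have b := A.leib.lin2.pc (m₁ := 1) (m₂ := 0) h3 (R := 2) (by decide)
  have c {μ : MMap L L 3 1} (hμ : IsMultilinear k μ) := hμ.pc (m₁ := 0) (m₂ := 2) h2 (R := 2)
    (by decide)
  have d {μ : MMap L L 3 1} (hμ : IsMultilinear k μ) := hμ.pc (m₁ := 1) (m₂ := 1) h2 (R := 2)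
    (by decide)
  have e {μ : MMap L L 3 1} (hμ : IsMultilinear k μ) := hμ.pc (m₁ := 2) (m₂ := 0) h2 (R := 2)
    (by decide)
  have q := A.leib.lin2.fc2 h2 h2 (R := 2) (by decide)
  have X := (((a.add ((b.sub (b.pa (P12 4))).add (b.pa (P123 4)))).add
      (c A.leib.lin3)).sub ((d A.leib.lin3).sub ((d A.leib.lin3).pa (P12 4)))).add
      (((e A.leib.lin3).sub ((e A.leib.lin3).pa (P23 4))).add ((e A.leib.lin3).pa (P132 4)))
  have Y := ((((c Z.1).sub ((d Z.1).sub ((d Z.1).pa (P12 4)))).add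
      ((q.sub (q.pa (P23 4))).add (q.pa (P132 4)))).add
      (((d Z.2).sub ((d Z.2).pa (P12 4))).add ((d Z.2).pa (P123 4)))).sub
      ((((((e Z.2).sub ((e Z.2).pa (P12 4))).add ((e Z.2).pa (P123 4))).sub
        ((e Z.2).pa (P23 4))).add ((e Z.2).pa (P132 4))).sub ((e Z.2).pa (P13 4)))
  exact ((H.linp.fc1 (A.leib.lin4.fc4 H.lini _) _).sub
    (H.linp.fc1 (X.fc4 H.lini _) _)).sub (H.linp.fc1 (Y.fc4 H.lini _) _)

end Multilinear

end Transfer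

end Low

end WL3

namespace WL3

open Finset

section Formulas

set_option linter.unusedSectionVars false

/-! ## The transferred operations on total spaces -/

variable {k : Type} [CommRing k] {L L' : ℤ → Type} [∀ i, AddCommGroup (L i)]
  [∀ i, Module k (L i)] [∀ i, AddCommGroup (L' i)] [∀ i, Module k (L' i)]
  (A : WeakLie3 k L) {p : MMap L L' 1 0} {i : MMap L' L 1 0} {h : MMap L L 1 1}
  [Bdd L] [Bdd L'] [MA p] [MA i] [MA h]

theorem sg_two_mul (n : ℤ) : sg (2 * n) = 1 := by
  rw [two_mul, sg_add, sg, ← mul_pow, neg_mul_neg, one_mul, one_pow]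

theorem sg_eq_or (n : ℤ) : sg n = 1 ∨ sg n = -1 := neg_one_pow_eq_or ℤ _

theorem T2_lin_full {r : ℤ} (u v : V L) (μ : MMap L L' (1 + 1) r) : T2 (-μ) u v = -T2 μ u v :=
  tot_neg _ _

theorem T3_lin_full {r : ℤ} (u v w : V L) :
    (∀ μ ν : MMap L L' (1 + 1 + 1) r, T3 (μ + ν) u v w = T3 μ u v w + T3 ν u v w) ∧
    (∀ μ ν : MMap L L' (1 + 1 + 1) r, T3 (μ - ν) u v w = T3 μ u v w - T3 ν u v w) ∧
    (∀ μ : MMap L L' (1 + 1 + 1) r, T3 (-μ) u v w = -T3 μ u v w) :=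
  ⟨fun _ _ => tot_add _ _ _, fun _ _ => tot_sub _ _ _, fun _ => tot_neg _ _⟩

theorem T4_lin_full {r : ℤ} (u v w x : V L) :
    (∀ μ ν : MMap L L' (1 + 1 + 1 + 1) r, T4 (μ + ν) u v w x = T4 μ u v w x + T4 ν u v w x) ∧
    (∀ μ ν : MMap L L' (1 + 1 + 1 + 1) r, T4 (μ - ν) u v w x = T4 μ u v w x - T4 ν u v w x) :=
  ⟨fun _ _ => tot_add _ _ _, fun _ _ => tot_sub _ _ _⟩

theorem T2_tl2 (u v : V L') {a b : ℤ} [Deg u a] [Deg v b] :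
    T2 (tl2 A p i) u v = T1 p (T2 A.l2 (T1 i u) (T1 i v)) := by
  unfold tl2
  simp only [T2_fc1, T2_fc2_1_1, zero_mul, sg_zero, one_smul]

theorem T2_tl21 (u v : V L') {a b : ℤ} [Deg u a] [Deg v b] :
    T2 (tl21 A p i) u v = T1 p (T2 A.l21 (T1 i u) (T1 i v)) := by
  unfold tl21
  simp only [T2_fc1, T2_fc2_1_1, zero_mul, sg_zero, one_smul]

theorem T2_tl211 (u v : V L') {a b : ℤ} [Deg u a] [Deg v b] :
    T2 (tl211 A p i) u v = T1 p (T2 A.l211 (T1 i u) (T1 i v)) := by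
  unfold tl211
  simp only [T2_fc1, T2_fc2_1_1, zero_mul, sg_zero, one_smul]

theorem T2_ti2 (u v : V L') {a b : ℤ} [Deg u a] [Deg v b] :
    T2 (ti2 A i h) u v = -T1 h (T2 A.l2 (T1 i u) (T1 i v)) := by
  unfold ti2
  simp only [T2_lin_full, T2_fc1, T2_fc2_1_1, zero_mul, sg_zero, one_smul]

theorem T2_ti21 (u v : V L') {a b : ℤ} [Deg u a] [Deg v b] :
    T2 (ti21 A i h) u v = -T1 h (T2 A.l21 (T1 i u) (T1 i v)) := by
  unfold ti21
  simp only [T2_lin_full, T2_fc1, T2_fc2_1_1, zero_mul, sg_zero, one_smul]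

theorem T3_tl3 (u v w : V L') {a b c : ℤ} [Deg u a] [Deg v b] [Deg w c] :
    T3 (tl3 A p i h) u v w = T1 p (T3 A.l3 (T1 i u) (T1 i v) (T1 i w) + T2 A.l2 (T1 h (T2 A.l2 (T1
      i u) (T1 i v))) (T1 i w) - sg a • T2 A.l2 (T1 i u) (T1 h (T2 A.l2 (T1 i v) (T1 i w))) + sg
      (a * b + b) • T2 A.l2 (T1 i v) (T1 h (T2 A.l2 (T1 i u) (T1 i w)))) := by
  simp only [tl3, hl2, T3_lin_full, T3_fc1, T3_fc3_1_1_1, T3_pc_0_1, T3_pc_1_0, T3_P12, T2_fc1,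
    zero_mul, add_zero, zero_add, sg_zero, one_smul, one_mul]
  simp only [sub_eq_add_neg, ← T1_map_add]
  simp only [sg_add]
  congr 1
  module

theorem T3_ti3 (u v w : V L') {a b c : ℤ} [Deg u a] [Deg v b] [Deg w c] :
    T3 (ti3 A i h) u v w = -T1 h (T3 A.l3 (T1 i u) (T1 i v) (T1 i w) + T2 A.l2 (T1 h (T2 A.l2 (T1
      i u) (T1 i v))) (T1 i w) - sg a • T2 A.l2 (T1 i u) (T1 h (T2 A.l2 (T1 i v) (T1 i w))) + sg
      (a * b + b) • T2 A.l2 (T1 i v) (T1 h (T2 A.l2 (T1 i u) (T1 i w)))) := by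
  simp only [ti3, hl2, T3_lin_full, T3_fc1, T3_fc3_1_1_1, T3_pc_0_1, T3_pc_1_0, T3_P12, T2_fc1,
    zero_mul, add_zero, zero_add, sg_zero, one_smul, one_mul]
  simp only [sub_eq_add_neg, ← T1_map_neg, ← T1_map_add]
  simp only [sg_add]
  congr 1
  module

theorem T3_tl31 (u v w : V L') {a b c : ℤ} [Deg u a] [Deg v b] [Deg w c] :
    T3 (tl31 A p i h) u v w = T1 p (T3 A.l31 (T1 i u) (T1 i v) (T1 i w) - T2 A.l2 (T1 h (T2 A.l21
      (T1 i u) (T1 i v))) (T1 i w)) := by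
  simp only [tl31, hl21, T3_lin_full, T3_fc1, T3_fc3_1_1_1, T3_pc_0_1, T2_fc1, zero_mul, add_zero,
    sg_zero, one_smul]
  simp only [sub_eq_add_neg, ← T1_map_neg, ← T1_map_add]

theorem T3_tl32 (u v w : V L') {a b c : ℤ} [Deg u a] [Deg v b] [Deg w c] :
    T3 (tl32 A p i h) u v w = T1 p (T3 A.l32 (T1 i u) (T1 i v) (T1 i w) + T2 A.l21 (T1 h (T2 A.l2
      (T1 i u) (T1 i v))) (T1 i w) + T2 A.l2 (T1 i u) (T1 h (T2 A.l21 (T1 i v) (T1 i w))) + sg (a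
      * b + b) • T2 A.l21 (T1 i v) (T1 h (T2 A.l2 (T1 i u) (T1 i w)))) := by
  simp only [tl32, hl2, hl21, T3_lin_full, T3_fc1, T3_fc3_1_1_1, T3_pc_0_1, T3_pc_1_0, T3_P12,
    T2_fc1, zero_mul, sg_two_mul, add_zero, zero_add, sg_zero, one_smul, one_mul]
  simp only [← T1_map_add]
  simp only [sg_add]
  congr 1
  module

theorem T4_tl4 (u v w x : V L') {a b c e : ℤ} [Deg u a] [Deg v b] [Deg w c] [Deg x e] :
    T4 (tl4 A p i h) u v w x = T1 p (T4 A.l4 (T1 i u) (T1 i v) (T1 i w) (T1 i x) - T2 A.l2 (T1 h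
      (T3 A.l3 (T1 i u) (T1 i v) (T1 i w))) (T1 i x) - T2 A.l2 (T1 i u) (T1 h (T3 A.l3 (T1 i v)
      (T1 i w) (T1 i x))) + sg (a * b) • T2 A.l2 (T1 i v) (T1 h (T3 A.l3 (T1 i u) (T1 i w) (T1 i
      x))) - sg (a * c + b * c) • T2 A.l2 (T1 i w) (T1 h (T3 A.l3 (T1 i u) (T1 i v) (T1 i x))) -
      T3 A.l3 (T1 h (T2 A.l2 (T1 i u) (T1 i v))) (T1 i w) (T1 i x) + sg a • T3 A.l3 (T1 i u) (T1 h
      (T2 A.l2 (T1 i v) (T1 i w))) (T1 i x) - sg (a * b + b) • T3 A.l3 (T1 i v) (T1 h (T2 A.l2 (T1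
      i u) (T1 i w))) (T1 i x) - sg (a + b) • T3 A.l3 (T1 i u) (T1 i v) (T1 h (T2 A.l2 (T1 i w)
      (T1 i x))) + sg (b * c + a + c) • T3 A.l3 (T1 i u) (T1 i w) (T1 h (T2 A.l2 (T1 i v) (T1 i
      x))) - sg (a * b + a * c + b + c) • T3 A.l3 (T1 i v) (T1 i w) (T1 h (T2 A.l2 (T1 i u) (T1 i
      x))) - T2 A.l2 (T1 h (T2 A.l2 (T1 h (T2 A.l2 (T1 i u) (T1 i v))) (T1 i w))) (T1 i x) + sg a
      • T2 A.l2 (T1 h (T2 A.l2 (T1 i u) (T1 h (T2 A.l2 (T1 i v) (T1 i w))))) (T1 i x) - sg (a * b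
      + b) • T2 A.l2 (T1 h (T2 A.l2 (T1 i v) (T1 h (T2 A.l2 (T1 i u) (T1 i w))))) (T1 i x) - sg (a
      + b) • T2 A.l2 (T1 h (T2 A.l2 (T1 i u) (T1 i v))) (T1 h (T2 A.l2 (T1 i w) (T1 i x))) + sg (b
      * c + a + c) • T2 A.l2 (T1 h (T2 A.l2 (T1 i u) (T1 i w))) (T1 h (T2 A.l2 (T1 i v) (T1 i x)))
      - sg (a * b + a * c + b + c) • T2 A.l2 (T1 h (T2 A.l2 (T1 i v) (T1 i w))) (T1 h (T2 A.l2 (T1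
      i u) (T1 i x))) - T2 A.l2 (T1 i u) (T1 h (T2 A.l2 (T1 h (T2 A.l2 (T1 i v) (T1 i w))) (T1 i
      x))) + sg (a * b) • T2 A.l2 (T1 i v) (T1 h (T2 A.l2 (T1 h (T2 A.l2 (T1 i u) (T1 i w))) (T1 i
      x))) - sg (a * c + b * c) • T2 A.l2 (T1 i w) (T1 h (T2 A.l2 (T1 h (T2 A.l2 (T1 i u) (T1 i
      v))) (T1 i x))) + sg b • T2 A.l2 (T1 i u) (T1 h (T2 A.l2 (T1 i v) (T1 h (T2 A.l2 (T1 i w)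
      (T1 i x))))) - sg (a * b + a) • T2 A.l2 (T1 i v) (T1 h (T2 A.l2 (T1 i u) (T1 h (T2 A.l2 (T1
      i w) (T1 i x))))) + sg (a * c + b * c + a) • T2 A.l2 (T1 i w) (T1 h (T2 A.l2 (T1 i u) (T1 h
      (T2 A.l2 (T1 i v) (T1 i x))))) - sg (b * c + c) • T2 A.l2 (T1 i u) (T1 h (T2 A.l2 (T1 i w)
      (T1 h (T2 A.l2 (T1 i v) (T1 i x))))) + sg (a * b + a * c + c) • T2 A.l2 (T1 i v) (T1 h (T2
      A.l2 (T1 i w) (T1 h (T2 A.l2 (T1 i u) (T1 i x))))) - sg (a * b + a * c + b * c + b) • T2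
      A.l2 (T1 i w) (T1 h (T2 A.l2 (T1 i v) (T1 h (T2 A.l2 (T1 i u) (T1 i x)))))) := by
  have z₁ : ZP (m := 3) (pc 1 0 1 A.l2 (hl2 A h)) :=
    inferInstanceAs (ZP (pc 1 0 1 A.l2 (fc1 1 h A.l2)))
  have z₂ : ZP (m := 3) (pc 1 1 0 A.l2 (hl2 A h)) :=
    inferInstanceAs (ZP (pc 1 1 0 A.l2 (fc1 1 h A.l2)))
  have e₁ (u v w : V L) {a b c : ℤ} [Deg u a] [Deg v b] [Deg w c] :
      T3 (pc 1 0 1 A.l2 (hl2 A h)) u v w = T2 A.l2 (T1 h (T2 A.l2 u v)) w := by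
    simp only [hl2, T3_pc_0_1, T2_fc1]
  have e₂ (u v w : V L) {a b c : ℤ} [Deg u a] [Deg v b] [Deg w c] :
      T3 (pc 1 1 0 A.l2 (hl2 A h)) u v w = sg a • T2 A.l2 u (T1 h (T2 A.l2 v w)) := by
    simp only [hl2, T3_pc_1_0, T2_fc1, one_mul]
  have z₃ : ZP (m := 4) (fc2 2 A.l2 (hl2 A h) (hl2 A h)) :=
    inferInstanceAs (ZP (fc2 2 A.l2 (fc1 1 h A.l2) (fc1 1 h A.l2)))
  have e₃ (u v w x : V L) {a b c e : ℤ} [Deg u a] [Deg v b] [Deg w c] [Deg x e] :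
      T4 (fc2 2 A.l2 (hl2 A h) (hl2 A h)) u v w x =
        sg (a + b) • T2 A.l2 (T1 h (T2 A.l2 u v)) (T1 h (T2 A.l2 w x)) := by
    simp only [hl2, T4_fc2_2_2, T2_fc1, one_mul]
  unfold tl4
  generalize (pc 1 0 1 A.l2 (hl2 A h)) = s₁ at *
  generalize (pc 1 1 0 A.l2 (hl2 A h)) = s₂ at *
  generalize fc2 2 A.l2 (hl2 A h) (hl2 A h) = s₃ at *
  change MMap L L 3 1 at s₁ s₂
  change MMap L L 4 2 at s₃
  have F (Y : MMap L L 4 2) [ZP Y] : T4 (fc1 2 p (fc4 2 Y i i i i)) u v w x =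
      T1 p (T4 Y (T1 i u) (T1 i v) (T1 i w) (T1 i x)) := by
    simp only [T4_fc1, T4_fc4_1_1_1_1, zero_mul, add_zero, sg_zero, one_smul]
  simp only [hl2, hl3]
  refine ((tot_sub _ _ _).trans (congrArg₂ HSub.hSub ((tot_sub _ _ _).trans
    (congrArg₂ HSub.hSub (F _) (F _))) (F _))).trans ?_
  simp only [e₁, e₂, e₃, T4_lin_full, T4_pc_0_1, T4_pc_1_0, T4_pc_0_2, T4_pc_1_1, T4_pc_2_0, T4_P12,
    T4_P23, T4_P123, T4_P132, T4_P13, T3_fc1, T2_fc1, sg_two_mul, zero_add, one_smul, one_mul]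
  simp only [sub_eq_add_neg, ← T1_map_neg, ← T1_map_add]
  simp only [sg_add]
  congr 1
  rcases sg_eq_or a with ha | ha <;> rcases sg_eq_or b with hb | hb <;>
    rcases sg_eq_or c with hc | hc <;> simp only [ha, hb, hc] <;>
  module

end Formulas

end WL3

namespace WL3

open Finset

section Boundary

variable {L M : ℤ → Type} [∀ i, AddCommGroup (L i)] [∀ i, AddCommGroup (M i)]

theorem ZP.mcast {m n : ℕ} {r s : ℤ} (hm : m = n) (hr : r = s) {μ : MMap L M m r} (hμ : ZP μ) :
    ZP (WL3.mcast hm hr μ) := by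
  subst hm hr
  exact hμ

instance {m : ℕ} {r R : ℤ} (D' : MMap M M 1 (-1)) (D : MMap L L 1 (-1)) (μ : MMap L M m r)
    (e : -1 + r = R) [ZP D'] [ZP D] [ZP μ] : ZP (bd R D' D μ e) := by
  refine ZP.mcast rfl e ?_
  have h₁ : ZP (comp₁ D' μ) := inferInstanceAs (ZP (fc1 _ D' μ rfl))
  have h₂ (m₁ m₂ : ℕ) (e₁ : m = m₁ + 1 + m₂) (e₂ : m₁ + 1 + m₂ = m) (e₃ : r + -1 = -1 + r) :
      ZP (WL3.mcast e₂ e₃ (pcomp m₁ m₂ (WL3.mcast e₁ rfl μ) D)) := by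
    have := ZP.mcast e₁ rfl ‹ZP μ›
    exact ZP.mcast e₂ e₃ inferInstance
  unfold bdry
  have h₃ := Finset.sum_induction (s := Finset.univ) (fun q : Fin m => WL3.mcast
    (by have := q.isLt; omega) (by ring) (pcomp q.val (m - 1 - q.val) (WL3.mcast
      (by have := q.isLt; omega) rfl μ) D)) (ZP (r := -1 + r)) (fun μ ν _ _ => inferInstance)
    inferInstance fun q _ => h₂ _ _ _ _ _
  infer_instance

end Boundary

theorem deg_three_le_two {a b c : ℤ} (ha : 0 ≤ a) (hb : 0 ≤ b) (hc : 0 ≤ c) (hr : a + b + c ≤ 2) :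
    a = 0 ∧ b = 0 ∧ c = 0 ∨ a = 0 ∧ b = 0 ∧ c = 1 ∨ a = 0 ∧ b = 1 ∧ c = 0 ∨ a = 1 ∧ b = 0 ∧ c = 0 ∨
    a = 0 ∧ b = 0 ∧ c = 2 ∨ a = 0 ∧ b = 1 ∧ c = 1 ∨ a = 0 ∧ b = 2 ∧ c = 0 ∨ a = 1 ∧ b = 0 ∧ c = 1 ∨
    a = 1 ∧ b = 1 ∧ c = 0 ∨ a = 2 ∧ b = 0 ∧ c = 0 := by
  omega

theorem deg_three_le_one {a b c : ℤ} (ha : 0 ≤ a) (hb : 0 ≤ b) (hc : 0 ≤ c) (hr : a + b + c ≤ 1) :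
    a = 0 ∧ b = 0 ∧ c = 0 ∨ a = 0 ∧ b = 0 ∧ c = 1 ∨ a = 0 ∧ b = 1 ∧ c = 0 ∨ a = 1 ∧ b = 0 ∧ c = 0
    := by
  omega

theorem deg_four_le_one {a b c e : ℤ} (ha : 0 ≤ a) (hb : 0 ≤ b) (hc : 0 ≤ c) (he : 0 ≤ e) (hr : a +
    b + c + e ≤ 1) : a = 0 ∧ b = 0 ∧ c = 0 ∧ e = 0 ∨ a = 0 ∧ b = 0 ∧ c = 0 ∧ e = 1 ∨ a = 0 ∧ b = 0
    ∧ c = 1 ∧ e = 0 ∨ a = 0 ∧ b = 1 ∧ c = 0 ∧ e = 0 ∨ a = 1 ∧ b = 0 ∧ c = 0 ∧ e = 0 := by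
  omega

theorem deg_two_le_two {a b : ℤ} (ha : 0 ≤ a) (hb : 0 ≤ b) (hr : a + b ≤ 2) : a = 0 ∧ b = 0 ∨ a = 0
    ∧ b = 1 ∨ a = 1 ∧ b = 0 ∨ a = 0 ∧ b = 2 ∨ a = 1 ∧ b = 1 ∨ a = 2 ∧ b = 0 := by
  omega

theorem deg_two_le_one {a b : ℤ} (ha : 0 ≤ a) (hb : 0 ≤ b) (hr : a + b ≤ 1) : a = 0 ∧ b = 0 ∨ a = 0
    ∧ b = 1 ∨ a = 1 ∧ b = 0 := by
  omega

section DLaws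

set_option linter.unusedSectionVars false

variable {k : Type} [CommRing k] {L L' : ℤ → Type} [∀ i, AddCommGroup (L i)]
  [∀ i, Module k (L i)] [∀ i, AddCommGroup (L' i)] [∀ i, Module k (L' i)]
  (A : WeakLie3 k L) {D' : MMap L' L' 1 (-1)} {p : MMap L L' 1 0} {i : MMap L' L 1 0}
  {h : MMap L L 1 1} [Bdd L] [Bdd L'] [MA D'] [MA p] [MA i] [MA h]
  (H : IsDefRetract k A.D D' p i h)

include H

theorem tl_eqL1 : bd (-1) D' D' (tl2 A p i) = 0 := by
  have := (tl2_lin A H).ma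
  refine ext_T2 fun a b u v _ _ ha hb hr => ?_
  simp only [T2, bd_two, tot_sub, tot_add, tot_zsmul, tot_zero]
  simp only [tot_two, T2_fc1, T2_pc_0_1, T2_pc_1_0, T2_tl2, H.push_p, ← H.push_i, push_l2
    A.leib.eqL1, sg_neg, sg_vals, one_smul, neg_one_mul, zero_add]
  rcases sg_eq_or a with ha | ha <;>
    simp only [ha, T1_map_add, T1_map_neg, neg_smul, one_smul] <;> abel

theorem tl_eqL2 : bd 0 D' D' (tl3 A p i h) = pc 0 1 0 (tl2 A p i) (tl2 A p i) - pc 0 0 1 (tl2 A p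
    i) (tl2 A p i) - pa (P12 3) (pc 0 1 0 (tl2 A p i) (tl2 A p i)) := by
  have := (tl2_lin A H).ma
  have := (tl3_lin A H).ma
  refine ext_T3 fun a b c u v w _ _ _ ha hb hc hr => ?_
  simp only [T3, bd_three, tot_sub, tot_add, tot_zsmul]
  simp only [tot_three, T3_fc1, T3_P12, T3_pc_0_1, T3_pc_1_0, T3_pc_0_2, T3_pc_1_1, T3_pc_2_0,
    ↓T2_tl2, T3_tl3, ← H.push_i]
  rcases deg_three_le_two ha hb hc (by omega) with ⟨rfl, rfl, rfl⟩ | ⟨rfl, rfl, rfl⟩ | ⟨rfl, rfl, rfl⟩ | ⟨rfl, rfl, rfl⟩ |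
    ⟨rfl, rfl, rfl⟩ | ⟨rfl, rfl, rfl⟩ | ⟨rfl, rfl, rfl⟩ | ⟨rfl, rfl, rfl⟩ |
    ⟨rfl, rfl, rfl⟩ | ⟨rfl, rfl, rfl⟩ <;>
  simp only [Int.reduceAdd, Int.reduceMul, Int.reduceNeg, sg_neg, sg_vals, neg_smul, one_smul,
    sub_eq_add_neg, push_l2 A.leib.eqL1, push_l3 A.leib.eqL2, H.push_p, H.push_h, T1_map_add,
    T1_map_neg, T2_map_add, T2_map_neg] <;>
  abel

set_option maxHeartbeats 2000000 in
theorem tl_eqL3 : bd 1 D' D' (tl4 A p i h) = pc 1 0 1 (tl2 A p i) (tl3 A p i h) + pc 1 1 0 (tl2 A p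
    i) (tl3 A p i h) - pa (P12 4) (pc 1 1 0 (tl2 A p i) (tl3 A p i h)) + pa (P123 4) (pc 1 1 0 (tl2
    A p i) (tl3 A p i h)) - pc 1 0 2 (tl3 A p i h) (tl2 A p i) + pc 1 1 1 (tl3 A p i h) (tl2 A p i)
    - pa (P12 4) (pc 1 1 1 (tl3 A p i h) (tl2 A p i)) - pc 1 2 0 (tl3 A p i h) (tl2 A p i) + pa
    (P23 4) (pc 1 2 0 (tl3 A p i h) (tl2 A p i)) - pa (P132 4) (pc 1 2 0 (tl3 A p i h) (tl2 A p i))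
    := by
  have := (tl2_lin A H).ma
  have := (tl3_lin A H).ma
  have := (tl4_lin A H).ma
  refine ext_T4 fun a b c e u v w x _ _ _ _ ha hb hc he hr => ?_
  simp only [T4, bd_four, tot_sub, tot_add, tot_zsmul]
  simp only [tot_four, T4_fc1, T4_P12, T4_P123, T4_P132, T4_P23, T4_pc_0_1, T4_pc_0_2, T4_pc_0_3,
    T4_pc_1_0, T4_pc_1_1, T4_pc_1_2, T4_pc_2_0, T4_pc_2_1, T4_pc_3_0, ↓T2_tl2, T3_tl3, T4_tl4, ←
    H.push_i]
  rcases deg_four_le_one ha hb hc he (by omega) with ⟨rfl, rfl, rfl, rfl⟩ | ⟨rfl, rfl, rfl, rfl⟩ | ⟨rfl, rfl, rfl, rfl⟩ | ⟨rfl, rfl, rfl, rfl⟩ |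
    ⟨rfl, rfl, rfl, rfl⟩ <;>
  simp only [Int.reduceAdd, Int.reduceMul, Int.reduceNeg, sg_neg, sg_vals, neg_smul, one_smul,
    sub_eq_add_neg, push_l2 A.leib.eqL1, push_l3 A.leib.eqL2, push_l4 A.leib.eqL3, H.push_p,
    H.push_h, T1_map_add, T1_map_neg, T2_map_add, T2_map_neg, T3_map_add, T3_map_neg] <;>
  abel

theorem tl_w1 : bd 0 D' D' (tl21 A p i) = (tl2 A p i) + pa (P12 2) (tl2 A p i) := by
  have := (tl2_lin A H).ma
  have := (tl21_lin A H).ma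
  refine ext_T2 fun a b u v _ _ ha hb hr => ?_
  simp only [T2, bd_two, tot_sub, tot_add, tot_zsmul]
  simp only [tot_two, T2_fc1, T2_P12, T2_pc_0_1, T2_pc_1_0, ↓T2_tl2, T2_tl21, H.push_p, ← H.push_i]
  rcases deg_two_le_two ha hb (by omega) with ⟨rfl, rfl⟩ | ⟨rfl, rfl⟩ | ⟨rfl, rfl⟩ | ⟨rfl, rfl⟩ |
    ⟨rfl, rfl⟩ | ⟨rfl, rfl⟩ <;>
  simp only [Int.reduceAdd, Int.reduceMul, Int.reduceNeg, sg_neg, sg_vals, neg_smul, one_smul,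
    sub_eq_add_neg, push_l21 A.w1, T1_map_add, T1_map_neg] <;>
  abel

theorem tl_w2 : bd 1 D' D' (tl211 A p i) = (tl21 A p i) - pa (P12 2) (tl21 A p i) := by
  have := (tl21_lin A H).ma
  have := (tl211_lin A H).ma
  refine ext_T2 fun a b u v _ _ ha hb hr => ?_
  simp only [T2, bd_two, tot_sub, tot_add, tot_zsmul]
  simp only [tot_two, T2_fc1, T2_P12, T2_pc_0_1, T2_pc_1_0, T2_tl21, T2_tl211, H.push_p, ← H.push_i]
  rcases deg_two_le_one ha hb (by omega) with ⟨rfl, rfl⟩ | ⟨rfl, rfl⟩ | ⟨rfl, rfl⟩ <;>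
  simp only [Int.reduceAdd, Int.reduceMul, Int.reduceNeg, sg_neg, sg_vals, neg_smul, one_smul,
    sub_eq_add_neg, push_l211 A.w2, T1_map_add, T1_map_neg]
    <;>
  abel

theorem tl_w3 : bd 1 D' D' (tl31 A p i h) = (tl3 A p i h) + pa (P12 3) (tl3 A p i h) + pc 1 0 1
    (tl2 A p i) (tl21 A p i) := by
  have := (tl2_lin A H).ma
  have := (tl21_lin A H).ma
  have := (tl3_lin A H).ma
  have := (tl31_lin A H).ma
  refine ext_T3 fun a b c u v w _ _ _ ha hb hc hr => ?_
  simp only [T3, bd_three, tot_sub, tot_add, tot_zsmul]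
  simp only [tot_three, T3_fc1, T3_P12, T3_pc_0_1, T3_pc_0_2, T3_pc_1_1, T3_pc_2_0, ↓T2_tl2,
    T2_tl21, T3_tl3, T3_tl31, ← H.push_i]
  rcases deg_three_le_one ha hb hc (by omega) with ⟨rfl, rfl, rfl⟩ | ⟨rfl, rfl, rfl⟩ | ⟨rfl, rfl, rfl⟩ | ⟨rfl, rfl, rfl⟩ <;>
  simp only [Int.reduceAdd, Int.reduceMul, Int.reduceNeg, sg_neg, sg_vals, neg_smul, one_smul,
    sub_eq_add_neg, push_l2 A.leib.eqL1, push_l21 A.w1, push_l31 A.w3, H.push_p, H.push_h,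
    T1_map_add, T1_map_neg, T2_map_add, T2_map_neg] <;>
  abel

theorem tl_w4 : bd 1 D' D' (tl32 A p i h) = (tl3 A p i h) + pa (P23 3) (tl3 A p i h) - pc 1 1 0
    (tl2 A p i) (tl21 A p i) + pc 1 0 1 (tl21 A p i) (tl2 A p i) + pa (P12 3) (pc 1 1 0 (tl21 A p
    i) (tl2 A p i)) := by
  have := (tl2_lin A H).ma
  have := (tl21_lin A H).ma
  have := (tl3_lin A H).ma
  have := (tl32_lin A H).ma
  refine ext_T3 fun a b c u v w _ _ _ ha hb hc hr => ?_
  simp only [T3, bd_three, tot_sub, tot_add, tot_zsmul]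
  simp only [tot_three, T3_fc1, T3_P23, T3_P12, T3_pc_0_1, T3_pc_1_0, T3_pc_0_2, T3_pc_1_1,
    T3_pc_2_0, ↓T2_tl2, T2_tl21, T3_tl3, T3_tl32, ← H.push_i]
  rcases deg_three_le_one ha hb hc (by omega) with ⟨rfl, rfl, rfl⟩ | ⟨rfl, rfl, rfl⟩ | ⟨rfl, rfl, rfl⟩ | ⟨rfl, rfl, rfl⟩ <;>
  simp only [Int.reduceAdd, Int.reduceMul, Int.reduceNeg, sg_neg, sg_vals, neg_smul, one_smul,
    sub_eq_add_neg, push_l2 A.leib.eqL1, push_l21 A.w1, push_l32 A.w4, H.push_p, H.push_h,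
    T1_map_add, T1_map_neg, T2_map_add, T2_map_neg] <;>
  abel

theorem ti_m1 : bd (-1) A.D D' i = 0 := H.chaini

theorem ti_m2 : bd 0 A.D D' (ti2 A i h) = fc1 0 i (tl2 A p i) - fc2 0 A.l2 i i := by
  have := (tl2_lin A H).ma
  have := (ti2_lin A H).ma
  refine ext_T2 fun a b u v _ _ ha hb hr => ?_
  simp only [T2, bd_two, tot_sub, tot_add, tot_zsmul]
  simp only [tot_two, T2_fc1, T2_fc2_1_1, T2_pc_0_1, T2_pc_1_0, ↓T2_tl2, T2_ti2, ← H.push_i]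
  rcases deg_two_le_two ha hb (by omega) with ⟨rfl, rfl⟩ | ⟨rfl, rfl⟩ | ⟨rfl, rfl⟩ | ⟨rfl, rfl⟩ |
    ⟨rfl, rfl⟩ | ⟨rfl, rfl⟩ <;>
  simp only [Int.reduceAdd, Int.reduceMul, Int.reduceNeg, sg_neg, sg_vals, neg_smul, one_smul,
    sub_eq_add_neg, push_l2 A.leib.eqL1, H.push_h, T1_map_add, T1_map_neg] <;>
  abel

theorem ti_m3 : bd 1 A.D D' (ti3 A i h) = fc1 1 i (tl3 A p i h) - pc 1 1 0 (ti2 A i h) (tl2 A p i)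
    + pc 1 0 1 (ti2 A i h) (tl2 A p i) + pa (P12 3) (pc 1 1 0 (ti2 A i h) (tl2 A p i)) - fc3 1 A.l3
    i i i - fc2 1 A.l2 i (ti2 A i h) + fc2 1 A.l2 (ti2 A i h) i + pa (P12 3) (fc2 1 A.l2 i (ti2 A i
    h)) := by
  have := (tl2_lin A H).ma
  have := (ti2_lin A H).ma
  have := (tl3_lin A H).ma
  have := (ti3_lin A H).ma
  refine ext_T3 fun a b c u v w _ _ _ ha hb hc hr => ?_
  simp only [T3, bd_three, tot_sub, tot_add, tot_zsmul]
  simp only [tot_three, T3_fc1, T3_fc2_1_2, T3_fc2_2_1, T3_fc3_1_1_1, T3_P12, T3_pc_0_1, T3_pc_1_0,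
    T3_pc_0_2, T3_pc_1_1, T3_pc_2_0, ↓T2_tl2, T2_ti2, T3_tl3, T3_ti3, ← H.push_i]
  rcases deg_three_le_one ha hb hc (by omega) with ⟨rfl, rfl, rfl⟩ | ⟨rfl, rfl, rfl⟩ | ⟨rfl, rfl, rfl⟩ | ⟨rfl, rfl, rfl⟩ <;>
  simp only [Int.reduceAdd, Int.reduceMul, Int.reduceNeg, sg_neg, sg_vals, neg_smul, one_smul,
    sub_eq_add_neg, push_l2 A.leib.eqL1, push_l3 A.leib.eqL2, H.push_h, T1_map_add, T1_map_neg,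
    T2_map_add, T2_map_neg] <;>
  abel

theorem ti_m5 : bd 1 A.D D' (ti21 A i h) = - (ti2 A i h) - pa (P12 2) (ti2 A i h) + fc1 1 i (tl21 A
    p i) - fc2 1 A.l21 i i := by
  have := (tl21_lin A H).ma
  have := (ti2_lin A H).ma
  have := (ti21_lin A H).ma
  refine ext_T2 fun a b u v _ _ ha hb hr => ?_
  simp only [T2, bd_two, tot_sub, tot_add, tot_neg, tot_zsmul]
  simp only [tot_two, T2_fc1, T2_fc2_1_1, T2_P12, T2_pc_0_1, T2_pc_1_0, T2_tl21, T2_ti2, T2_ti21, ←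
    H.push_i]
  rcases deg_two_le_one ha hb (by omega) with ⟨rfl, rfl⟩ | ⟨rfl, rfl⟩ | ⟨rfl, rfl⟩ <;>
  simp only [Int.reduceAdd, Int.reduceMul, Int.reduceNeg, sg_neg, sg_vals, neg_smul, one_smul,
    sub_eq_add_neg, push_l21 A.w1, H.push_h, T1_map_add, T1_map_neg] <;>
  abel

end DLaws

end WL3

namespace WL3

open Finset

section MLaws

set_option linter.unusedSectionVars false

variable {k : Type} [CommRing k] {L L' : ℤ → Type} [∀ i, AddCommGroup (L i)]
  [∀ i, Module k (L i)] [∀ i, AddCommGroup (L' i)] [∀ i, Module k (L' i)]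
  (A : WeakLie3 k L) {D' : MMap L' L' 1 (-1)} {p : MMap L L' 1 0} {i : MMap L' L 1 0}
  {h : MMap L L 1 1} [Bdd L] [Bdd L'] [MA D'] [MA p] [MA i] [MA h]
  (H : IsDefRetract k A.D D' p i h)

theorem D_eq_zero {D : MMap L L 1 (-1)} [ZP D] (i : MMap L' L 1 0) [ZP i] (u : V L') [hu : Deg u 0] :
    T1 D (T1 i u) = 0 :=
  (deg_T1 D (T1 i u)).eq_zero (by decide)

include H

theorem IsDefRetract.ip_top (u : V L) {a : ℤ} [hu : Deg u a] (ha : a = 2) :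
    T1 i (T1 p u) = u + -T1 h (T1 A.D u) := by
  have E := H.push_h u
  rw [(deg_T1 h u).eq_zero (by omega), T1_map_zero, add_right_comm, ← sub_eq_add_neg] at E
  exact (sub_eq_zero.mp E.symm).symm

theorem ti_m6 : fc1 2 i (tl211 A p i) - fc2 2 A.l211 i i = (ti21 A i h) - pa (P12 2) (ti21 A i h)
    := by
  have := (tl211_lin A H).ma
  have := (ti21_lin A H).ma
  refine ext_T2 fun a b u v _ _ ha hb hr => ?_
  obtain ⟨rfl, rfl⟩ : a = 0 ∧ b = 0 := by omega
  have hz := fun u [Deg u 0] => D_eq_zero (D := A.D) i u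
  simp only [T2, tot_sub]
  simp only [tot_two, T2_fc1, T2_fc2_1_1, T2_P12, T2_tl211, ↓T2_ti21]
  simp only [Int.reduceAdd, Int.reduceMul, Int.reduceNeg, sg_vals, one_smul, sub_eq_add_neg,
    H.ip_top A, hz, push_l211 A.w2, T1_map_add, T1_map_neg, T1_map_zero, T2_map_zero]
  abel

theorem ti_m7 : fc1 2 i (tl31 A p i h) - fc3 2 A.l31 i i i = (ti3 A i h) + pa (P12 3) (ti3 A i h) +
    pc 2 0 1 (ti2 A i h) (tl21 A p i) + fc2 2 A.l2 (ti21 A i h) i := by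
  have := (tl31_lin A H).ma
  have := (ti2_lin A H).ma
  have := (ti3_lin A H).ma
  have := (tl21_lin A H).ma
  have := (ti21_lin A H).ma
  refine ext_T3 fun a b c u v w _ _ _ ha hb hc hr => ?_
  obtain ⟨rfl, rfl, rfl⟩ : a = 0 ∧ b = 0 ∧ c = 0 := by omega
  have hz := fun u [Deg u 0] => D_eq_zero (D := A.D) i u
  simp only [T3, tot_sub, tot_add]
  simp only [tot_three, T3_fc1, T3_fc2_2_1, T3_fc3_1_1_1, T3_P12, T3_pc_0_1, T3_tl31, ↓T2_ti2,
    T3_ti3, T2_tl21, ↓T2_ti21]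
  simp only [Int.reduceAdd, Int.reduceMul, Int.reduceNeg, sg_vals, one_smul, sub_eq_add_neg,
    H.ip_top A, hz, push_l2 A.leib.eqL1, push_l21 A.w1, push_l31 A.w3, H.push_h, T1_map_add,
    T1_map_neg, T2_map_add, T2_map_neg, T1_map_zero, T2_map_zero, T3_map_zero]
  abel

theorem ti_m8 : fc1 2 i (tl32 A p i h) - fc3 2 A.l32 i i i = (ti3 A i h) + pa (P23 3) (ti3 A i h) -
    pc 2 1 0 (ti2 A i h) (tl21 A p i) + pc 2 0 1 (ti21 A i h) (tl2 A p i) + pa (P12 3) (pc 2 1 0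
    (ti21 A i h) (tl2 A p i)) - fc2 2 A.l2 i (ti21 A i h) - fc2 2 A.l21 (ti2 A i h) i - pa (P12 3)
    (fc2 2 A.l21 i (ti2 A i h)) := by
  have := (tl2_lin A H).ma
  have := (tl32_lin A H).ma
  have := (ti2_lin A H).ma
  have := (ti3_lin A H).ma
  have := (tl21_lin A H).ma
  have := (ti21_lin A H).ma
  refine ext_T3 fun a b c u v w _ _ _ ha hb hc hr => ?_
  obtain ⟨rfl, rfl, rfl⟩ : a = 0 ∧ b = 0 ∧ c = 0 := by omega
  have hz := fun u [Deg u 0] => D_eq_zero (D := A.D) i u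
  simp only [T3, tot_sub, tot_add]
  simp only [tot_three, T3_fc1, T3_P23, T3_fc2_2_1, T3_fc2_1_2, T3_fc3_1_1_1, T3_P12, T3_pc_0_1,
    T3_pc_1_0, ↓T2_tl2, T3_tl32, ↓T2_ti2, T3_ti3, T2_tl21, ↓T2_ti21]
  simp only [Int.reduceAdd, Int.reduceMul, Int.reduceNeg, sg_vals, neg_smul, one_smul,
    sub_eq_add_neg, H.ip_top A, hz, push_l2 A.leib.eqL1, push_l21 A.w1, push_l32 A.w4, H.push_h,
    T1_map_add, T1_map_neg, T2_map_add, T2_map_neg, T1_map_zero, T2_map_zero, T3_map_zero]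
  abel

set_option synthInstance.maxHeartbeats 200000 in
set_option synthInstance.maxSize 1000 in
set_option maxHeartbeats 2000000 in
theorem ti_m4 : fc1 2 i (tl4 A p i h) - fc4 2 A.l4 i i i i = pc 2 0 1 (ti2 A i h) (tl3 A p i h) +
    pc 2 1 0 (ti2 A i h) (tl3 A p i h) - pa (P12 4) (pc 2 1 0 (ti2 A i h) (tl3 A p i h)) + pa (P123
    4) (pc 2 1 0 (ti2 A i h) (tl3 A p i h)) - pc 2 0 2 (ti3 A i h) (tl2 A p i) + pc 2 1 1 (ti3 A i
    h) (tl2 A p i) - pa (P12 4) (pc 2 1 1 (ti3 A i h) (tl2 A p i)) - pc 2 2 0 (ti3 A i h) (tl2 A p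
    i) + pa (P23 4) (pc 2 2 0 (ti3 A i h) (tl2 A p i)) - pa (P132 4) (pc 2 2 0 (ti3 A i h) (tl2 A p
    i)) + fc2 2 A.l2 (ti3 A i h) i + fc2 2 A.l2 i (ti3 A i h) - pa (P12 4) (fc2 2 A.l2 i (ti3 A i
    h)) + pa (P123 4) (fc2 2 A.l2 i (ti3 A i h)) - fc2 2 A.l2 (ti2 A i h) (ti2 A i h) + pa (P23 4)
    (fc2 2 A.l2 (ti2 A i h) (ti2 A i h)) - pa (P132 4) (fc2 2 A.l2 (ti2 A i h) (ti2 A i h)) + fc3 2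
    A.l3 (ti2 A i h) i i - fc3 2 A.l3 i (ti2 A i h) i + pa (P12 4) (fc3 2 A.l3 i (ti2 A i h) i) +
    fc3 2 A.l3 i i (ti2 A i h) - pa (P23 4) (fc3 2 A.l3 i i (ti2 A i h)) + pa (P132 4) (fc3 2 A.l3
    i i (ti2 A i h)) := by
  have := (tl2_lin A H).ma
  have := (tl4_lin A H).ma
  have := (ti2_lin A H).ma
  have := (tl3_lin A H).ma
  have := (ti3_lin A H).ma
  refine ext_T4 fun a b c e u v w x _ _ _ _ ha hb hc he hr => ?_
  obtain ⟨rfl, rfl, rfl, rfl⟩ : a = 0 ∧ b = 0 ∧ c = 0 ∧ e = 0 := by omega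
  have hz := fun u [Deg u 0] => D_eq_zero (D := A.D) i u
  simp only [T4, tot_sub, tot_add]
  simp only [tot_four, T4_fc1, T4_fc2_1_3, T4_fc2_3_1, T4_fc2_2_2, T4_fc3_2_1_1, T4_fc3_1_2_1,
    T4_fc3_1_1_2, T4_fc4_1_1_1_1, T4_P12, T4_P123, T4_P132, T4_P23, T4_pc_0_1, T4_pc_0_2, T4_pc_1_0,
    T4_pc_1_1, T4_pc_2_0, ↓T2_tl2, T4_tl4, ↓T2_ti2, T3_tl3, T3_ti3]
  simp only [Int.reduceAdd, Int.reduceMul, Int.reduceNeg, sg_vals, neg_smul, one_smul,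
    sub_eq_add_neg, H.ip_top A, hz, push_l2 A.leib.eqL1, push_l3 A.leib.eqL2, push_l4 A.leib.eqL3,
    H.push_h, T1_map_add, T1_map_neg, T2_map_add, T2_map_neg, T1_map_zero, T2_map_zero, T3_map_add,
    T3_map_neg, T3_map_zero, T4_map_zero]
  abel

end MLaws

end WL3

namespace WL3

open Finset

section Lift

set_option linter.unusedSectionVars false

variable {L M : ℤ → Type} [∀ i, AddCommGroup (L i)] [∀ i, AddCommGroup (M i)] [Bdd L] [Bdd M]

section Zero

variable {r : ℤ}

theorem T1_top (μ : MMap L M 1 r) [ZP μ] (u : V L) {a : ℤ} [Deg u a]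
    (h : r + a < 0 ∨ 2 < r + a) : T1 μ u = 0 :=
  (deg_T1 μ u).eq_zero h

theorem T2_top (μ : MMap L M 2 r) [ZP μ] (u v : V L) {a b : ℤ} [Deg u a] [Deg v b]
    (h : 2 < r + (a + b)) : T2 μ u v = 0 :=
  (deg_T2 μ u v).eq_zero (.inr h)

theorem T3_top (μ : MMap L M 3 r) [ZP μ] (u v w : V L) {a b c : ℤ} [Deg u a] [Deg v b] [Deg w c]
    (h : 2 < r + (a + b + c)) : T3 μ u v w = 0 :=
  (deg_T3 μ u v w).eq_zero (.inr h)

theorem T4_top (μ : MMap L M 4 r) [ZP μ] (u v w x : V L) {a b c e : ℤ} [Deg u a] [Deg v b]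
    [Deg w c] [Deg x e] (h : 2 < r + (a + b + c + e)) : T4 μ u v w x = 0 :=
  (deg_T4 μ u v w x).eq_zero (.inr h)

end Zero

section Top

variable {D : MMap L L 1 (-1)} {l2 : MMap L L 2 0} {l3 : MMap L L 3 1}
  {l21 : MMap L L 2 1} [MA D] [ZP l2] [ZP l3] [ZP l21]

theorem l2_top (he : bd (-1) D D l2 = 0) (u v : V L) {a b : ℤ} [Deg u a] [Deg v b]
    (ha : a = 2) (hb : b = 1) : T2 l2 (T1 D u) v = -T2 l2 u (T1 D v) := by
  subst ha hb
  have E := push_l2 he u v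
  rw [T2_top l2 u v (by decide), T1_map_zero, sg_vals.2.2.2.2.1, one_smul] at E
  exact eq_neg_of_add_eq_zero_left E.symm

theorem l2_top_second (he : bd (-1) D D l2 = 0) (u v : V L) {a b : ℤ} [Deg u a] [Deg v b]
    (ha : a = 1) (hb : b = 2) : T2 l2 u (T1 D v) = T2 l2 (T1 D u) v := by
  subst ha hb
  have E := push_l2 he u v
  rw [T2_top l2 u v (by decide), T1_map_zero, sg_vals.2.2.2.1, neg_one_smul] at E
  exact (eq_of_sub_eq_zero ((sub_eq_add_neg _ _).trans E.symm)).symm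

theorem l21_top (he : bd 0 D D l21 = l2 + pa (P12 2) l2) (u v : V L) {a b : ℤ} [Deg u a] [Deg v b]
    (h : a + b = 2) : T2 l21 (T1 D u) v = -sg a • T2 l21 u (T1 D v) + T2 l2 u v + sg (a * b) • T2
    l2 v u := by
  have E := push_l21 he u v
  rw [T2_top l21 u v (by omega), T1_map_zero] at E
  linear_combination (norm := module) E

theorem l21_top_second (he : bd 0 D D l21 = l2 + pa (P12 2) l2) (u v : V L) {a b : ℤ} [Deg u a]
    [Deg v b] (h : a + b = 2) (ha : a = 0) : T2 l21 u (T1 D v) = -T2 l21 (T1 D u) v + T2 l2 u v +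
    sg (a * b) • T2 l2 v u := by
  subst ha
  have E := push_l21 he u v
  rw [T2_top l21 u v (by omega), T1_map_zero] at E
  simp only [sg_zero, one_smul] at E ⊢
  linear_combination (norm := module) E

theorem l3_top (he : bd 0 D D l3 = pc 0 1 0 l2 l2 - pc 0 0 1 l2 l2 - pa (P12 3) (pc 0 1 0 l2 l2))
    (u v w : V L) {a b c : ℤ} [Deg u a] [Deg v b] [Deg w c] (h : a + b + c = 2) : T3 l3 (T1 D u) v
    w = -sg a • T3 l3 u (T1 D v) w - sg (a + b) • T3 l3 u v (T1 D w) + T2 l2 u (T2 l2 v w) - T2 l2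
    (T2 l2 u v) w - sg (a * b) • T2 l2 v (T2 l2 u w) := by
  have E := push_l3 he u v w
  rw [T3_top l3 u v w (by omega), T1_map_zero] at E
  linear_combination (norm := module) E

theorem l3_top_second (he : bd 0 D D l3 = pc 0 1 0 l2 l2 - pc 0 0 1 l2 l2 - pa (P12 3) (pc 0 1 0
    l2 l2)) (u v w : V L) {a b c : ℤ} [Deg u a] [Deg v b] [Deg w c] (h : a + b + c = 2) (ha : a =
    0) : T3 l3 u (T1 D v) w = -T3 l3 (T1 D u) v w - sg (a + b) • T3 l3 u v (T1 D w) + T2 l2 u (T2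
    l2 v w) - T2 l2 (T2 l2 u v) w - sg (a * b) • T2 l2 v (T2 l2 u w) := by
  subst ha
  have E := push_l3 he u v w
  rw [T3_top l3 u v w (by omega), T1_map_zero] at E
  simp only [zero_add, sg_zero, one_smul] at E ⊢
  linear_combination (norm := module) E

theorem l3_top_third (he : bd 0 D D l3 = pc 0 1 0 l2 l2 - pc 0 0 1 l2 l2 - pa (P12 3) (pc 0 1 0 l2
    l2)) (u v w : V L) {a b c : ℤ} [Deg u a] [Deg v b] [Deg w c] (h : a + b + c = 2) (ha : a = 0)
    (hb : b = 0) : T3 l3 u v (T1 D w) = -T3 l3 (T1 D u) v w - sg a • T3 l3 u (T1 D v) w + T2 l2 u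
    (T2 l2 v w) - T2 l2 (T2 l2 u v) w - sg (a * b) • T2 l2 v (T2 l2 u w) := by
  subst ha hb
  have E := push_l3 he u v w
  rw [T3_top l3 u v w (by omega), T1_map_zero] at E
  simp only [add_zero, sg_zero, one_smul] at E ⊢
  linear_combination (norm := module) E

end Top

variable {D' : MMap L L 1 (-1)} {D : MMap M M 1 (-1)} {i : MMap L M 1 0}
  {m2 : MMap L L 2 0} {m3 : MMap L L 3 1} {m4 : MMap L L 4 2} {m21 : MMap L L 2 1}
  {m211 : MMap L L 2 2} {m31 m32 : MMap L L 3 2}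
  {l2 : MMap M M 2 0} {l3 : MMap M M 3 1} {l4 : MMap M M 4 2} {l21 : MMap M M 2 1}
  {l211 : MMap M M 2 2} {l31 l32 : MMap M M 3 2}
  {f2 : MMap L M 2 1} {f21 : MMap L M 2 2} {f3 : MMap L M 3 2}
  [MA D'] [MA D] [MA i] [ZP m2] [ZP m3] [ZP m4] [ZP m21] [ZP m211] [ZP m31] [ZP m32]
  [ZP l2] [ZP l3] [ZP l4] [ZP l21] [ZP l211] [ZP l31] [ZP l32] [ZP f2] [ZP f21] [ZP f3]

theorem lift_m2 (he : bd 0 D D' f2 = fc1 0 i m2 - fc2 0 l2 i i) (u v : V L) {a b : ℤ} [Deg u a]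
    [Deg v b] : T1 i (T2 m2 u v) = T1 D (T2 f2 u v) + T2 f2 (T1 D' u) v + sg a • T2 f2 u (T1 D' v)
    + T2 l2 (T1 i u) (T1 i v) := by
  have E := congrArg (tot · ![u, v]) he
  simp only [bd_two, tot_sub, tot_add, tot_zsmul] at E
  simp only [tot_two, T2_fc1, T2_fc2_1_1, T2_pc_0_1, T2_pc_1_0, sg_vals, sg_neg, one_smul,
    neg_one_mul, zero_mul] at E
  linear_combination (norm := module) -E

theorem lift_m3 (he : bd 1 D D' f3 = fc1 1 i m3 - pc 1 1 0 f2 m2 + pc 1 0 1 f2 m2 + pa (P12 3) (pc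
    1 1 0 f2 m2) - fc3 1 l3 i i i - fc2 1 l2 i f2 + fc2 1 l2 f2 i + pa (P12 3) (fc2 1 l2 i f2)) (u
    v w : V L) {a b c : ℤ} [Deg u a] [Deg v b] [Deg w c] : T1 i (T3 m3 u v w) = T1 D (T3 f3 u v w)
    - T3 f3 (T1 D' u) v w - sg a • T3 f3 u (T1 D' v) w - sg (a + b) • T3 f3 u v (T1 D' w) + T2 f2
    u (T2 m2 v w) - T2 f2 (T2 m2 u v) w - sg (a * b) • T2 f2 v (T2 m2 u w) + T3 l3 (T1 i u) (T1 i
    v) (T1 i w) + sg a • T2 l2 (T1 i u) (T2 f2 v w) - T2 l2 (T2 f2 u v) (T1 i w) - sg (a * b + b)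
    • T2 l2 (T1 i v) (T2 f2 u w) := by
  have E := congrArg (tot · ![u, v, w]) he
  simp only [bd_three, tot_sub, tot_add, tot_zsmul] at E
  simp only [tot_three, T3_P12, T3_fc1, T3_fc2_1_2, T3_fc2_2_1, T3_fc3_1_1_1, T3_pc_0_1, T3_pc_0_2,
    T3_pc_1_0, T3_pc_1_1, T3_pc_2_0, sg_vals, sg_neg, sg_add, one_mul, one_smul, neg_one_mul,
    zero_mul] at E
  simp only [sg_add]
  linear_combination (norm := module) -E

theorem lift_m4 (he : fc1 2 i m4 - fc4 2 l4 i i i i = pc 2 0 1 f2 m3 + pc 2 1 0 f2 m3 - pa (P12 4)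
    (pc 2 1 0 f2 m3) + pa (P123 4) (pc 2 1 0 f2 m3) - pc 2 0 2 f3 m2 + pc 2 1 1 f3 m2 - pa (P12 4)
    (pc 2 1 1 f3 m2) - pc 2 2 0 f3 m2 + pa (P23 4) (pc 2 2 0 f3 m2) - pa (P132 4) (pc 2 2 0 f3 m2)
    + fc2 2 l2 f3 i + fc2 2 l2 i f3 - pa (P12 4) (fc2 2 l2 i f3) + pa (P123 4) (fc2 2 l2 i f3) -
    fc2 2 l2 f2 f2 + pa (P23 4) (fc2 2 l2 f2 f2) - pa (P132 4) (fc2 2 l2 f2 f2) + fc3 2 l3 f2 i i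
    - fc3 2 l3 i f2 i + pa (P12 4) (fc3 2 l3 i f2 i) + fc3 2 l3 i i f2 - pa (P23 4) (fc3 2 l3 i i
    f2) + pa (P132 4) (fc3 2 l3 i i f2)) (u v w x : V L) {a b c e : ℤ} [Deg u a] [Deg v b] [Deg w
    c] [Deg x e] : T1 i (T4 m4 u v w x) = T4 l4 (T1 i u) (T1 i v) (T1 i w) (T1 i x) + T2 f2 (T3 m3
    u v w) x + sg a • T2 f2 u (T3 m3 v w x) - sg (a * b + b) • T2 f2 v (T3 m3 u w x) + sg (a * c +
    b * c + c) • T2 f2 w (T3 m3 u v x) - T3 f3 (T2 m2 u v) w x + T3 f3 u (T2 m2 v w) x - sg (a *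
    b) • T3 f3 v (T2 m2 u w) x - T3 f3 u v (T2 m2 w x) + sg (b * c) • T3 f3 u w (T2 m2 v x) - sg
    (a * b + a * c) • T3 f3 v w (T2 m2 u x) + T2 l2 (T3 f3 u v w) (T1 i x) + T2 l2 (T1 i u) (T3 f3
    v w x) - sg (a * b) • T2 l2 (T1 i v) (T3 f3 u w x) + sg (a * c + b * c) • T2 l2 (T1 i w) (T3
    f3 u v x) - sg (a + b) • T2 l2 (T2 f2 u v) (T2 f2 w x) + sg (b * c + a + c) • T2 l2 (T2 f2 u
    w) (T2 f2 v x) - sg (a * b + a * c + b + c) • T2 l2 (T2 f2 v w) (T2 f2 u x) + T3 l3 (T2 f2 u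
    v) (T1 i w) (T1 i x) - sg a • T3 l3 (T1 i u) (T2 f2 v w) (T1 i x) + sg (a * b + b) • T3 l3 (T1
    i v) (T2 f2 u w) (T1 i x) + sg (a + b) • T3 l3 (T1 i u) (T1 i v) (T2 f2 w x) - sg (b * c + a +
    c) • T3 l3 (T1 i u) (T1 i w) (T2 f2 v x) + sg (a * b + a * c + b + c) • T3 l3 (T1 i v) (T1 i
    w) (T2 f2 u x) := by
  have E := congrArg (tot · ![u, v, w, x]) he
  simp only [tot_sub, tot_add] at E
  simp only [tot_four, T4_P12, T4_P123, T4_P132, T4_P23, T4_fc1, T4_fc2_1_3, T4_fc2_2_2, T4_fc2_3_1,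
    T4_fc3_1_1_2, T4_fc3_1_2_1, T4_fc3_2_1_1, T4_fc4_1_1_1_1, T4_pc_0_1, T4_pc_0_2, T4_pc_1_0,
    T4_pc_1_1, T4_pc_2_0, sg_vals, sg_add, sg_two_mul, one_mul, one_smul, zero_mul] at E
  simp only [sg_add]
  linear_combination (norm := module) E

theorem lift_m21 (he : bd 1 D D' f21 = - f2 - pa (P12 2) f2 + fc1 1 i m21 - fc2 1 l21 i i) (u v :
    V L) {a b : ℤ} [Deg u a] [Deg v b] : T1 i (T2 m21 u v) = T1 D (T2 f21 u v) - T2 f21 (T1 D' u)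
    v - sg a • T2 f21 u (T1 D' v) + T2 f2 u v + sg (a * b) • T2 f2 v u + T2 l21 (T1 i u) (T1 i v)
    := by
  have E := congrArg (tot · ![u, v]) he
  simp only [bd_two, tot_sub, tot_add, tot_neg, tot_zsmul] at E
  simp only [tot_two, T2_P12, T2_fc1, T2_fc2_1_1, T2_pc_0_1, T2_pc_1_0, sg_vals, sg_neg, one_smul,
    neg_one_mul, zero_mul] at E
  linear_combination (norm := module) -E

theorem lift_m211 (he : fc1 2 i m211 - fc2 2 l211 i i = f21 - pa (P12 2) f21) (u v : V L) {a b :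
    ℤ} [Deg u a] [Deg v b] : T1 i (T2 m211 u v) = T2 l211 (T1 i u) (T1 i v) + T2 f21 u v - sg (a *
    b) • T2 f21 v u := by
  have E := congrArg (tot · ![u, v]) he
  simp only [tot_sub] at E
  simp only [tot_two, T2_P12, T2_fc1, T2_fc2_1_1, sg_vals, one_smul, zero_mul] at E
  linear_combination (norm := module) E

theorem lift_m31 (he : fc1 2 i m31 - fc3 2 l31 i i i = f3 + pa (P12 3) f3 + pc 2 0 1 f2 m21 + fc2
    2 l2 f21 i) (u v w : V L) {a b c : ℤ} [Deg u a] [Deg v b] [Deg w c] : T1 i (T3 m31 u v w) = T3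
    l31 (T1 i u) (T1 i v) (T1 i w) + T3 f3 u v w + sg (a * b) • T3 f3 v u w + T2 f2 (T2 m21 u v) w
    + T2 l2 (T2 f21 u v) (T1 i w) := by
  have E := congrArg (tot · ![u, v, w]) he
  simp only [tot_sub, tot_add] at E
  simp only [tot_three, T3_P12, T3_fc1, T3_fc2_2_1, T3_fc3_1_1_1, T3_pc_0_1, sg_vals, sg_add,
    one_mul, one_smul, zero_mul] at E
  linear_combination (norm := module) E

theorem lift_m32 (he : fc1 2 i m32 - fc3 2 l32 i i i = f3 + pa (P23 3) f3 - pc 2 1 0 f2 m21 + pc 2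
    0 1 f21 m2 + pa (P12 3) (pc 2 1 0 f21 m2) - fc2 2 l2 i f21 - fc2 2 l21 f2 i - pa (P12 3) (fc2
    2 l21 i f2)) (u v w : V L) {a b c : ℤ} [Deg u a] [Deg v b] [Deg w c] : T1 i (T3 m32 u v w) =
    T3 l32 (T1 i u) (T1 i v) (T1 i w) + T3 f3 u v w + sg (b * c) • T3 f3 u w v - sg a • T2 f2 u
    (T2 m21 v w) + T2 f21 (T2 m2 u v) w + sg (a * b) • T2 f21 v (T2 m2 u w) - T2 l2 (T1 i u) (T2
    f21 v w) - T2 l21 (T2 f2 u v) (T1 i w) - sg (a * b + b) • T2 l21 (T1 i v) (T2 f2 u w) := by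
  have E := congrArg (tot · ![u, v, w]) he
  simp only [tot_sub, tot_add] at E
  simp only [tot_three, T3_P12, T3_P23, T3_fc1, T3_fc2_1_2, T3_fc2_2_1, T3_fc3_1_1_1, T3_pc_0_1,
    T3_pc_1_0, sg_vals, sg_add, sg_two_mul, one_mul, one_smul, zero_mul] at E
  simp only [sg_add]
  linear_combination (norm := module) E

end Lift

end WL3

namespace WL3

open Finset

section WLaws

set_option linter.unusedSectionVars false

variable {k : Type} [CommRing k] {L L' : ℤ → Type} [∀ i, AddCommGroup (L i)]
  [∀ i, Module k (L i)] [∀ i, AddCommGroup (L' i)] [∀ i, Module k (L' i)]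
  (A : WeakLie3 k L) {D' : MMap L' L' 1 (-1)} {p : MMap L L' 1 0} {i : MMap L' L 1 0}
  {h : MMap L L 1 1} [Bdd L] [Bdd L'] [MA D'] [MA p] [MA i] [MA h]
  (H : IsDefRetract k A.D D' p i h)

include H

theorem IsDefRetract.inj_i {u v : V L'} {a b : ℤ} [Deg u a] [Deg v b] (e : T1 i u = T1 i v) :
    u = v := by
  rw [← H.pi u, e, H.pi]

theorem tl_w5 : (tl211 A p i) + pa (P12 2) (tl211 A p i) = 0 := by
  have := (tl211_lin A H).ma
  have := (ti21_lin A H).ma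
  refine ext_T2 fun a b u v _ _ ha hb hr => ?_
  obtain ⟨rfl, rfl⟩ : a = 0 ∧ b = 0 := by omega
  refine H.inj_i A ?_
  have E := congrArg (tot · ![T1 i u, T1 i v]) A.w5
  simp only [T2, tot_add, tot_zero] at E ⊢
  simp only [tot_two, T2_P12] at E ⊢
  simp only [Int.reduceAdd, Int.reduceMul, sg_vals, one_smul, sub_eq_add_neg, lift_m211 (ti_m6 A H),
    T1_map_add, T1_map_zero] at E ⊢
  linear_combination (norm := abel) E

theorem tl_w6 : (tl31 A p i h) - pa (P12 3) (tl31 A p i h) = pc 2 0 1 (tl2 A p i) (tl211 A p i) :=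
      by
  have := (tl2_lin A H).ma
  have := (tl21_lin A H).ma
  have := (tl211_lin A H).ma
  have := (tl31_lin A H).ma
  have := (ti2_lin A H).ma
  have := (ti3_lin A H).ma
  have := (ti21_lin A H).ma
  refine ext_T3 fun a b c u v w _ _ _ ha hb hc hr => ?_
  obtain ⟨rfl, rfl, rfl⟩ : a = 0 ∧ b = 0 ∧ c = 0 := by omega
  refine H.inj_i A ?_
  have E := congrArg (tot · ![T1 i u, T1 i v, T1 i w]) A.w6
  simp only [T3, tot_sub] at E ⊢
  simp only [tot_three, T3_P12, T3_pc_0_1] at E ⊢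
  simp only [Int.reduceAdd, Int.reduceMul, Int.reduceNeg, Int.reduceLT, or_false, sg_vals, one_smul,
    sub_eq_add_neg, lift_m2 (ti_m2 A H), lift_m31 (ti_m7 A H), lift_m211 (ti_m6 A H), push_l211
    (tl_w2 A H), T1_map_add, T1_map_neg, T1_map_zero, T1_top, T2_map_add, T2_map_neg, T2_map_zero,
    T2_top] at E ⊢
  linear_combination (norm := abel) E

theorem tl_w7 : (tl31 A p i h) - pa (P12 3) (tl32 A p i h) + pa (P132 3) (tl31 A p i h) - (tl32 A
      p i h) + pa (P23 3) (tl31 A p i h) - pa (P123 3) (tl32 A p i h) = pc 2 1 0 (tl21 A p i)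
      (tl21 A p i) + pc 2 0 1 (tl21 A p i) (tl21 A p i) + pa (P12 3) (pc 2 1 0 (tl21 A p i) (tl21
      A p i)) + pa (P132 3) (pc 2 1 0 (tl211 A p i) (tl2 A p i)) := by
  have := (tl2_lin A H).ma
  have := (tl3_lin A H).ma
  have := (tl21_lin A H).ma
  have := (tl211_lin A H).ma
  have := (tl31_lin A H).ma
  have := (tl32_lin A H).ma
  have := (ti2_lin A H).ma
  have := (ti3_lin A H).ma
  have := (ti21_lin A H).ma
  refine ext_T3 fun a b c u v w _ _ _ ha hb hc hr => ?_
  obtain ⟨rfl, rfl, rfl⟩ : a = 0 ∧ b = 0 ∧ c = 0 := by omega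
  refine H.inj_i A ?_
  have E := congrArg (tot · ![T1 i u, T1 i v, T1 i w]) A.w7
  simp only [T3, tot_sub, tot_add] at E ⊢
  simp only [tot_three, T3_P12, T3_P123, T3_P132, T3_P23, T3_pc_0_1, T3_pc_1_0] at E ⊢
  have r := push_l211 A.w2 (T1 i v) (T2 (ti2 A i h) w u)
  simp only [Int.reduceAdd, Int.reduceMul, Int.reduceNeg, Int.reduceLT, or_false, sg_vals, neg_smul,
    one_smul, neg_neg, sub_eq_add_neg, lift_m2 (ti_m2 A H), lift_m31 (ti_m7 A H), lift_m32 (ti_m8 A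
    H), lift_m211 (ti_m6 A H), lift_m21 (ti_m5 A H), push_l21 (tl_w1 A H), l21_top A.w1,
    l21_top_second A.w1, H.push_i, T1_map_add, T1_map_neg, T1_map_zero, T1_top, T2_map_add,
    T2_map_neg, T2_map_zero, T2_top] at E r ⊢
  linear_combination (norm := abel) E + r

theorem tl_w8 : (tl32 A p i h) - pa (P23 3) (tl32 A p i h) = - pc 2 1 0 (tl2 A p i) (tl211 A p i)
      + pc 2 0 1 (tl211 A p i) (tl2 A p i) + pa (P12 3) (pc 2 1 0 (tl211 A p i) (tl2 A p i)) := by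
  have := (tl2_lin A H).ma
  have := (tl3_lin A H).ma
  have := (tl21_lin A H).ma
  have := (tl211_lin A H).ma
  have := (tl31_lin A H).ma
  have := (tl32_lin A H).ma
  have := (ti2_lin A H).ma
  have := (ti3_lin A H).ma
  have := (ti21_lin A H).ma
  refine ext_T3 fun a b c u v w _ _ _ ha hb hc hr => ?_
  obtain ⟨rfl, rfl, rfl⟩ : a = 0 ∧ b = 0 ∧ c = 0 := by omega
  refine H.inj_i A ?_
  have E := congrArg (tot · ![T1 i u, T1 i v, T1 i w]) A.w8
  simp only [T3, tot_sub, tot_add, tot_neg] at E ⊢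
  simp only [tot_three, T3_P12, T3_P23, T3_pc_0_1, T3_pc_1_0] at E ⊢
  have r0 := push_l211 A.w2 (T2 (ti2 A i h) u v) (T1 i w)
  have r1 := push_l211 A.w2 (T1 i v) (T2 (ti2 A i h) u w)
  simp only [Int.reduceAdd, Int.reduceMul, Int.reduceNeg, Int.reduceLT, or_false, sg_vals, neg_smul,
    one_smul, sub_eq_add_neg, lift_m2 (ti_m2 A H), lift_m32 (ti_m8 A H), lift_m211 (ti_m6 A H),
    push_l211 (tl_w2 A H), H.push_i, T1_map_add, T1_map_neg, T1_map_zero, T1_top, T2_map_add,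
    T2_map_neg, T2_map_zero, T2_top] at E r0 r1 ⊢
  linear_combination (norm := abel) E + r0 + r1

set_option maxHeartbeats 2000000 in
set_option synthInstance.maxHeartbeats 200000 in
set_option synthInstance.maxSize 1000 in
theorem tl_w9 : (tl4 A p i h) + pa (P12 4) (tl4 A p i h) = pc 2 0 1 (tl2 A p i) (tl31 A p i h) -
      pc 2 2 0 (tl31 A p i h) (tl2 A p i) + pa (P123 4) (pc 2 1 0 (tl2 A p i) (tl31 A p i h)) + pc
      2 0 2 (tl3 A p i h) (tl21 A p i) := by
  have := (tl2_lin A H).ma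
  have := (tl3_lin A H).ma
  have := (tl4_lin A H).ma
  have := (tl21_lin A H).ma
  have := (tl31_lin A H).ma
  have := (tl32_lin A H).ma
  have := (ti2_lin A H).ma
  have := (ti3_lin A H).ma
  have := (ti21_lin A H).ma
  refine ext_T4 fun a b c e u v w x _ _ _ _ ha hb hc he hr => ?_
  obtain ⟨rfl, rfl, rfl, rfl⟩ : a = 0 ∧ b = 0 ∧ c = 0 ∧ e = 0 := by omega
  refine H.inj_i A ?_
  have E := congrArg (tot · ![T1 i u, T1 i v, T1 i w, T1 i x]) A.w9
  simp only [T4, tot_sub, tot_add] at E ⊢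
  simp only [tot_four, T4_P12, T4_P123, T4_pc_0_1, T4_pc_0_2, T4_pc_1_0, T4_pc_2_0] at E ⊢
  have r := push_l31 A.w3 (T1 i u) (T1 i v) (T2 (ti2 A i h) w x)
  simp only [Int.reduceAdd, Int.reduceMul, Int.reduceNeg, Int.reduceLT, or_false, sg_vals, neg_smul,
    one_smul, neg_neg, sub_eq_add_neg, lift_m2 (ti_m2 A H), lift_m3 (ti_m3 A H), lift_m4 (ti_m4 A
    H), lift_m31 (ti_m7 A H), lift_m21 (ti_m5 A H), push_l21 (tl_w1 A H), push_l31 (tl_w3 A H),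
    l2_top A.leib.eqL1, l3_top A.leib.eqL2, H.push_i, T1_map_add, T1_map_neg, T1_map_zero, T1_top,
    T2_map_add, T2_map_neg, T2_map_zero, T2_top, T3_map_add, T3_map_neg, T3_map_zero,
    T3_top] at E r ⊢
  linear_combination (norm := abel) E - r

set_option maxHeartbeats 2000000 in
set_option synthInstance.maxHeartbeats 200000 in
set_option synthInstance.maxSize 1000 in
theorem tl_w10 : (tl4 A p i h) + pa (P23 4) (tl4 A p i h) = pc 2 0 1 (tl2 A p i) (tl32 A p i h) -
      pc 2 1 1 (tl3 A p i h) (tl21 A p i) + pc 2 1 0 (tl2 A p i) (tl31 A p i h) - pc 2 0 2 (tl31 A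
      p i h) (tl2 A p i) - pa (P12 4) (pc 2 1 1 (tl31 A p i h) (tl2 A p i)) - pa (P132 4) (pc 2 2
      0 (tl31 A p i h) (tl2 A p i)) := by
  have := (tl2_lin A H).ma
  have := (tl3_lin A H).ma
  have := (tl4_lin A H).ma
  have := (tl21_lin A H).ma
  have := (tl31_lin A H).ma
  have := (tl32_lin A H).ma
  have := (ti2_lin A H).ma
  have := (ti3_lin A H).ma
  have := (ti21_lin A H).ma
  refine ext_T4 fun a b c e u v w x _ _ _ _ ha hb hc he hr => ?_
  obtain ⟨rfl, rfl, rfl, rfl⟩ : a = 0 ∧ b = 0 ∧ c = 0 ∧ e = 0 := by omega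
  refine H.inj_i A ?_
  have E := congrArg (tot · ![T1 i u, T1 i v, T1 i w, T1 i x]) A.w10
  simp only [T4, tot_sub, tot_add] at E ⊢
  simp only [tot_four, T4_P12, T4_P132, T4_P23, T4_pc_0_1, T4_pc_0_2, T4_pc_1_0, T4_pc_1_1,
    T4_pc_2_0] at E ⊢
  have r0 := push_l31 A.w3 (T2 (ti2 A i h) u v) (T1 i w) (T1 i x)
  have r1 := push_l31 A.w3 (T1 i v) (T2 (ti2 A i h) u w) (T1 i x)
  have r2 := push_l31 A.w3 (T1 i v) (T1 i w) (T2 (ti2 A i h) u x)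
  simp only [Int.reduceAdd, Int.reduceMul, Int.reduceNeg, Int.reduceLT, or_false, sg_vals, neg_smul,
    one_smul, neg_neg, sub_eq_add_neg, lift_m2 (ti_m2 A H), lift_m3 (ti_m3 A H), lift_m4 (ti_m4 A
    H), lift_m31 (ti_m7 A H), lift_m32 (ti_m8 A H), lift_m21 (ti_m5 A H), push_l21 (tl_w1 A H),
    push_l31 (tl_w3 A H), push_l32 (tl_w4 A H), l2_top A.leib.eqL1, l3_top_second A.leib.eqL2,
    H.push_i, T1_map_add, T1_map_neg, T1_map_zero, T1_top, T2_map_add, T2_map_neg, T2_map_zero,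
    T2_top, T3_map_add, T3_map_neg, T3_map_zero, T3_top] at E r0 r1 r2 ⊢
  linear_combination (norm := abel) E - r0 - r1 - r2

set_option maxHeartbeats 2000000 in
set_option synthInstance.maxHeartbeats 200000 in
set_option synthInstance.maxSize 1000 in
theorem tl_w11 : (tl4 A p i h) + pa (P34 4) (tl4 A p i h) = pc 2 0 1 (tl21 A p i) (tl3 A p i h) -
      pc 2 0 2 (tl32 A p i h) (tl2 A p i) + pc 2 1 1 (tl32 A p i h) (tl2 A p i) - pa (P12 4) (pc 2
      1 1 (tl32 A p i h) (tl2 A p i)) + pc 2 2 0 (tl3 A p i h) (tl21 A p i) + pa (P23 4) (pc 2 2 0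
      (tl32 A p i h) (tl2 A p i)) - pa (P132 4) (pc 2 2 0 (tl32 A p i h) (tl2 A p i)) + pc 2 1 0
      (tl2 A p i) (tl32 A p i h) - pa (P12 4) (pc 2 1 0 (tl2 A p i) (tl32 A p i h)) + pa (P123 4)
      (pc 2 1 0 (tl21 A p i) (tl3 A p i h)) := by
  have := (tl2_lin A H).ma
  have := (tl3_lin A H).ma
  have := (tl4_lin A H).ma
  have := (tl21_lin A H).ma
  have := (tl31_lin A H).ma
  have := (tl32_lin A H).ma
  have := (ti2_lin A H).ma
  have := (ti3_lin A H).ma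
  have := (ti21_lin A H).ma
  refine ext_T4 fun a b c e u v w x _ _ _ _ ha hb hc he hr => ?_
  obtain ⟨rfl, rfl, rfl, rfl⟩ : a = 0 ∧ b = 0 ∧ c = 0 ∧ e = 0 := by omega
  refine H.inj_i A ?_
  have E := congrArg (tot · ![T1 i u, T1 i v, T1 i w, T1 i x]) A.w11
  simp only [T4, tot_sub, tot_add] at E ⊢
  simp only [tot_four, T4_P12, T4_P123, T4_P132, T4_P23, T4_P34, T4_pc_0_1, T4_pc_0_2, T4_pc_1_0,
    T4_pc_1_1, T4_pc_2_0] at E ⊢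
  have r0 := push_l32 A.w4 (T2 (ti2 A i h) u v) (T1 i w) (T1 i x)
  have r1 := push_l32 A.w4 (T1 i u) (T2 (ti2 A i h) v w) (T1 i x)
  have r2 := push_l32 A.w4 (T1 i v) (T2 (ti2 A i h) u w) (T1 i x)
  have r3 := push_l32 A.w4 (T1 i u) (T1 i w) (T2 (ti2 A i h) v x)
  have r4 := push_l32 A.w4 (T1 i v) (T1 i w) (T2 (ti2 A i h) u x)
  simp only [Int.reduceAdd, Int.reduceMul, Int.reduceNeg, Int.reduceLT, or_false, sg_vals, neg_smul,
    one_smul, neg_neg, sub_eq_add_neg, lift_m2 (ti_m2 A H), lift_m3 (ti_m3 A H), lift_m4 (ti_m4 A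
    H), lift_m32 (ti_m8 A H), lift_m21 (ti_m5 A H), push_l3 (tl_eqL2 A H), push_l21 (tl_w1 A H),
    push_l32 (tl_w4 A H), l2_top_second A.leib.eqL1, l21_top A.w1, l21_top_second A.w1, l3_top_third
    A.leib.eqL2, H.push_i, T1_map_add, T1_map_neg, T1_map_zero, T1_top, T2_map_add, T2_map_neg,
    T2_map_zero, T2_top, T3_map_add, T3_map_neg, T3_map_zero, T3_top] at E r0 r1 r2 r3 r4 ⊢
  linear_combination (norm := abel) E - r0 + r1 - r2 + r3 - r4

set_option maxHeartbeats 2000000 in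
set_option synthInstance.maxHeartbeats 200000 in
set_option synthInstance.maxSize 1000 in
theorem tl_eqL4 : (0 : MMap L' L' 5 2) = pc 2 0 1 (tl2 A p i) (tl4 A p i h) - pc 2 1 0 (tl2 A p i)
      (tl4 A p i h) + pa (P12 5) (pc 2 1 0 (tl2 A p i) (tl4 A p i h)) - pa (P123 5) (pc 2 1 0 (tl2
      A p i) (tl4 A p i h)) + pa (P1234 5) (pc 2 1 0 (tl2 A p i) (tl4 A p i h)) + pc 2 0 2 (tl3 A
      p i h) (tl3 A p i h) + pc 2 1 1 (tl3 A p i h) (tl3 A p i h) - pa (P12 5) (pc 2 1 1 (tl3 A p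
      i h) (tl3 A p i h)) + pa (P123 5) (pc 2 1 1 (tl3 A p i h) (tl3 A p i h)) + pc 2 2 0 (tl3 A p
      i h) (tl3 A p i h) - pa (P23 5) (pc 2 2 0 (tl3 A p i h) (tl3 A p i h)) + pa (P132 5) (pc 2 2
      0 (tl3 A p i h) (tl3 A p i h)) + pa (P234 5) (pc 2 2 0 (tl3 A p i h) (tl3 A p i h)) - pa
      (P1342 5) (pc 2 2 0 (tl3 A p i h) (tl3 A p i h)) + pa (P13P24 5) (pc 2 2 0 (tl3 A p i h)
      (tl3 A p i h)) + pc 2 0 3 (tl4 A p i h) (tl2 A p i) - pc 2 1 2 (tl4 A p i h) (tl2 A p i) +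
      pa (P12 5) (pc 2 1 2 (tl4 A p i h) (tl2 A p i)) + pc 2 2 1 (tl4 A p i h) (tl2 A p i) - pa
      (P23 5) (pc 2 2 1 (tl4 A p i h) (tl2 A p i)) + pa (P132 5) (pc 2 2 1 (tl4 A p i h) (tl2 A p
      i)) - pc 2 3 0 (tl4 A p i h) (tl2 A p i) + pa (P34 5) (pc 2 3 0 (tl4 A p i h) (tl2 A p i)) -
      pa (P243 5) (pc 2 3 0 (tl4 A p i h) (tl2 A p i)) + pa (P1432 5) (pc 2 3 0 (tl4 A p i h) (tl2
      A p i)) := by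
  have := (tl2_lin A H).ma
  have := (tl3_lin A H).ma
  have := (tl4_lin A H).ma
  have := (ti2_lin A H).ma
  have := (ti3_lin A H).ma
  refine ext_T5 fun a b c e f u v w x y _ _ _ _ _ ha hb hc he hf hr => ?_
  obtain ⟨rfl, rfl, rfl, rfl, rfl⟩ : a = 0 ∧ b = 0 ∧ c = 0 ∧ e = 0 ∧ f = 0 := by omega
  refine H.inj_i A ?_
  have E := congrArg (tot · ![T1 i u, T1 i v, T1 i w, T1 i x, T1 i y]) A.leib.eqL4
  simp only [T5, tot_sub, tot_add, tot_zero] at E ⊢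
  simp only [tot_five, T5_P12, T5_P123, T5_P1234, T5_P132, T5_P1342, T5_P13P24, T5_P1432, T5_P23,
    T5_P234, T5_P243, T5_P34, T5_pc_0_1, T5_pc_0_2, T5_pc_0_3, T5_pc_1_0, T5_pc_1_1, T5_pc_1_2,
    T5_pc_2_0, T5_pc_2_1, T5_pc_3_0] at E ⊢
  have r0 := push_l4 A.leib.eqL3 (T2 (ti2 A i h) u v) (T1 i w) (T1 i x) (T1 i y)
  have r1 := push_l4 A.leib.eqL3 (T1 i u) (T2 (ti2 A i h) v w) (T1 i x) (T1 i y)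
  have r2 := push_l4 A.leib.eqL3 (T1 i v) (T2 (ti2 A i h) u w) (T1 i x) (T1 i y)
  have r3 := push_l4 A.leib.eqL3 (T1 i u) (T1 i v) (T2 (ti2 A i h) w x) (T1 i y)
  have r4 := push_l4 A.leib.eqL3 (T1 i u) (T1 i w) (T2 (ti2 A i h) v x) (T1 i y)
  have r5 := push_l4 A.leib.eqL3 (T1 i v) (T1 i w) (T2 (ti2 A i h) u x) (T1 i y)
  have r6 := push_l4 A.leib.eqL3 (T1 i u) (T1 i v) (T1 i w) (T2 (ti2 A i h) x y)
  have r7 := push_l4 A.leib.eqL3 (T1 i u) (T1 i v) (T1 i x) (T2 (ti2 A i h) w y)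
  have r8 := push_l4 A.leib.eqL3 (T1 i u) (T1 i w) (T1 i x) (T2 (ti2 A i h) v y)
  have r9 := push_l4 A.leib.eqL3 (T1 i v) (T1 i w) (T1 i x) (T2 (ti2 A i h) u y)
  simp only [Int.reduceAdd, Int.reduceMul, Int.reduceNeg, Int.reduceLT, or_false, sg_vals, neg_smul,
    one_smul, neg_neg, sub_eq_add_neg, lift_m2 (ti_m2 A H), lift_m3 (ti_m3 A H), lift_m4 (ti_m4 A
    H), push_l3 (tl_eqL2 A H), push_l4 (tl_eqL3 A H), l2_top A.leib.eqL1, l2_top_second A.leib.eqL1,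
    l3_top A.leib.eqL2, l3_top_second A.leib.eqL2, l3_top_third A.leib.eqL2, H.push_i, T1_map_add,
    T1_map_neg, T1_map_zero, T1_top, T2_map_add, T2_map_neg, T2_map_zero, T2_top, T3_map_add,
    T3_map_neg, T3_map_zero, T3_top, T4_map_add, T4_map_zero,
    T4_top] at E r0 r1 r2 r3 r4 r5 r6 r7 r8 r9 ⊢
  linear_combination (norm := abel) E + r0 - r1 + r2 + r3 - r4 + r5 - r6 + r7 - r8 + r9

end WLaws

end WL3

namespace WL3

/-- **Homotopy transfer for weak Lie 3-algebras** (Proposition on homotopy transfer):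
given a weak Lie 3-algebra `(L, d, λ)` and a deformation retract `(p, i, h)` of `(L, d)`
onto a 3-term complex `(L', d')`, there is a weak Lie 3-algebra structure on `(L', d')`
such that `i` extends to a weak morphism of weak Lie 3-algebras. -/
theorem homotopy_transfer_weak_Lie3
    (k : Type) [CommRing k] {L L' : ℤ → Type}
    [∀ i, AddCommGroup (L i)] [∀ i, Module k (L i)]
    [∀ i, AddCommGroup (L' i)] [∀ i, Module k (L' i)]
    (A : WeakLie3 k L)
    (D' : MMap L' L' 1 (-1)) (hlinD' : IsMultilinear k D') (hdd' : fc1 (-2) D' D' = 0)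
    (hbound' : ∀ i : ℤ, (i < 0 ∨ 2 < i) → ∀ x : L' i, x = 0)
    (p : MMap L L' 1 0) (i : MMap L' L 1 0) (h : MMap L L 1 1)
    (hret : IsDefRetract k A.D D' p i h) :
    ∃ (B : WeakLie3 k L') (f2 : MMap L' L 2 1) (f21 : MMap L' L 2 2) (f3 : MMap L' L 3 2),
      B.D = D' ∧ IsWeakMorphism k B A i f2 f21 f3 := by
  have : Bdd L := A.bdd
  have : Bdd L' := ⟨hbound'⟩
  have := hlinD'.ma
  have := hret.linp.ma
  have := hret.lini.ma
  have := hret.linh.ma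
  let B : WeakLie3 k L' :=
    { D := D', linD := hlinD', dd := hdd', bound := hbound'
      l2 := tl2 A p i, l3 := tl3 A p i h, l4 := tl4 A p i h, l21 := tl21 A p i
      l211 := tl211 A p i, l31 := tl31 A p i h, l32 := tl32 A p i h
      leib := ⟨tl2_lin A hret, tl3_lin A hret, tl4_lin A hret, tl_eqL1 A hret, tl_eqL2 A hret,
        tl_eqL3 A hret, tl_eqL4 A hret⟩
      lin21 := tl21_lin A hret, lin211 := tl211_lin A hret, lin31 := tl31_lin A hret
      lin32 := tl32_lin A hret
      w1 := tl_w1 A hret, w2 := tl_w2 A hret, w3 := tl_w3 A hret, w4 := tl_w4 A hret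
      w5 := tl_w5 A hret, w6 := tl_w6 A hret, w7 := tl_w7 A hret, w8 := tl_w8 A hret
      w9 := tl_w9 A hret, w10 := tl_w10 A hret, w11 := tl_w11 A hret }
  exact ⟨B, ti2 A i h, ti21 A i h, ti3 A i h, rfl, hret.lini, ti2_lin A hret, ti21_lin A hret,
    ti3_lin A hret, ti_m1 A hret, ti_m2 A hret, ti_m3 A hret, ti_m4 A hret, ti_m5 A hret,
    ti_m6 A hret, ti_m7 A hret, ti_m8 A hret⟩

end WL3
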